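/- Assume either (a) d ≠ 0 and (s,ε) ∈ S[d], or (b) d = 0 and (s,ε) ∈ S (in case (b) read Y(s,ε) and Y_<(s,ε) for Y(s,ε)[d] and Y_<(s,ε)[d]). Then for every f ∈ Y(s,ε)[d] with f ∉ Y_<(s,ε)[d], the smallest Sp(V)-stable k-subspace of k[V] containing f equals Y(s,ε)[d]; that is, any such f generates Y(s,ε)[d] as a kSp(V)-module. -/

import Mathlib

open scoped Classical

noncomputable section

/-- The `2m`-dimensional standard symplectic space over `k = F_q = GaloisField p t`:
pairs `(x,y)` of `m`-tuples; the coordinates are `x_i(v) = v.1 i`, `y_i(v) = v.2 i`. -/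
abbrev SympV (p t m : ℕ) [Fact p.Prime] : Type :=
  (Fin m → GaloisField p t) × (Fin m → GaloisField p t)

/-- The nonsingular alternating bilinear form
`⟨(x,y),(x',y')⟩ = Σ_i (x_i y'_i − y_i x'_i)`. -/
def sform {p t m : ℕ} [Fact p.Prime] (v w : SympV p t m) : GaloisField p t :=
  ∑ i, (v.1 i * w.2 i - v.2 i * w.1 i)

/-- Membership in the symplectic group `Sp(V)`: a linear automorphism of `V`
preserving the form. -/
def IsSymp {p t m : ℕ} [Fact p.Prime]
    (g : SympV p t m ≃ₗ[GaloisField p t] SympV p t m) : Prop :=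
  ∀ v w, sform (g v) (g w) = sform v w

/-- A `k`-subspace `M` of `k[V]` is `Sp(V)`-stable (a `kSp(V)`-submodule) if it is
closed under the action `(g·f)(v) = f(g⁻¹v)`. -/
def SpStable {p t m : ℕ} [Fact p.Prime]
    (M : Submodule (GaloisField p t) (SympV p t m → GaloisField p t)) : Prop :=
  ∀ g : SympV p t m ≃ₗ[GaloisField p t] SympV p t m, IsSymp g →
    ∀ h ∈ M, (fun v => h (g.symm v)) ∈ M

/-- The monomial `x^α y^β = ∏_i x_i^{α_i} y_i^{β_i}` as a function `V → k`. -/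
def mono {p t m : ℕ} [Fact p.Prime] (α β : Fin m → ℕ) :
    SympV p t m → GaloisField p t :=
  fun v => ∏ i, (v.1 i ^ α i * v.2 i ^ β i)

/-- The complementary multi-index `ᾱ = (p−1−α₁,…,p−1−α_m)`. -/
def abar (p : ℕ) {m : ℕ} (α : Fin m → ℕ) : Fin m → ℕ := fun i => p - 1 - α i

/-- `α! = ∏_i α_i!`, computed in the prime field `F_p ⊆ k`. -/
def factk (p t : ℕ) [Fact p.Prime] {m : ℕ} (α : Fin m → ℕ) : GaloisField p t :=
  ∏ i, ((α i).factorial : GaloisField p t)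

/-- Allowable `j`-th digit of a symplectic basis function, of degree `lam`;
`pl` records whether this digit counts towards the signature (a monomial
`x^α y^{ᾱ}` or a '+' binomial when `lam = m(p−1)`). -/
def IsDigit (p t m lam : ℕ) [Fact p.Prime] (pl : Prop)
    (g : SympV p t m → GaloisField p t) : Prop :=
  (lam ≠ m * (p - 1) ∧ ¬pl ∧
    ∃ α β : Fin m → ℕ, (∀ i, α i ≤ p - 1) ∧ (∀ i, β i ≤ p - 1) ∧
      (∑ i, α i) + (∑ i, β i) = lam ∧ g = mono α β) ∨
  (lam = m * (p - 1) ∧ pl ∧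
    ∃ α : Fin m → ℕ, (∀ i, α i ≤ p - 1) ∧ g = mono α (abar p α)) ∨
  (lam = m * (p - 1) ∧
    ∃ α β : Fin m → ℕ, (∀ i, α i ≤ p - 1) ∧ (∀ i, β i ≤ p - 1) ∧
      (∑ i, α i) + (∑ i, β i) = m * (p - 1) ∧ β ≠ abar p α ∧
      g = mono α β +
        ((if pl then (1 : GaloisField p t) else -1) *
          ((-1) ^ ((∑ i, β i) + m) * factk p t α * factk p t β)) •
            mono (abar p β) (abar p α))

/-- `f` is a symplectic basis function of type `λ` with signature `ε`:
`f = f₀·f₁^p⋯f_{t−1}^{p^{t−1}}` with every digit `f_j` allowable of degree `λ_j`,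
and `ε` is the set of digits of '+' kind. -/
def IsSBF (p t m : ℕ) [Fact p.Prime] (lam : Fin t → ℕ) (eps : Finset (Fin t))
    (f : SympV p t m → GaloisField p t) : Prop :=
  ∃ g : Fin t → (SympV p t m → GaloisField p t),
    (∀ j, IsDigit p t m (lam j) (j ∈ eps) (g j)) ∧
    f = fun v => ∏ j, (g j v) ^ (p ^ (j : ℕ))

/-- The `j`-th `p`-adic digit of `d`. -/
def digitp (p d j : ℕ) : ℕ := d / p ^ j % p

/-- The type `λ` attached to a tuple `s` (for `d`): `λ_j = p·s_{j+1} − s_j + d_j`,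
indices mod `t`. -/
def lamOf (p t d : ℕ) [NeZero t] (s : Fin t → ℤ) (j : Fin t) : ℤ :=
  (p : ℤ) * s (j + 1) - s j + digitp p d (j : ℕ)

/-- The type of `s` as a tuple of naturals. -/
def lamOfN (p t d : ℕ) [NeZero t] (s : Fin t → ℤ) (j : Fin t) : ℕ :=
  (lamOf p t d s j).toNat

/-- Membership in `H[d]`: `0 ≤ s_j ≤ 2m−1` and `0 ≤ λ_j ≤ 2m(p−1)` for all `j`. -/
def memHd (p t m d : ℕ) [NeZero t] (s : Fin t → ℤ) : Prop :=
  (∀ j, 0 ≤ s j ∧ s j ≤ 2 * m - 1) ∧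
  (∀ j, 0 ≤ lamOf p t d s j ∧ lamOf p t d s j ≤ 2 * m * ((p : ℤ) - 1))

/-- Membership in `H`: `1 ≤ s_j ≤ 2m−1` and `0 ≤ p·s_{j+1} − s_j ≤ 2m(p−1)`. -/
def memH (p t m : ℕ) [NeZero t] (s : Fin t → ℤ) : Prop :=
  (∀ j, 1 ≤ s j ∧ s j ≤ 2 * m - 1) ∧
  (∀ j, 0 ≤ lamOf p t 0 s j ∧ lamOf p t 0 s j ≤ 2 * m * ((p : ℤ) - 1))

/-- `J(s) = {j : λ_j = m(p−1)}`. -/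
def Jset (p t m d : ℕ) [NeZero t] (s : Fin t → ℤ) : Finset (Fin t) :=
  Finset.univ.filter (fun j => lamOf p t d s j = m * ((p : ℤ) - 1))

/-- Membership in `S[d]`: `s ∈ H[d]` and `ε ⊆ J(s)`. -/
def memSd (p t m d : ℕ) [NeZero t] (s : Fin t → ℤ) (eps : Finset (Fin t)) : Prop :=
  memHd p t m d s ∧ eps ⊆ Jset p t m d s

/-- Membership in `S`: `s ∈ H` and `ε ⊆ J(s)` (with `d = 0`). -/
def memS (p t m : ℕ) [NeZero t] (s : Fin t → ℤ) (eps : Finset (Fin t)) : Prop :=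
  memH p t m s ∧ eps ⊆ Jset p t m 0 s

/-- Case distinction: for `d ≠ 0` the relevant poset is `S[d]`, for `d = 0` it is `S`. -/
def memCase (p t m d : ℕ) [NeZero t] (s : Fin t → ℤ) (eps : Finset (Fin t)) : Prop :=
  if d = 0 then memS p t m s eps else memSd p t m d s eps

/-- `Z(s',s) = {j : s'_j = s_j, s'_{j+1} = s_{j+1}, λ'_j = m(p−1)}`. -/
def Zset (p t m d : ℕ) [NeZero t] (s' s : Fin t → ℤ) : Finset (Fin t) :=
  Finset.univ.filter (fun j =>
    s' j = s j ∧ s' (j + 1) = s (j + 1) ∧ lamOf p t d s' j = m * ((p : ℤ) - 1))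

/-- The order on `S[d]` (and on `S`): `(s',ε') ≤ (s,ε)` iff `s' ≤ s` pointwise and
`ε ∩ Z(s',s) = ε' ∩ Z(s',s)`. -/
def leSd (p t m d : ℕ) [NeZero t] (s' : Fin t → ℤ) (eps' : Finset (Fin t))
    (s : Fin t → ℤ) (eps : Finset (Fin t)) : Prop :=
  (∀ j, s' j ≤ s j) ∧ eps ∩ Zset p t m d s' s = eps' ∩ Zset p t m d s' s

/-- `Y(s,ε)[d]` (for `d ≠ 0`), resp. `Y(s,ε)` (for `d = 0`): the span in `k[V]` of all
symplectic basis functions with signed `H`-type `(s',ε') ≤ (s,ε)` in `S[d]`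
(resp. in `S`). -/
def Ymod (p t m d : ℕ) [Fact p.Prime] [NeZero t] (s : Fin t → ℤ)
    (eps : Finset (Fin t)) :
    Submodule (GaloisField p t) (SympV p t m → GaloisField p t) :=
  Submodule.span (GaloisField p t)
    {f | ∃ s' eps', memCase p t m d s' eps' ∧ leSd p t m d s' eps' s eps ∧
      IsSBF p t m (lamOfN p t d s') eps' f}

/-- `Y_<(s,ε)[d]`: the span of the symplectic basis functions with signed `H`-type
strictly below `(s,ε)`. -/
def Yltmod (p t m d : ℕ) [Fact p.Prime] [NeZero t] (s : Fin t → ℤ)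
    (eps : Finset (Fin t)) :
    Submodule (GaloisField p t) (SympV p t m → GaloisField p t) :=
  Submodule.span (GaloisField p t)
    {f | ∃ s' eps', memCase p t m d s' eps' ∧ leSd p t m d s' eps' s eps ∧
      ¬(s' = s ∧ eps' = eps) ∧ IsSBF p t m (lamOfN p t d s') eps' f}


noncomputable section
set_option linter.unusedSectionVars false
set_option linter.unusedSimpArgs false

abbrev Sg (m : ℕ) : Type := Fin m ⊕ Fin m
abbrev Pol (K : Type) [Field K] (m : ℕ) : Type := MvPolynomial (Sg m) K
abbrev Ex (m : ℕ) : Type := Sg m →₀ ℕ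

/-- reduced exponents -/
def Red (p : ℕ) {m : ℕ} (e : Ex m) : Prop := ∀ z, e z ≤ p - 1

/-- the flip -/
def flp (p : ℕ) {m : ℕ} (e : Ex m) : Ex m :=
  Finsupp.equivFunOnFinite.symm (fun z => p - 1 - e z.swap)

/-- the coefficient -/
def cf (K : Type) [Field K] {m : ℕ} (e : Ex m) : K :=
  (-1) ^ ((∑ i, e (Sum.inr i)) + m) * ∏ z, ((e z).factorial : K)

def redL (K : Type) [Field K] (p m : ℕ) : Pol K m →ₗ[K] Pol K m :=
  (MvPolynomial.basisMonomials (Sg m) K).constr K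
    (fun e => if Red p e then MvPolynomial.monomial e 1 else 0)

def tauL (K : Type) [Field K] (p m : ℕ) : Pol K m →ₗ[K] Pol K m :=
  (MvPolynomial.basisMonomials (Sg m) K).constr K
    (fun e => if Red p e then MvPolynomial.monomial (flp p e) (cf K e) else 0)

def sgn (K : Type) [Field K] {m : ℕ} (z : Sg m) : K := Sum.elim (fun _ => 1) (fun _ => -1) z

def dd (K : Type) [Field K] {m : ℕ} (z : Sg m) : Pol K m →ₗ[K] Pol K m :=
  sgn K z • (MvPolynomial.pderiv z.swap).toLinearMap

section P1
open MvPolynomial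
variable {K : Type} [Field K] {p m : ℕ}

@[simp] lemma flp_apply (e : Ex m) (z : Sg m) : flp p e z = p - 1 - e z.swap := rfl

lemma red_flp (e : Ex m) : Red p (flp p e) := fun z => by simp

lemma flp_flp {e : Ex m} (h : Red p e) : flp p (flp p e) = e := by
  ext z; have := h z; simp; omega

lemma constr_monomial (φ : Ex m → Pol K m) (e : Ex m) (c : K) :
    (MvPolynomial.basisMonomials (Sg m) K).constr K φ (monomial e c) = c • φ e := by
  have : (monomial e c : Pol K m) = c • MvPolynomial.basisMonomials (Sg m) K e := by
    simp [MvPolynomial.coe_basisMonomials, smul_monomial]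
  rw [this, map_smul, Module.Basis.constr_basis]

lemma redL_monomial (e : Ex m) (c : K) :
    redL K p m (monomial e c) = if Red p e then monomial e c else 0 := by
  unfold redL; rw [constr_monomial]; split_ifs <;> simp [smul_monomial]

lemma tauL_monomial (e : Ex m) (c : K) :
    tauL K p m (monomial e c) = if Red p e then monomial (flp p e) (c * cf K e) else 0 := by
  unfold tauL; rw [constr_monomial]; split_ifs <;> simp [smul_monomial]

lemma dd_monomial (z : Sg m) (e : Ex m) (c : K) :
    dd K z (monomial e c) = monomial (e - Finsupp.single z.swap 1) (sgn K z * (c * e z.swap)) := by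
  simp [dd, pderiv_monomial, smul_monomial]

/-- linear maps out of Pol agree if they agree on monomials -/
lemma lin_ext {V : Type*} [AddCommGroup V] [Module K V] {f g : Pol K m →ₗ[K] V}
    (h : ∀ e c, f (monomial e c) = g (monomial e c)) (x : Pol K m) : f x = g x := by
  induction x using MvPolynomial.induction_on' with
  | monomial e c => exact h e c
  | add a b ha hb => rw [map_add, map_add, ha, hb]

lemma redL_redL (f : Pol K m) : redL K p m (redL K p m f) = redL K p m f := by
  refine lin_ext (f := redL K p m ∘ₗ redL K p m) (g := redL K p m) (fun e c => ?_) f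
  simp only [LinearMap.comp_apply, redL_monomial]; split_ifs with h
  · rw [redL_monomial, if_pos h]
  · simp

lemma tauL_redL (f : Pol K m) : tauL K p m (redL K p m f) = tauL K p m f := by
  refine lin_ext (f := tauL K p m ∘ₗ redL K p m) (g := tauL K p m) (fun e c => ?_) f
  simp only [LinearMap.comp_apply, redL_monomial, tauL_monomial]; split_ifs with h
  · rw [tauL_monomial, if_pos h]
  · simp

lemma redL_tauL (f : Pol K m) : redL K p m (tauL K p m f) = tauL K p m f := by
  refine lin_ext (f := redL K p m ∘ₗ tauL K p m) (g := tauL K p m) (fun e c => ?_) f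
  simp only [LinearMap.comp_apply, tauL_monomial]; split_ifs with h
  · rw [redL_monomial, if_pos (red_flp e)]
  · simp

lemma sgn_swap (z : Sg m) : sgn K z.swap = - sgn K z := by cases z <;> simp [sgn]
lemma sgn_sq (z : Sg m) : sgn K z * sgn K z = 1 := by cases z <;> simp [sgn]
lemma sgn_ne (z : Sg m) : sgn K z ≠ 0 := by cases z <;> simp [sgn]

lemma not_red_iff (e : Ex m) (hp : 0 < p) : ¬ Red p e ↔ ∃ z, p ≤ e z := by
  simp only [Red, not_forall, not_le]
  exact exists_congr (fun z => by omega)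

lemma redL_X_pow_mul (hp : 0 < p) (z : Sg m) (f : Pol K m) : redL K p m (X z ^ p * f) = 0 := by
  have : ∀ f, redL K p m (X z ^ p * f) = 0 := by
    intro f
    induction f using MvPolynomial.induction_on' with
    | monomial e c =>
      rw [X_pow_eq_monomial, monomial_mul, redL_monomial, if_neg]
      rw [not_red_iff _ hp]; exact ⟨z, by simp⟩
    | add a b ha hb => rw [mul_add, map_add, ha, hb, add_zero]
  exact this f

/-- red (g * f) = red (g * red f) -/
lemma redL_mul_redL (g f : Pol K m) : redL K p m (g * redL K p m f) = redL K p m (g * f) := by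
  induction g using MvPolynomial.induction_on' with
  | add a b ha hb => simp only [add_mul, map_add, ha, hb]
  | monomial e c =>
    refine lin_ext (f := redL K p m ∘ₗ LinearMap.mulLeft K (monomial e c) ∘ₗ redL K p m)
      (g := redL K p m ∘ₗ LinearMap.mulLeft K (monomial e c)) (fun e' c' => ?_) f
    simp only [LinearMap.comp_apply, redL_monomial, LinearMap.mulLeft_apply]
    split_ifs with h
    · rw [monomial_mul, redL_monomial]
    · rw [monomial_mul, redL_monomial, if_neg, mul_zero, map_zero]
      intro h2; apply h; intro z; have := h2 z; simp at this; omega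

variable [hpp : Fact p.Prime] [hch : CharP K p]

/-- red (∂ f) = red (∂ (red f)) -/
lemma redL_dd_redL (z : Sg m) (f : Pol K m) :
    redL K p m (dd K z (redL K p m f)) = redL K p m (dd K z f) := by
  refine lin_ext (f := redL K p m ∘ₗ dd K z ∘ₗ redL K p m)
      (g := redL K p m ∘ₗ dd K z) (fun e c => ?_) f
  simp only [LinearMap.comp_apply, redL_monomial]
  split_ifs with h
  · rfl
  · rw [dd_monomial, redL_monomial, map_zero, map_zero]
    split_ifs with h2
    · have : (e z.swap : K) = 0 := by
        rw [CharP.cast_eq_zero_iff K p]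
        have hz : e z.swap = p := by
          rw [not_red_iff _ hpp.out.pos] at h
          obtain ⟨w, hw⟩ := h
          have h3 := h2 w
          have := hpp.out.pos
          by_cases hwz : z.swap = w
          · subst hwz; simp at h3; omega
          · simp [Finsupp.single_apply, hwz] at h3; omega
        rw [hz]
      simp [this]
    · rfl

/-- red (∂ f) when f reduced is ∂ f -/
lemma dd_red_red (z : Sg m) (f : Pol K m) :
    redL K p m (dd K z (redL K p m f)) = dd K z (redL K p m f) := by
  refine lin_ext (f := redL K p m ∘ₗ dd K z ∘ₗ redL K p m)
      (g := dd K z ∘ₗ redL K p m) (fun e c => ?_) f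
  simp only [LinearMap.comp_apply, redL_monomial]
  split_ifs with h
  · rw [dd_monomial, redL_monomial, if_pos]
    intro w; have := h w; simp; omega
  · simp

lemma cast_p_sub (a : ℕ) (h : a ≤ p - 1) : ((p - 1 - a : ℕ) : K) = - (a + 1) := by
  have h1 : ((p - 1 - a : ℕ) : K) + (a + 1) = (p : K) := by
    have := hpp.out.pos
    exact_mod_cast congrArg (Nat.cast (R := K)) (show p - 1 - a + (a + 1) = p by omega)
  rw [CharP.cast_eq_zero K p] at h1
  linear_combination h1

lemma cf_add_single (e : Ex m) (z : Sg m) :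
    cf K (e + Finsupp.single z 1) = sgn K z * (e z + 1) * cf K e := by
  unfold cf
  have h1 : ∏ w, (((e + Finsupp.single z 1 : Ex m) w).factorial : K)
      = (e z + 1) * ∏ w, ((e w).factorial : K) := by
    rw [← Finset.mul_prod_erase Finset.univ _ (Finset.mem_univ z),
      ← Finset.mul_prod_erase Finset.univ (fun w => ((e w).factorial : K)) (Finset.mem_univ z)]
    rw [← mul_assoc]
    congr 1
    · simp [Nat.factorial_succ]
    · apply Finset.prod_congr rfl
      intro w hw
      have : z ≠ w := (Finset.ne_of_mem_erase hw).symm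
      simp [Finsupp.single_apply, this]
  rw [h1]
  cases z with
  | inl i => simp [sgn, Finsupp.single_apply]; ring
  | inr i =>
    have : ∑ k, (e + Finsupp.single (Sum.inr i) 1 : Ex m) (Sum.inr k) = (∑ k, e (Sum.inr k)) + 1 := by
      simp [Finset.sum_add_distrib, Finsupp.single_apply]
    rw [this]; simp [sgn]; ring

lemma tauL_X_mul (z : Sg m) (f : Pol K m) :
    tauL K p m (X z * f) = - dd K z (tauL K p m f) := by
  refine lin_ext (f := tauL K p m ∘ₗ LinearMap.mulLeft K (X z))
      (g := -(dd K z ∘ₗ tauL K p m)) (fun e c => ?_) f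
  simp only [LinearMap.comp_apply, LinearMap.mulLeft_apply, LinearMap.neg_apply, tauL_monomial,
    X, monomial_mul]
  have hp := hpp.out.two_le
  by_cases h : Red p e
  · rw [if_pos h, dd_monomial]
    have hez := h z
    by_cases h2 : e z = p - 1
    · rw [if_neg]
      · simp [h2]
      · intro h3; have := h3 z; simp [h2] at this; try omega
    · rw [if_pos, ← map_neg]
      · have e1 : flp p (Finsupp.single z 1 + e) = flp p e - Finsupp.single z.swap 1 := by
          ext w; simp only [flp_apply, Finsupp.coe_add, Pi.add_apply, Finsupp.coe_tsub, Pi.sub_apply,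
            Finsupp.single_apply]
          have : z = w.swap ↔ z.swap = w := by
            constructor
            · rintro rfl; simp
            · rintro rfl; simp
          by_cases h3 : z = w.swap
          · rw [if_pos h3, if_pos (this.1 h3)]; omega
          · rw [if_neg h3, if_neg (fun h => h3 (this.2 h))]; try omega
        rw [e1, add_comm (Finsupp.single z 1), cf_add_single]
        congr 1
        rw [flp_apply, Sum.swap_swap, cast_p_sub _ hez]
        ring
      · intro w; have := h w
        by_cases h3 : z = w
        · subst h3; simp; omega
        · simp [Finsupp.single_apply, h3]; omega
  · rw [if_neg h, if_neg, map_zero, neg_zero]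
    intro h2; apply h; intro w; have := h2 w; simp at this; omega

lemma fact_mul_fact (a : ℕ) (h : a ≤ p - 1) :
    ((a.factorial : K)) * ((p - 1 - a).factorial : K) = (-1) ^ (a + 1) := by
  induction a with
  | zero =>
    have := ZMod.wilsons_lemma p
    have h2 := congrArg (ZMod.castHom (dvd_refl p) K) this
    rw [map_natCast, map_neg, map_one] at h2
    simpa using h2
  | succ a ih =>
    have ih := ih (by omega)
    have h1 : p - 1 - a = (p - 1 - (a + 1)) + 1 := by omega
    have h2 : ((p - 1 - (a+1) : ℕ) : K) + 1 = - (a + 1) := by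
      have := cast_p_sub (K := K) a (by omega : a ≤ p - 1)
      rw [h1] at this; exact_mod_cast this
    rw [h1, Nat.factorial_succ] at ih
    rw [Nat.factorial_succ]
    push_cast at ih ⊢
    rw [h2] at ih
    rw [pow_succ, ← ih]; ring

lemma cf_flp {e : Ex m} (h : Red p e) : cf K (flp p e) * cf K e = 1 := by
  have h1 : (∏ z, (((flp p e) z).factorial : K)) * ∏ z, ((e z).factorial : K)
      = ∏ z, (-1 : K) ^ (e z + 1) := by
    have : ∏ z, (((flp p e) z).factorial : K) = ∏ z, ((p - 1 - e z).factorial : K) := by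
      apply Fintype.prod_equiv (Equiv.sumComm (Fin m) (Fin m))
      intro z; simp
    rw [this, ← Finset.prod_mul_distrib]
    apply Finset.prod_congr rfl
    intro z _; rw [mul_comm, fact_mul_fact _ (h z)]
  unfold cf
  rw [mul_mul_mul_comm, h1, Finset.prod_pow_eq_pow_sum, ← pow_add, ← pow_add]
  rcases hpp.out.eq_two_or_odd' with h2 | h2
  · subst h2; rw [CharTwo.neg_eq, one_pow]
  · have e1 : ∀ i, (flp p e) (Sum.inr i) + e (Sum.inl i) = p - 1 := fun i => by
      have := h (Sum.inl i); simp at this ⊢; omega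
    have e2 : ∑ i, (flp p e) (Sum.inr i) + ∑ i, e (Sum.inl i) = m * (p - 1) := by
      rw [← Finset.sum_add_distrib, Finset.sum_congr rfl (fun i _ => e1 i)]; simp
    obtain ⟨k, hk⟩ := h2
    have e3 : m * (p - 1) = 2 * (m * k) := by rw [hk]; simp; ring
    rw [e3] at e2
    apply Even.neg_one_pow
    rw [Fintype.sum_sum_type]
    simp only [Finset.sum_add_distrib]
    simp only [Finset.sum_const, Finset.card_univ, Fintype.card_fin, smul_eq_mul, mul_one]
    rw [Nat.even_iff]; omega

lemma tauL_tauL (f : Pol K m) : tauL K p m (tauL K p m f) = redL K p m f := by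
  refine lin_ext (f := tauL K p m ∘ₗ tauL K p m) (g := redL K p m) (fun e c => ?_) f
  simp only [LinearMap.comp_apply, tauL_monomial, redL_monomial]; split_ifs with h
  · rw [tauL_monomial, if_pos (red_flp e), flp_flp h, mul_assoc, mul_comm (cf K e), cf_flp h, mul_one]
  · simp

lemma tauL_dd (z : Sg m) (f : Pol K m) :
    tauL K p m (dd K z f) = - redL K p m (X z * tauL K p m f) := by
  have h1 := tauL_X_mul (p := p) z (tauL K p m f)
  rw [tauL_tauL] at h1
  have h2 : dd K z (redL K p m f) = - tauL K p m (X z * tauL K p m f) := by rw [h1]; simp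
  rw [← tauL_redL (dd K z f), ← redL_dd_redL, tauL_redL, h2, map_neg, tauL_tauL]

/-- the coefficient on fixed points -/
lemma cf_fixed (e : Ex m) (hr : Red p e) (h : flp p e = e) : cf K e = 1 := by
  have h0 : ∀ i, e (Sum.inr i) = p - 1 - e (Sum.inl i) := fun i => by
    have := DFunLike.congr_fun h (Sum.inr i); simpa using this.symm
  unfold cf
  rw [Fintype.prod_sum_type, ← Finset.prod_mul_distrib]
  have : ∀ i ∈ Finset.univ, ((e (Sum.inl i)).factorial : K) * ((e (Sum.inr i)).factorial : K)
      = (-1) ^ (e (Sum.inr i) + 1) := fun i _ => by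
    have h1 := fact_mul_fact (K := K) (e (Sum.inr i)) (hr _)
    have h2 : p - 1 - e (Sum.inr i) = e (Sum.inl i) := by
      have := h0 i; have := hr (Sum.inl i); omega
    rw [h2] at h1; rw [mul_comm, h1]
  rw [Finset.prod_congr rfl this, Finset.prod_pow_eq_pow_sum, Finset.sum_add_distrib, ← pow_add]
  apply Even.neg_one_pow
  simp

end P1
end


noncomputable section
set_option linter.unusedSectionVars false
set_option linter.unusedSimpArgs false

def lform (K : Type) [Field K] {m : ℕ} (a : Sg m → K) : Pol K m :=
  ∑ w, MvPolynomial.C (a w) * MvPolynomial.X w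

def phi {K : Type} [Field K] {m : ℕ} (A : Matrix (Sg m) (Sg m) K) : Pol K m →ₐ[K] Pol K m :=
  MvPolynomial.aeval (fun z => lform K (A z))

def Om (p m : ℕ) : Ex m := Finsupp.equivFunOnFinite.symm (fun _ => p - 1)

section P2
open MvPolynomial
variable {K : Type} [Field K] {p m : ℕ}

lemma coeff_redL (f : Pol K m) (e : Ex m) :
    coeff e (redL K p m f) = if Red p e then coeff e f else 0 := by
  induction f using MvPolynomial.induction_on' with
  | add a b ha hb => rw [map_add, coeff_add, ha, hb, coeff_add]; split_ifs <;> simp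
  | monomial e' c =>
    rw [redL_monomial]
    by_cases h : e' = e
    · subst h; split_ifs <;> simp
    · split_ifs <;> simp [coeff_monomial, h]

lemma redL_eq_self_iff (f : Pol K m) : redL K p m f = f ↔ ∀ e ∈ f.support, Red p e := by
  constructor
  · intro h e he
    by_contra h2
    rw [mem_support_iff, ← h, coeff_redL, if_neg h2] at he
    exact he rfl
  · intro h; ext e; rw [coeff_redL]; split_ifs with h2
    · rfl
    · by_contra h3
      exact h2 (h e (by rw [mem_support_iff]; exact Ne.symm h3))

lemma phi_X (A : Matrix (Sg m) (Sg m) K) (z : Sg m) : phi A (X z) = lform K (A z) := by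
  simp [phi]

lemma lform_homog (a : Sg m → K) : (lform K a).IsHomogeneous 1 := by
  unfold lform
  apply IsHomogeneous.sum
  intro w _
  exact isHomogeneous_C_mul_X (a w) w

lemma phi_homog (A : Matrix (Sg m) (Sg m) K) {f : Pol K m} {n : ℕ} (h : f.IsHomogeneous n) :
    (phi A f).IsHomogeneous n := by
  have := h.aeval (fun z => lform K (A z)) (n := 1) (fun z => lform_homog _)
  rw [one_mul] at this; exact this

lemma phi_phi (A B : Matrix (Sg m) (Sg m) K) (f : Pol K m) : phi A (phi B f) = phi (B * A) f := by
  have : (phi A).comp (phi B) = phi (B * A) := by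
    apply MvPolynomial.algHom_ext
    intro z
    simp only [AlgHom.comp_apply, phi_X, lform, map_sum, map_mul, algHom_C]
    simp only [Matrix.mul_apply, Finset.mul_sum, map_sum, Finset.sum_mul]
    rw [Finset.sum_comm]
    apply Finset.sum_congr rfl; intro i _
    apply Finset.sum_congr rfl; intro j _
    simp [mul_assoc, MvPolynomial.algebraMap_eq]
  exact DFunLike.congr_fun this f

lemma phi_one (f : Pol K m) : phi (1 : Matrix (Sg m) (Sg m) K) f = f := by
  have : phi (1 : Matrix (Sg m) (Sg m) K) = AlgHom.id K _ := by
    apply MvPolynomial.algHom_ext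
    intro z
    rw [phi_X]; unfold lform
    simp [Matrix.one_apply]
  rw [this]; rfl

lemma eval_lform (v : Sg m → K) (a : Sg m → K) : eval v (lform K a) = ∑ w, a w * v w := by
  simp [lform]

lemma eval_phi (A : Matrix (Sg m) (Sg m) K) (v : Sg m → K) (f : Pol K m) :
    eval v (phi A f) = eval (A.mulVec v) f := by
  induction f using MvPolynomial.induction_on with
  | C c => simp
  | add a b ha hb => simp only [map_add, ha, hb]
  | mul_X a z ha => simp only [map_mul, ha, phi_X, eval_lform, eval_X, Matrix.mulVec, dotProduct]

variable [hpp : Fact p.Prime] [hch : CharP K p]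

lemma redL_lform_pow_mul (a : Sg m → K) (f : Pol K m) :
    redL K p m (lform K a ^ p * f) = 0 := by
  have : ExpChar (Pol K m) p := ExpChar.prime hpp.out
  unfold lform
  rw [sum_pow_char p, Finset.sum_mul, map_sum]
  apply Finset.sum_eq_zero
  intro w _
  rw [mul_pow, ← C_pow, mul_assoc, ← smul_eq_C_mul, map_smul, redL_X_pow_mul hpp.out.pos, smul_zero]

lemma redL_phi_redL (A : Matrix (Sg m) (Sg m) K) (f : Pol K m) :
    redL K p m (phi A (redL K p m f)) = redL K p m (phi A f) := by
  refine lin_ext (f := redL K p m ∘ₗ (phi A).toLinearMap ∘ₗ redL K p m)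
      (g := redL K p m ∘ₗ (phi A).toLinearMap) (fun e c => ?_) f
  simp only [LinearMap.comp_apply, redL_monomial, AlgHom.toLinearMap_apply]
  split_ifs with h
  · rfl
  · rw [map_zero, map_zero]
    rw [not_red_iff _ hpp.out.pos] at h
    obtain ⟨z, hz⟩ := h
    have : (monomial e c : Pol K m) = X z ^ p * monomial (e - Finsupp.single z p) c := by
      have he : Finsupp.single z p + (e - Finsupp.single z p) = e := by
        ext w; by_cases hw : z = w
        · subst hw; simp; omega
        · simp [Finsupp.single_apply, hw]
      rw [X_pow_eq_monomial, monomial_mul, one_mul, he]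
    rw [this, map_mul, map_pow, phi_X, redL_lform_pow_mul]

lemma red_top {e : Ex m} (h : Red p e) (hd : e.degree = (Om p m).degree) : e = Om p m := by
  have h1 : ∀ z ∈ Finset.univ, e z ≤ Om p m z := fun z _ => h z
  have h2 : ∑ z, e z = ∑ z, Om p m z := by
    rwa [Finsupp.degree_eq_sum, Finsupp.degree_eq_sum] at hd
  ext z
  exact (Finset.sum_eq_sum_iff_of_le h1).1 h2 z (Finset.mem_univ z)

lemma redL_top {f : Pol K m} (h : f.IsHomogeneous (Om p m).degree) :
    redL K p m f = monomial (Om p m) (coeff (Om p m) f) := by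
  ext e
  rw [coeff_redL, coeff_monomial]
  have hO : Red p (Om p m) := fun z => le_refl _
  by_cases h1 : Om p m = e
  · subst h1; simp [hO]
  · rw [if_neg h1]; split_ifs with h2
    · exact h.coeff_eq_zero (fun h3 => h1 (red_top h2 h3).symm)
    · rfl

lemma Om_homog : (monomial (Om p m) (1:K)).IsHomogeneous (Om p m).degree :=
  isHomogeneous_monomial _ rfl

def chi (K : Type) [Field K] (p m : ℕ) (A : Matrix (Sg m) (Sg m) K) : K :=
  coeff (Om p m) (phi A (monomial (Om p m) 1))

lemma redL_phi_Om (A : Matrix (Sg m) (Sg m) K) :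
    redL K p m (phi A (monomial (Om p m) 1)) = monomial (Om p m) (chi K p m A) :=
  redL_top (phi_homog A Om_homog)

lemma chi_mul (A B : Matrix (Sg m) (Sg m) K) : chi K p m (A * B) = chi K p m A * chi K p m B := by
  have h := redL_phi_Om (p := p) (A * B)
  rw [← phi_phi, ← redL_phi_redL, redL_phi_Om] at h
  have h2 : (monomial (Om p m) (chi K p m A) : Pol K m) = chi K p m A • monomial (Om p m) 1 := by
    simp [smul_monomial]
  rw [h2, map_smul, map_smul, redL_phi_Om, smul_monomial] at h
  have h5 := congrArg (coeff (Om p m)) h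
  simpa using h5.symm

lemma chi_one : chi K p m 1 = 1 := by
  unfold chi; rw [phi_one]; simp

lemma chi_transvection (i j : Sg m) (hij : i ≠ j) (c : K) :
    chi K p m (Matrix.transvection i j c) = 1 := by
  have h1 : ∀ n : ℕ, chi K p m (Matrix.transvection i j c) ^ n
      = chi K p m (Matrix.transvection i j (n * c)) := by
    intro n
    induction n with
    | zero => simp [chi_one]
    | succ n ih =>
      rw [pow_succ, ih, ← chi_mul, Matrix.transvection_mul_transvection_same _ _ hij]
      congr 2; push_cast; ring
  have h2 := h1 p
  rw [CharP.cast_eq_zero, zero_mul, Matrix.transvection_zero, chi_one] at h2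
  have : ExpChar K p := ExpChar.prime hpp.out
  have h3 : (chi K p m (Matrix.transvection i j c) - 1) ^ p = 0 := by
    rw [sub_pow_expChar, h2]; simp
  exact sub_eq_zero.1 (pow_eq_zero_iff (hpp.out.ne_zero) |>.1 h3)

lemma chi_diagonal (D : Sg m → K) :
    chi K p m (Matrix.diagonal D) = (Matrix.diagonal D).det ^ (p - 1) := by
  have h1 : ∀ z, phi (Matrix.diagonal D) (X z) = C (D z) * X z := by
    intro z
    rw [phi_X]; unfold lform
    rw [Finset.sum_eq_single z]
    · simp
    · intro w _ hw; simp [Matrix.diagonal_apply, hw.symm]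
    · simp
  have h2 : (monomial (Om p m) (1:K) : Pol K m) = ∏ z, X z ^ (p - 1) := by
    rw [monomial_eq, Finsupp.prod_fintype]
    · simp [Om]
    · simp
  unfold chi
  rw [h2, map_prod]
  simp only [map_pow, h1, mul_pow, Finset.prod_mul_distrib, ← h2]
  rw [Matrix.det_diagonal, ← Finset.prod_pow]
  simp only [← C_pow, ← map_prod]
  rw [coeff_C_mul]; simp

lemma chi_det (A : Matrix (Sg m) (Sg m) K) : chi K p m A = A.det ^ (p - 1) := by
  apply Matrix.diagonal_transvection_induction (fun A => chi K p m A = A.det ^ (p - 1))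
  · intro D _; exact chi_diagonal D
  · rintro ⟨i, j, hij, c⟩
    simp [Matrix.TransvectionStruct.toMatrix, chi_transvection i j hij, Matrix.det_transvection_of_ne i j hij]
  · intro A B hA hB
    simp only [chi_mul, hA, hB, Matrix.det_mul, mul_pow]

/-- Symplectic condition in the form used below. -/
def SpMat (A : Matrix (Sg m) (Sg m) K) : Prop :=
  (∀ z u, ∑ w, A z w * sgn K w * A u w.swap = if u = z.swap then sgn K z else 0) ∧ A.det = 1

lemma dd_X (z w : Sg m) : dd K z (X w) = if w = z.swap then C (sgn K z) else 0 := by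
  simp only [dd, LinearMap.smul_apply, Derivation.coeFn_coe, pderiv_X, Pi.single_apply]
  split_ifs with h
  · simp [smul_eq_C_mul]
  · simp

lemma dd_mul (z : Sg m) (f g : Pol K m) : dd K z (f * g) = dd K z f * g + f * dd K z g := by
  simp only [dd, LinearMap.smul_apply, Derivation.coeFn_coe, Derivation.leibniz, smul_eq_mul, smul_add]
  simp only [smul_eq_C_mul]; ring

lemma dd_C (z : Sg m) (c : K) : dd K z (C c : Pol K m) = 0 := by
  simp [dd]

lemma dd_lform (z : Sg m) (a : Sg m → K) : dd K z (lform K a) = C (sgn K z * a z.swap) := by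
  unfold lform
  simp only [map_sum, dd_mul, dd_C, dd_X, zero_mul, zero_add]
  simp [mul_comm]

lemma dd_phi (A : Matrix (Sg m) (Sg m) K) (hA : SpMat A) (z : Sg m) (f : Pol K m) :
    ∑ w, A z w • dd K w (phi A f) = phi A (dd K z f) := by
  induction f using MvPolynomial.induction_on with
  | C c => simp [dd_C, MvPolynomial.algebraMap_eq]
  | add a b ha hb => simp only [map_add, smul_add, Finset.sum_add_distrib, ha, hb]
  | mul_X f u hf =>
    simp only [map_mul, dd_mul, phi_X, dd_lform, map_add, smul_add, Finset.sum_add_distrib,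
      ← smul_mul_assoc, ← Finset.sum_mul, hf]
    congr 1
    have h1 := hA.1 z u
    simp only [smul_mul_assoc, ← mul_smul_comm, ← Finset.mul_sum]
    congr 1
    rw [dd_X]
    have h3 : ∀ x ∈ Finset.univ, (C (sgn K x) * A z x • C (A u x.swap) : Pol K m)
        = C (A z x * sgn K x * A u x.swap) := fun x _ => by
      rw [smul_eq_C_mul, ← C_mul, ← C_mul]; congr 1; ring
    rw [Finset.sum_congr rfl h3, ← map_sum, h1]
    split_ifs <;> simp [MvPolynomial.algebraMap_eq]

lemma tauL_phi (A : Matrix (Sg m) (Sg m) K) (hA : SpMat A) (f : Pol K m) :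
    tauL K p m (phi A f) = redL K p m (phi A (tauL K p m f)) := by
  induction f using MvPolynomial.induction_on with
  | C c =>
    have h0 : Red p (0 : Ex m) := fun z => by simp
    have h1 : flp p (0 : Ex m) = Om p m := by ext z; simp [Om]
    have : (phi A (C c) : Pol K m) = C c := by simp [MvPolynomial.algebraMap_eq]
    rw [this]
    have h3 : (C c : Pol K m) = monomial 0 c := rfl
    rw [h3, tauL_monomial, if_pos h0, h1]
    have h2 : (monomial (Om p m) (c * cf K (0 : Ex m)) : Pol K m)
      = (c * cf K (0 : Ex m)) • monomial (Om p m) 1 := by simp [smul_monomial]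
    conv_rhs => rw [h2, map_smul, map_smul, redL_phi_Om, chi_det, hA.2, one_pow]
    exact h2
  | add a b ha hb => simp only [map_add, ha, hb]
  | mul_X f u hf =>
    rw [mul_comm f, map_mul, phi_X, tauL_X_mul, map_neg, map_neg, ← dd_phi A hA]
    unfold lform
    simp only [Finset.sum_mul, map_sum, ← smul_eq_C_mul, smul_mul_assoc, map_smul, tauL_X_mul, hf]
    rw [← Finset.sum_neg_distrib]
    apply Finset.sum_congr rfl
    intro w _
    rw [← redL_dd_redL, dd_red_red, smul_neg]

lemma J_apply (z w : Sg m) :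
    Matrix.J (Fin m) K z w = if w = z.swap then - sgn K z else 0 := by
  cases z <;> cases w <;> simp [Matrix.J, sgn, Matrix.one_apply, eq_comm]
  split_ifs <;> simp

lemma spMat_of_mem (A : Matrix (Sg m) (Sg m) K) (hA : A ∈ Matrix.symplecticGroup (Fin m) K) :
    SpMat A := by
  refine ⟨fun z u => ?_, SymplecticGroup.det_eq_one hA⟩
  have h := congrFun (congrFun (SymplecticGroup.mem_iff.1 hA) z) u
  rw [Matrix.mul_assoc, Matrix.mul_apply] at h
  simp only [Matrix.mul_apply, J_apply, Matrix.transpose_apply, ite_mul, zero_mul,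
    Finset.sum_ite_eq', Finset.sum_ite_eq, Finset.mem_univ, if_true] at h
  have h2 : ∑ w, A z w * sgn K w * A u w.swap = - ∑ w, A z w * (-sgn K w * A u w.swap) := by
    rw [← Finset.sum_neg_distrib]; apply Finset.sum_congr rfl; intros; ring
  rw [h2, h]; split_ifs <;> simp

end P2
end


noncomputable section
set_option linter.unusedSectionVars false
set_option linter.unusedSimpArgs false

/-- unreduced degree-preserving operator -/
def DU (K : Type) [Field K] {m : ℕ} (a b : Sg m) : Pol K m →ₗ[K] Pol K m :=
  LinearMap.mulLeft K (MvPolynomial.X a) ∘ₗ dd K b + LinearMap.mulLeft K (MvPolynomial.X b) ∘ₗ dd K a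

def DD (K : Type) [Field K] (p : ℕ) {m : ℕ} (a b : Sg m) : Pol K m →ₗ[K] Pol K m :=
  redL K p m ∘ₗ DU K a b

def TT (K : Type) [Field K] (p m : ℕ) (μ : K) : Pol K m →ₗ[K] Pol K m :=
  redL K p m + μ • tauL K p m

/-- the diagonal operators -/
def DG (K : Type) [Field K] (p : ℕ) {m : ℕ} (k : Sg m ⊕ (Fin m × Fin m)) : Pol K m →ₗ[K] Pol K m :=
  match k with
  | Sum.inl z => DD K p z.swap z.swap ∘ₗ DD K p z z
  | Sum.inr (i, k) => if i = k then 0 else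
      - (DD K p (Sum.inr i) (Sum.inr k) ∘ₗ DD K p (Sum.inl i) (Sum.inl k))
      + DD K p (Sum.inl k) (Sum.inr i) ∘ₗ DD K p (Sum.inl i) (Sum.inr k)

def ev0 (K : Type) [Field K] {m : ℕ} (k : Sg m ⊕ (Fin m × Fin m)) (e : Ex m) : K :=
  match k with
  | Sum.inl z => - 4 * (e z.swap * (e z + 1))
  | Sum.inr (i, k) => if i = k then 0 else
      (e (Sum.inl i) + e (Sum.inr i) + 1) * (e (Sum.inl k) + e (Sum.inr k)) + 2 * e (Sum.inr i)

def mv {m : ℕ} (e : Ex m) (w z : Sg m) : Ex m := e - Finsupp.single w 1 + Finsupp.single z 1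

section P3
open MvPolynomial
variable {K : Type} [Field K] {p m : ℕ}

lemma DU_apply (a b : Sg m) (f : Pol K m) : DU K a b f = X a * dd K b f + X b * dd K a f := rfl
lemma DD_apply (a b : Sg m) (f : Pol K m) :
    DD K p a b f = redL K p m (X a * dd K b f + X b * dd K a f) := rfl
lemma TT_apply (μ : K) (f : Pol K m) : TT K p m μ f = redL K p m f + μ • tauL K p m f := rfl

lemma mv_apply (e : Ex m) (w z u : Sg m) :
    mv e w z u = e u - (if w = u then 1 else 0) + (if z = u then 1 else 0) := by
  simp [mv, Finsupp.single_apply]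

lemma pderiv_comm (a b : Sg m) (f : Pol K m) : pderiv a (pderiv b f) = pderiv b (pderiv a f) := by
  induction f using MvPolynomial.induction_on' with
  | add a b ha hb => simp only [map_add, ha, hb]
  | monomial e c =>
    simp only [pderiv_monomial]
    by_cases h : a = b
    · subst h; rfl
    · simp [Finsupp.single_apply, h, Ne.symm h]
      congr 1
      · congr 1; ext u; simp; omega
      · ring

lemma euler1 (z : Sg m) (e : Ex m) (c : K) :
    X z * pderiv z (monomial e c : Pol K m) = C (e z : K) * monomial e c := by
  rw [pderiv_monomial, X, monomial_mul, C_mul_monomial]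
  by_cases h : e z = 0
  · simp [h]
  · have : Finsupp.single z 1 + (e - Finsupp.single z 1) = e := by
      ext w; by_cases hw : z = w
      · subst hw; simp; omega
      · simp [Finsupp.single_apply, hw]
    rw [this]; congr 1; ring

lemma euler2 (z w : Sg m) (h : z ≠ w) (e : Ex m) (c : K) :
    X z * X w * pderiv z (pderiv w (monomial e c : Pol K m)) = C (e z * e w : K) * monomial e c := by
  have h1 : X w * pderiv z (pderiv w (monomial e c : Pol K m))
      = pderiv z (X w * pderiv w (monomial e c : Pol K m)) := by
    rw [Derivation.leibniz, pderiv_X_of_ne (Ne.symm h)]; simp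
  rw [mul_assoc, h1, euler1, C_mul', Derivation.map_smul, mul_smul_comm, euler1, ← C_mul', ← mul_assoc, ← C_mul]
  congr 2; ring

variable [hpp : Fact p.Prime] [hch : CharP K p]

lemma DD_redL (a b : Sg m) (f : Pol K m) : DD K p a b (redL K p m f) = DD K p a b f := by
  have h : ∀ a b : Sg m, redL K p m (X a * dd K b (redL K p m f)) = redL K p m (X a * dd K b f) := by
    intro a b
    rw [← redL_mul_redL, redL_dd_redL, redL_mul_redL]
  simp only [DD_apply, map_add, h]

lemma redL_DD (a b : Sg m) (f : Pol K m) : redL K p m (DD K p a b f) = DD K p a b f := by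
  simp only [DD_apply, redL_redL]

lemma DD_DD (a b a' b' : Sg m) (f : Pol K m) :
    DD K p a b (DD K p a' b' f) = redL K p m (DU K a b (DU K a' b' f)) := by
  have : DD K p a' b' f = redL K p m (DU K a' b' f) := rfl
  rw [this, DD_redL]; rfl

lemma tauL_DD (a b : Sg m) (f : Pol K m) :
    tauL K p m (DD K p a b f) = DD K p a b (tauL K p m f) := by
  have h : ∀ a b : Sg m, tauL K p m (X a * dd K b f)
      = redL K p m (dd K a (X b)  * tauL K p m f) + redL K p m (X b * dd K a (tauL K p m f)) := by
    intro a b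
    rw [tauL_X_mul, tauL_dd, map_neg, neg_neg, ← dd_red_red, redL_dd_redL, dd_mul, map_add]
  have h2 : (dd K a (X b) : Pol K m) = - dd K b (X a) := by
    rw [dd_X, dd_X]
    by_cases h : b = a.swap
    · subst h; simp [sgn_swap]
    · have : ¬ a = b.swap := fun h2 => h (by rw [h2]; simp)
      simp [h, this]
  rw [DD_apply, tauL_redL, map_add, h, h, h2, DD_apply, map_add, neg_mul, map_neg]
  ring

lemma TT_DD (μ : K) (a b : Sg m) (f : Pol K m) :
    TT K p m μ (DD K p a b f) = DD K p a b (TT K p m μ f) := by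
  simp only [TT_apply, map_add, map_smul, redL_DD, tauL_DD, DD_redL]

lemma TT_DG (μ : K) (k : Sg m ⊕ (Fin m × Fin m)) (f : Pol K m) :
    TT K p m μ (DG K p k f) = DG K p k (TT K p m μ f) := by
  rcases k with z | ⟨i, k⟩
  · simp only [DG, LinearMap.comp_apply, TT_DD]
  · simp only [DG]; split_ifs
    · simp
    · simp only [LinearMap.add_apply, LinearMap.neg_apply, map_add, map_neg, LinearMap.comp_apply, TT_DD]

lemma DG_monomial (k : Sg m ⊕ (Fin m × Fin m)) (e : Ex m) (c : K) :
    DG K p k (monomial e c) = ev0 K k e • redL K p m (monomial e c) := by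
  rcases k with z | ⟨i, k⟩
  · simp only [DG, LinearMap.comp_apply, DD_DD, ev0]
    rw [← LinearMap.map_smul (redL K p m)]
    congr 1
    have h1 := euler1 z.swap e c
    have hz : z.swap ≠ z := by cases z <;> simp
    have h2 := euler2 z.swap z hz e c
    rw [pderiv_comm] at h2
    rw [smul_eq_C_mul]
    generalize (monomial e c : Pol K m) = f at *
    simp only [map_mul, map_add, map_neg, map_one] at h2 ⊢
    have h5 : (C (4:K) : Pol K m) = 4 := rfl
    rw [h5]
    rcases z with i | i
    · simp only [DU_apply, dd, LinearMap.smul_apply, Derivation.coeFn_coe, Sum.swap_swap, Sum.swap_inl, sgn,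
        Sum.elim_inl, Sum.elim_inr, Sum.swap_inr, one_smul, neg_smul, map_add, Derivation.map_neg,
        Derivation.leibniz, smul_eq_mul, pderiv_X_self] at *
      linear_combination - 4 * h1 - 4 * h2
    · simp only [DU_apply, dd, LinearMap.smul_apply, Derivation.coeFn_coe, Sum.swap_swap, Sum.swap_inl, sgn,
        Sum.elim_inl, Sum.elim_inr, Sum.swap_inr, one_smul, neg_smul, map_add, Derivation.map_neg,
        Derivation.leibniz, smul_eq_mul, pderiv_X_self] at *
      linear_combination - 4 * h1 - 4 * h2
  · simp only [DG, ev0]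
    split_ifs with hik
    · simp
    · simp only [LinearMap.add_apply, LinearMap.neg_apply, LinearMap.comp_apply, DD_DD]
      rw [← map_neg, ← map_add, ← LinearMap.map_smul (redL K p m)]
      congr 1
      have n1 : (Sum.inl i : Sg m) ≠ Sum.inl k := by simpa using hik
      have n2 : (Sum.inr i : Sg m) ≠ Sum.inr k := by simpa using hik
      have n3 : (Sum.inl i : Sg m) ≠ Sum.inr k := by simp
      have n4 : (Sum.inr i : Sg m) ≠ Sum.inl k := by simp
      have n5 : (Sum.inl i : Sg m) ≠ Sum.inr i := by simp
      have n6 : (Sum.inl k : Sg m) ≠ Sum.inr k := by simp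
      have a1 := euler1 (Sum.inl i) e c
      have a2 := euler1 (Sum.inl k) e c
      have a3 := euler1 (Sum.inr i) e c
      have a4 := euler1 (Sum.inr k) e c
      have b1 := euler2 (Sum.inr k) (Sum.inl i) n3.symm e c
      have b2 := euler2 (Sum.inr i) (Sum.inl k) n4 e c
      have b3 := euler2 (Sum.inl i) (Sum.inl k) n1 e c
      have b4 := euler2 (Sum.inr k) (Sum.inr i) n2.symm e c
      rw [smul_eq_C_mul]
      generalize (monomial e c : Pol K m) = f at *
      simp only [map_mul, map_add, map_one] at b1 b2 b3 b4 ⊢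
      have h5 : (C (2:K) : Pol K m) = 2 := rfl
      rw [h5]
      simp only [DU_apply, dd, LinearMap.smul_apply, Derivation.coeFn_coe, map_add, Derivation.map_neg,
        Derivation.leibniz, smul_eq_mul, pderiv_X_self, pderiv_X_of_ne n1, pderiv_X_of_ne n2,
        pderiv_X_of_ne n3, pderiv_X_of_ne n4, pderiv_X_of_ne n5, pderiv_X_of_ne n6,
        pderiv_X_of_ne n1.symm, pderiv_X_of_ne n2.symm, pderiv_X_of_ne n3.symm, pderiv_X_of_ne n4.symm,
        pderiv_X_of_ne n5.symm, pderiv_X_of_ne n6.symm, Sum.swap_inl, Sum.swap_inr, sgn, Sum.elim_inl, Sum.elim_inr,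
        one_smul, neg_smul, map_neg]
      have c1 := pderiv_comm (Sum.inl k) (Sum.inr k) f
      have c2 := pderiv_comm (Sum.inl k) (Sum.inr i) f
      have c3 := pderiv_comm (Sum.inl i) (Sum.inr k) f
      have c4 := pderiv_comm (Sum.inl i) (Sum.inr i) f
      simp only [c1, c2, c3, c4]
      linear_combination 2 * a3 + a4 + a2 + b1 + b2 + b3 + b4

lemma DG_TT_monomial (μ : K) (k : Sg m ⊕ (Fin m × Fin m)) (e : Ex m) (c : K) :
    DG K p k (TT K p m μ (monomial e c)) = ev0 K k e • TT K p m μ (monomial e c) := by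
  rw [← TT_DG, DG_monomial, map_smul]
  congr 1
  simp only [TT_apply, redL_redL, tauL_redL]

lemma cast_inj_small {a b : ℕ} (ha : a ≤ p - 1) (hb : b ≤ p - 1) (h : (a : K) = b) : a = b := by
  have hp := hpp.out.pos
  rw [CharP.natCast_eq_natCast K p, Nat.ModEq, Nat.mod_eq_of_lt (by omega), Nat.mod_eq_of_lt (by omega)] at h
  exact h

lemma cast_ne_zero_small {a : ℕ} (ha : a ≤ p - 1) (h0 : 0 < a) : (a : K) ≠ 0 := by
  intro h
  have := cast_inj_small (K := K) (p := p) ha (Nat.zero_le _) (by simpa using h)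
  omega

lemma two_ne (hodd : Odd p) : (2 : K) ≠ 0 := by
  have h1 := hpp.out.two_le
  have h2 : p ≠ 2 := by rintro rfl; exact absurd hodd (by decide)
  have := cast_ne_zero_small (K := K) (p := p) (a := 2) (by omega) (by norm_num)
  exact_mod_cast this

lemma sepChar (hodd : Odd p) {e e' : Ex m} (he : Red p e) (he' : Red p e')
    (h : ∀ k, ev0 K k e = ev0 K k e') : e' = e ∨ e' = flp p e := by
  have h2 := two_ne (K := K) hodd
  have h4 : (4 : K) ≠ 0 := by
    have : (4 : K) = 2 * 2 := by norm_num
    rw [this]; exact mul_ne_zero h2 h2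
  -- each coordinate
  have hc : ∀ i : Fin m, (e' (Sum.inl i) = e (Sum.inl i) ∧ e' (Sum.inr i) = e (Sum.inr i)) ∨
      ((e' (Sum.inl i) = p - 1 - e (Sum.inr i) ∧ e' (Sum.inr i) = p - 1 - e (Sum.inl i))) := by
    intro i
    have k1 := h (Sum.inl (Sum.inl i))
    have k2 := h (Sum.inl (Sum.inr i))
    simp only [ev0, Sum.swap_inl, Sum.swap_inr] at k1 k2
    have k1 := mul_left_cancel₀ (neg_ne_zero.2 h4) k1
    have k2 := mul_left_cancel₀ (neg_ne_zero.2 h4) k2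
    set a : K := (e (Sum.inl i) : K); set b : K := (e (Sum.inr i) : K)
    have key : ((e' (Sum.inl i) : K) - a) * ((e' (Sum.inl i) : K) + b + 1) = 0 := by
      linear_combination ((e' (Sum.inl i) : K)) * (k1 - k2) - k2
    have kd : (e' (Sum.inr i) : K) = b + e' (Sum.inl i) - a := by linear_combination k2 - k1
    rcases mul_eq_zero.1 key with h5 | h5
    · left
      constructor
      · exact cast_inj_small (K := K) (he' _) (he _) (by linear_combination h5)
      · exact cast_inj_small (K := K) (he' _) (he _) (by rw [kd]; linear_combination h5)
    · right
      constructor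
      · refine cast_inj_small (K := K) (p := p) (he' _) (by omega) ?_
        rw [cast_p_sub _ (he _)]; linear_combination h5
      · refine cast_inj_small (K := K) (p := p) (he' _) (by omega) ?_
        rw [cast_p_sub _ (he _)]; rw [kd]; linear_combination h5
  by_contra hcon
  push Not at hcon
  obtain ⟨c1, c2⟩ := hcon
  have x1 : ∃ i, ¬ (e' (Sum.inl i) = e (Sum.inl i) ∧ e' (Sum.inr i) = e (Sum.inr i)) := by
    by_contra hh; push Not at hh; apply c1; ext z
    rcases z with i | i
    · exact (hh i).1
    · exact (hh i).2
  have x2 : ∃ i, ¬ (e' (Sum.inl i) = p - 1 - e (Sum.inr i) ∧ e' (Sum.inr i) = p - 1 - e (Sum.inl i)) := by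
    by_contra hh; push Not at hh; apply c2; ext z
    rcases z with i | i
    · exact (hh i).1
    · exact (hh i).2
  obtain ⟨i, hi⟩ := x1
  obtain ⟨k, hk⟩ := x2
  have hi2 := (hc i).resolve_left hi
  have hk2 := (hc k).resolve_right hk
  have hik : i ≠ k := by rintro rfl; exact hi hk2
  have h6 := h (Sum.inr (i, k))
  simp only [ev0, if_neg hik, hi2.1, hi2.2, hk2.1, hk2.2, cast_p_sub (K := K) _ (he _)] at h6
  have h7 : (2:K) * (((e (Sum.inl i) : K) + e (Sum.inr i) + 1) * (e (Sum.inl k) + e (Sum.inr k) + 1)) = 0 := by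
    linear_combination h6
  rcases mul_eq_zero.1 ((mul_eq_zero.1 h7).resolve_left h2) with h8 | h8
  · apply hi
    constructor
    · rw [hi2.1]
      refine cast_inj_small (K := K) (p := p) (by omega) (he _) ?_
      rw [cast_p_sub _ (he _)]; linear_combination -h8
    · rw [hi2.2]
      refine cast_inj_small (K := K) (p := p) (by omega) (he _) ?_
      rw [cast_p_sub _ (he _)]; linear_combination -h8
  · apply hk
    constructor
    · rw [hk2.1]
      refine cast_inj_small (K := K) (p := p) (he _) (by omega) ?_
      rw [cast_p_sub _ (he _)]; linear_combination h8
    · rw [hk2.2]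
      refine cast_inj_small (K := K) (p := p) (he _) (by omega) ?_
      rw [cast_p_sub _ (he _)]; linear_combination h8

end P3
end


noncomputable section
set_option linter.unusedSectionVars false
set_option linter.unusedSimpArgs false

def vv (K : Type) [Field K] (p : ℕ) {m : ℕ} (μ : K) (e : Ex m) : Pol K m :=
  TT K p m μ (MvPolynomial.monomial e 1)

def ClosedDD (p : ℕ) {K : Type} [Field K] {m : ℕ} (U : Submodule K (Pol K m)) : Prop :=
  ∀ a b, ∀ f ∈ U, DD K p a b f ∈ U

def dist1 {m : ℕ} (e n : Ex m) : ℕ := ∑ z, (e z - n z)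

/-- separation of eigenvectors -/
lemma sep {K V ι κ : Type*} [Field K] [AddCommGroup V] [Module K V] (M : Submodule K V)
    (Θ : κ → V →ₗ[K] V) (hΘ : ∀ k, ∀ x ∈ M, Θ k x ∈ M) (χ : ι → κ → K) (i0 : ι)
    (S : Finset ι) : ∀ (v : ι → V), (∀ i ∈ S, ∀ k, Θ k (v i) - χ i k • v i ∈ M) →
    ∑ i ∈ S, v i ∈ M → ∑ i ∈ S.filter (fun i => χ i = χ i0), v i ∈ M := by
  induction S using Finset.strongInduction with
  | H S ih =>
    intro v hv hS
    by_cases h : ∀ i ∈ S, χ i = χ i0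
    · rwa [Finset.filter_true_of_mem h]
    · push Not at h
      obtain ⟨i1, hi1, hne⟩ := h
      obtain ⟨k, hk⟩ := Function.ne_iff.1 hne
      have hk' : χ i0 k - χ i1 k ≠ 0 := sub_ne_zero.2 (Ne.symm hk)
      have h1 : ∑ i ∈ S, (χ i k - χ i1 k) • v i ∈ M := by
        have h2 : ∑ i ∈ S, (χ i k - χ i1 k) • v i
            = (Θ k (∑ i ∈ S, v i) - χ i1 k • ∑ i ∈ S, v i) - ∑ i ∈ S, (Θ k (v i) - χ i k • v i) := by
          rw [map_sum, Finset.smul_sum, ← Finset.sum_sub_distrib, ← Finset.sum_sub_distrib]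
          apply Finset.sum_congr rfl; intro i _
          rw [sub_smul]; abel
        rw [h2]
        exact M.sub_mem (M.sub_mem (hΘ k _ hS) (M.smul_mem _ hS))
          (M.sum_mem (fun i hi => hv i hi k))
      have h3 := ih (S.erase i1) (Finset.erase_ssubset hi1) (fun i => (χ i k - χ i1 k) • v i)
        (fun i hi k' => by
          have := M.smul_mem (χ i k - χ i1 k) (hv i (Finset.mem_of_mem_erase hi) k')
          rw [smul_sub, smul_comm _ (χ i k')] at this
          rwa [map_smul])
        (by
          rw [← Finset.add_sum_erase S _ hi1] at h1
          simpa using h1)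
      have h4 : (S.erase i1).filter (fun i => χ i = χ i0) = S.filter (fun i => χ i = χ i0) := by
        ext i; simp only [Finset.mem_filter, Finset.mem_erase]
        constructor
        · rintro ⟨⟨_, h⟩, h'⟩; exact ⟨h, h'⟩
        · rintro ⟨h, h'⟩; refine ⟨⟨?_, h⟩, h'⟩; rintro rfl; exact hne h'
      rw [h4] at h3
      have h5 : ∑ i ∈ S.filter (fun i => χ i = χ i0), (χ i k - χ i1 k) • v i
          = (χ i0 k - χ i1 k) • ∑ i ∈ S.filter (fun i => χ i = χ i0), v i := by
        rw [Finset.smul_sum]; apply Finset.sum_congr rfl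
        intro i hi; rw [(Finset.mem_filter.1 hi).2]
      rw [h5] at h3
      exact (Submodule.smul_mem_iff M hk').1 h3

section P4
open MvPolynomial
variable {K : Type} [Field K] {p m : ℕ} [hpp : Fact p.Prime] [hch : CharP K p]

lemma closed_DG {U : Submodule K (Pol K m)} (hU : ClosedDD p U) (k) : ∀ f ∈ U, DG K p k f ∈ U := by
  intro f hf
  rcases k with z | ⟨i, k⟩
  · simp only [DG, LinearMap.comp_apply]
    exact hU z.swap z.swap _ (hU z z f hf)
  · simp only [DG]; split_ifs
    · simp
    · simp only [LinearMap.add_apply, LinearMap.neg_apply, LinearMap.comp_apply]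
      exact U.add_mem (U.neg_mem (hU _ _ _ (hU _ _ _ hf))) (hU _ _ _ (hU _ _ _ hf))

lemma TT_redL (μ : K) (f : Pol K m) : TT K p m μ (redL K p m f) = TT K p m μ f := by
  simp only [TT_apply, redL_redL, tauL_redL]

lemma DD_vv (μ : K) (a b : Sg m) (e : Ex m) :
    DD K p a b (vv K p μ e) = (sgn K b * e b.swap) • vv K p μ (mv e b.swap a)
      + (sgn K a * e a.swap) • vv K p μ (mv e a.swap b) := by
  have h : ∀ a b : Sg m, X a * dd K b (monomial e (1:K)) = (sgn K b * e b.swap) • monomial (mv e b.swap a) 1 := by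
    intro a b
    rw [dd_monomial, X, monomial_mul, smul_monomial, mv, add_comm]; simp
  unfold vv
  rw [← TT_DD, DD_apply, TT_redL, h, h, map_add, map_smul, map_smul]

lemma vv_not_red (μ : K) (e : Ex m) (h : ¬ Red p e) : vv K p μ e = 0 := by
  simp [vv, TT_apply, redL_monomial, tauL_monomial, h]

lemma vv_red (μ : K) (e : Ex m) (h : Red p e) :
    vv K p μ e = monomial e 1 + monomial (flp p e) (μ * cf K e) := by
  simp [vv, TT_apply, redL_monomial, tauL_monomial, h, smul_monomial]

lemma vv_flp (μ : K) (hμ : μ * μ = 1) (e : Ex m) (h : Red p e) :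
    vv K p μ e = (μ * cf K e) • vv K p μ (flp p e) := by
  rw [vv_red _ _ h, vv_red _ _ (red_flp e), flp_flp h, smul_add, smul_monomial, smul_monomial,
    add_comm]
  congr 2
  · simp
  · have := cf_flp (K := K) h
    simp only [smul_eq_mul]
    linear_combination (-(μ * μ)) * this - hμ

lemma DG_vv (μ : K) (k) (e : Ex m) : DG K p k (vv K p μ e) = ev0 K k e • vv K p μ e :=
  DG_TT_monomial μ k e 1

lemma sep_two (hodd : Odd p) {U : Submodule K (Pol K m)} (hU : ClosedDD p U) (μ c1 c2 : K)
    {e1 e2 : Ex m} (h1 : Red p e1) (h2 : Red p e2) (hne : e2 ≠ e1) (hnf : e2 ≠ flp p e1) (hc : c1 ≠ 0)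
    (h : c1 • vv K p μ e1 + c2 • vv K p μ e2 ∈ U) : vv K p μ e1 ∈ U := by
  have hk : ∃ k, ev0 K k e1 ≠ ev0 K k e2 := by
    by_contra hcon; push Not at hcon
    rcases sepChar hodd h1 h2 hcon with h' | h'
    · exact hne h'
    · exact hnf h'
  obtain ⟨k, hk⟩ := hk
  have h3 := U.sub_mem (closed_DG hU k _ h) (U.smul_mem (ev0 K k e2) h)
  rw [map_add, map_smul, map_smul, DG_vv, DG_vv] at h3
  have h4 : c1 • ev0 K k e1 • vv K p μ e1 + c2 • ev0 K k e2 • vv K p μ e2 -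
      ev0 K k e2 • (c1 • vv K p μ e1 + c2 • vv K p μ e2) = (c1 * (ev0 K k e1 - ev0 K k e2)) • vv K p μ e1 := by
    module
  rw [h4] at h3
  exact (Submodule.smul_mem_iff U (mul_ne_zero hc (sub_ne_zero.2 hk))).1 h3

lemma red_mv {e : Ex m} (h : Red p e) {w z : Sg m} (hz : e z < p - 1) : Red p (mv e w z) := by
  intro u
  have := h u
  rw [mv_apply]
  by_cases h1 : z = u
  · subst h1; simp; omega
  · simp [h1]; omega

lemma sg_swap_eq_iff (a b : Sg m) : a.swap = b ↔ a = b.swap := by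
  constructor
  · rintro rfl; simp
  · rintro rfl; simp

/-- The basic move. -/
lemma move (hodd : Odd p) {U : Submodule K (Pol K m)} (hU : ClosedDD p U) (μ : K) {e : Ex m}
    (he : Red p e) (hv : vv K p μ e ∈ U) (w a : Sg m) (hw : 0 < e w) (ha : e a < p - 1) (hwa : w ≠ a)
    (hfix : flp p e ≠ e ∨ μ = 1) : vv K p μ (mv e w a) ∈ U := by
  obtain ⟨b, rfl⟩ : ∃ b : Sg m, w = b.swap := ⟨w.swap, by simp⟩
  have h2 := two_ne (K := K) hodd
  have h := hU a b _ hv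
  rw [DD_vv] at h
  have hc : sgn K b * (e b.swap : K) ≠ 0 := mul_ne_zero (sgn_ne b) (cast_ne_zero_small (he _) hw)
  have hr1 : Red p (mv e b.swap a) := red_mv he ha
  by_cases hab : a = b
  · subst hab
    rw [← add_smul, ← two_mul] at h
    exact (Submodule.smul_mem_iff U (mul_ne_zero h2 hc)).1 h
  by_cases h0 : e a.swap = 0
  · rw [h0] at h
    simp only [Nat.cast_zero, mul_zero, zero_smul, add_zero] at h
    exact (Submodule.smul_mem_iff U hc).1 h
  by_cases hr2 : Red p (mv e a.swap b)
  swap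
  · rw [vv_not_red _ _ hr2, smul_zero, add_zero] at h
    exact (Submodule.smul_mem_iff U hc).1 h
  have hab2 : a.swap ≠ b := fun h => hwa (by rw [← h]; simp)
  have hwa' : b.swap ≠ a := hwa
  have hbb : b.swap ≠ b := by cases b <;> simp
  have haa : a.swap ≠ a := by cases a <;> simp
  have hne : mv e a.swap b ≠ mv e b.swap a := by
    intro h5
    have h6 := DFunLike.congr_fun h5 b
    rw [mv_apply, mv_apply] at h6
    simp [hab, hab2, hbb] at h6
  by_cases hfl : mv e a.swap b = flp p (mv e b.swap a)
  swap
  · exact sep_two hodd hU μ _ _ hr1 hr2 hne hfl hc h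
  -- then e is fixed
  have hef : flp p e = e := by
    ext u
    have h6 := DFunLike.congr_fun hfl u
    have h7 := he u.swap
    have h8 := he u
    rw [flp_apply, mv_apply, mv_apply] at h6
    rw [flp_apply]
    have i1 : (b.swap = u.swap) ↔ b = u := by rw [sg_swap_eq_iff, Sum.swap_swap]
    have i2 : a = u.swap ↔ a.swap = u := (sg_swap_eq_iff _ _).symm
    simp only [i1, i2] at h6
    by_cases c1 : b = u
    · subst c1
      have : a.swap ≠ b := hab2
      simp [this] at h6
      have hr := hr2 b
      rw [mv_apply] at hr
      simp [this] at hr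
      omega
    · by_cases c2 : a.swap = u
      · subst c2
        simp [c1] at h6
        simp at h6 ⊢
        omega
      · simp [c1, c2] at h6
        omega
  have hμ : μ = 1 := hfix.resolve_left (fun h => h hef)
  subst hμ
  rw [hfl, vv_flp (1:K) (by simp) _ (red_flp _), flp_flp hr1, ← hfl] at h
  -- coefficient
  have hcf : cf K (mv e a.swap b) * (sgn K a * e a.swap) = sgn K b * e b.swap := by
    set g : Ex m := e - Finsupp.single a.swap 1 with hg
    have g1 : e = g + Finsupp.single a.swap 1 := by
      ext u; by_cases hu : a.swap = u
      · subst hu; simp [hg]; omega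
      · simp [hg, Finsupp.single_apply, hu]
    have g2 : mv e a.swap b = g + Finsupp.single b 1 := rfl
    have g3 := cf_add_single (K := K) g a.swap
    rw [← g1, cf_fixed e he hef] at g3
    have g4 : (g b : K) = e b := by
      congr 1; simp [hg, Finsupp.single_apply, hab2]
    have g5 : (g a.swap : K) + 1 = e a.swap := by
      have : g a.swap + 1 = e a.swap := by simp [hg]; omega
      exact_mod_cast congrArg (Nat.cast (R := K)) this
    have g6 : (e b.swap : K) = - (e b + 1) := by
      have h9 := DFunLike.congr_fun hef b.swap
      rw [← cast_p_sub (K := K) _ (he b), ← h9, flp_apply, Sum.swap_swap]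
    rw [g5, sgn_swap] at g3
    rw [g2, cf_add_single, g4, g6]
    linear_combination (sgn K b * ((e b : K) + 1)) * g3
  rw [smul_smul, ← add_smul] at h
  have h10 : (sgn K b * (e b.swap : K) + sgn K a * (e a.swap : K) * (1 * cf K (mv e a.swap b)))
      = 2 * (sgn K b * (e b.swap : K)) := by linear_combination hcf
  rw [h10] at h
  exact (Submodule.smul_mem_iff U (mul_ne_zero h2 hc)).1 h

lemma degree_eq_sum' (e : Ex m) : e.degree = ∑ z, e z := Finsupp.degree_eq_sum e

lemma exists_lt_of_ne {e n : Ex m} (hd : e.degree = n.degree) (h : e ≠ n) :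
    (∃ w, n w < e w) ∧ (∃ z, e z < n z) := by
  rw [degree_eq_sum', degree_eq_sum'] at hd
  have key : ∀ e n : Ex m, ∑ z, e z = ∑ z, n z → e ≠ n → ∃ w, n w < e w := by
    intro e n hd h
    by_contra hcon; push Not at hcon
    apply h; ext z
    exact (Finset.sum_eq_sum_iff_of_le (fun z _ => hcon z)).1 hd z (Finset.mem_univ z)
  exact ⟨key e n hd h, key n e hd.symm (Ne.symm h)⟩

lemma dist1_mv {e n : Ex m} {w z : Sg m} (hw : n w < e w) (hz : e z < n z) :
    dist1 (mv e w z) n < dist1 e n := by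
  have hwz : w ≠ z := by rintro rfl; omega
  apply Finset.sum_lt_sum
  · intro u _
    rw [mv_apply]
    by_cases h1 : z = u
    · subst h1; simp; omega
    · simp [h1]; omega
  · refine ⟨w, Finset.mem_univ _, ?_⟩
    rw [mv_apply]; simp [hwz.symm]; omega

lemma degree_mv {e : Ex m} {w z : Sg m} (hw : 0 < e w) : (mv e w z).degree = e.degree := by
  have h : e = (e - Finsupp.single w 1) + Finsupp.single w 1 := by
    ext u; by_cases hu : w = u
    · subst hu; simp; omega
    · simp [Finsupp.single_apply, hu]
  unfold mv
  conv_rhs => rw [h]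
  simp [map_add]

lemma degree_flp {e : Ex m} (h : Red p e) : (flp p e).degree + e.degree = 2 * (m * (p - 1)) := by
  rw [degree_eq_sum', degree_eq_sum']
  have : ∑ z, flp p e z = ∑ z, (p - 1 - e z) := by
    apply Fintype.sum_equiv (Equiv.sumComm (Fin m) (Fin m)); intro z; simp
  rw [this, ← Finset.sum_add_distrib, Finset.sum_congr rfl (fun z _ => Nat.sub_add_cancel (h z))]
  simp; ring

/-- DR1 / DR3 -/
lemma reachA (hodd : Odd p) {U : Submodule K (Pol K m)} (hU : ClosedDD p U) (μ : K) (N : ℕ)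
    (hN : N ≠ m * (p - 1) ∨ μ = 1) (n : Ex m) (hn : Red p n) (hnd : n.degree = N) :
    ∀ (D : ℕ) (e : Ex m), dist1 e n = D → Red p e → e.degree = N → vv K p μ e ∈ U →
      vv K p μ n ∈ U := by
  intro D
  induction D using Nat.strong_induction_on with
  | _ D ih =>
    intro e hD he hed hv
    by_cases hen : e = n
    · rwa [← hen]
    obtain ⟨⟨w, hw⟩, ⟨z, hz⟩⟩ := exists_lt_of_ne (hed.trans hnd.symm) hen
    have hwz : w ≠ z := by rintro rfl; omega
    have hz' : e z < p - 1 := lt_of_lt_of_le hz (hn z)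
    have hf : flp p e ≠ e ∨ μ = 1 := by
      rcases hN with h | h
      · left; intro h2
        have := degree_flp he
        rw [h2, hed] at this; omega
      · right; exact h
    have hm := move hodd hU μ he hv w z (by omega) hz' hwz hf
    refine ih _ ?_ (mv e w z) rfl (red_mv he hz') ?_ hm
    · rw [← hD]; exact dist1_mv hw hz
    · rw [degree_mv (by omega), hed]

lemma not_fixed_of_pos {e : Ex m} (he : Red p e) {k : Fin m} (h : p - 1 < e (Sum.inl k) + e (Sum.inr k)) :
    flp p e ≠ e := by
  intro h2
  have := DFunLike.congr_fun h2 (Sum.inl k)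
  have h3 := he (Sum.inr k)
  rw [flp_apply] at this
  simp at this; omega

/-- descent keeping coordinate `k` above `p-1` -/
lemma reachK (hodd : Odd p) {U : Submodule K (Pol K m)} (hU : ClosedDD p U) (μ : K)
    (n : Ex m) (hn : Red p n) (k : Fin m) (hk : p - 1 < n (Sum.inl k) + n (Sum.inr k)) :
    ∀ (D : ℕ) (e : Ex m), dist1 e n = D → Red p e → e.degree = n.degree →
      p - 1 < e (Sum.inl k) + e (Sum.inr k) → vv K p μ e ∈ U → vv K p μ n ∈ U := by
  intro D
  induction D using Nat.strong_induction_on with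
  | _ D ih =>
    intro e hD he hed hek hv
    by_cases hen : e = n
    · rwa [← hen]
    have hchoice : ∃ w z, n w < e w ∧ e z < n z ∧
        p - 1 < mv e w z (Sum.inl k) + mv e w z (Sum.inr k) := by
      obtain ⟨⟨w, hw⟩, ⟨z, hz⟩⟩ := exists_lt_of_ne hed hen
      by_cases c1 : ∃ w', n w' < e w' ∧ w' ≠ Sum.inl k ∧ w' ≠ Sum.inr k
      · obtain ⟨w', h1, h2, h3⟩ := c1
        refine ⟨w', z, h1, hz, ?_⟩
        rw [mv_apply, mv_apply]; simp only [h2, h3, if_false]; omega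
      · by_cases c2 : ∃ z', e z' < n z' ∧ (z' = Sum.inl k ∨ z' = Sum.inr k)
        · obtain ⟨z', h1, h2⟩ := c2
          have hwz : w ≠ z' := by rintro rfl; omega
          refine ⟨w, z', hw, h1, ?_⟩
          rw [mv_apply, mv_apply]
          push Not at c1
          have c3 := c1 w hw
          rcases h2 with rfl | rfl
          · by_cases h5 : w = Sum.inl k
            · exact absurd h5 hwz
            · have := c3 h5; subst this; simp; omega
          · by_cases h5 : w = Sum.inl k
            · subst h5; simp; omega
            · exact absurd (c3 h5) hwz
        · push Not at c1 c2
          refine ⟨w, z, hw, hz, ?_⟩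
          have z1 := c2 z hz
          have hl : n (Sum.inl k) ≤ e (Sum.inl k) := by
            by_contra h; push Not at h; exact (c2 _ h).1 rfl
          have hr : n (Sum.inr k) ≤ e (Sum.inr k) := by
            by_contra h; push Not at h; exact (c2 _ h).2 rfl
          rw [mv_apply, mv_apply]
          by_cases h5 : w = Sum.inl k
          · subst h5; simp; omega
          · have := c1 w hw h5; subst this; simp; omega
    obtain ⟨w, z, hw, hz, hkk⟩ := hchoice
    have hwz : w ≠ z := by rintro rfl; omega
    have hz' : e z < p - 1 := lt_of_lt_of_le hz (hn z)
    have hm := move hodd hU μ he hv w z (by omega) hz' hwz (Or.inl (not_fixed_of_pos he hek))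
    refine ih _ ?_ (mv e w z) rfl (red_mv he hz') ?_ hkk hm
    · rw [← hD]; exact dist1_mv hw hz
    · rw [degree_mv (by omega), hed]

lemma exists_pos {e : Ex m} (_he : Red p e) (hd : e.degree = m * (p - 1)) (h : flp p e ≠ e) :
    ∃ k, p - 1 < e (Sum.inl k) + e (Sum.inr k) := by
  by_contra hcon; push Not at hcon
  rw [degree_eq_sum', Fintype.sum_sum_type, ← Finset.sum_add_distrib] at hd
  have h1 : ∑ i : Fin m, (e (Sum.inl i) + e (Sum.inr i)) = ∑ i : Fin m, (p - 1) := by rw [hd]; simp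
  have h2 := (Finset.sum_eq_sum_iff_of_le (fun i _ => hcon i)).1 h1
  apply h; ext z
  rcases z with i | i
  · have := h2 i (Finset.mem_univ _); simp; omega
  · have := h2 i (Finset.mem_univ _); simp; omega

/-- an auxiliary exponent with defect `+1` at `k` and `-1` at `l` -/
lemma exists_hop (k l : Fin m) (hkl : k ≠ l) : ∃ h : Ex m, Red p h ∧ h.degree = m * (p - 1) ∧
    p - 1 < h (Sum.inl k) + h (Sum.inr k) ∧
    p - 1 < flp p h (Sum.inl l) + flp p h (Sum.inr l) := by
  have hp := hpp.out.two_le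
  let h0 : Ex m := Finsupp.equivFunOnFinite.symm (Sum.elim (fun _ => p - 1) (fun _ => 0))
  have r0 : Red p h0 := by rintro (i | i) <;> simp [h0]
  have d0 : h0.degree = m * (p - 1) := by
    rw [degree_eq_sum', Fintype.sum_sum_type]; simp [h0]
  have e1 : h0 (Sum.inl l) = p - 1 := by simp [h0]
  have e2 : h0 (Sum.inr k) = 0 := by simp [h0]
  have e3 : h0 (Sum.inl k) = p - 1 := by simp [h0]
  have e4 : h0 (Sum.inr l) = 0 := by simp [h0]
  refine ⟨mv h0 (Sum.inl l) (Sum.inr k), red_mv r0 (by omega), ?_, ?_, ?_⟩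
  · rw [degree_mv (by omega), d0]
  · rw [mv_apply, mv_apply]; simp [hkl.symm]; omega
  · rw [flp_apply, flp_apply, Sum.swap_inl, Sum.swap_inr, mv_apply, mv_apply]; simp [hkl]; omega

/-- DR4 -/
lemma reachM (hodd : Odd p) {U : Submodule K (Pol K m)} (hU : ClosedDD p U) (μ : K) (hμ : μ * μ = 1)
    {e n : Ex m} (he : Red p e) (hn : Red p n) (hed : e.degree = m * (p - 1))
    (hnd : n.degree = m * (p - 1)) (hef : flp p e ≠ e) (hnf : flp p n ≠ n)
    (hv : vv K p μ e ∈ U) : vv K p μ n ∈ U := by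
  obtain ⟨k, hk⟩ := exists_pos he hed hef
  obtain ⟨l, hl⟩ := exists_pos hn hnd hnf
  by_cases hkl : k = l
  · subst hkl
    exact reachK hodd hU μ n hn k hl _ e rfl he (hed.trans hnd.symm) hk hv
  · obtain ⟨h, hr, hd, h1, h2⟩ := exists_hop (p := p) k l hkl
    have h3 := reachK hodd hU μ h hr k h1 _ e rfl he (hed.trans hd.symm) hk hv
    have h4 : vv K p μ (flp p h) ∈ U := by
      rw [vv_flp μ hμ _ (red_flp h), flp_flp hr]
      exact U.smul_mem _ h3
    refine reachK hodd hU μ n hn l hl _ (flp p h) rfl (red_flp h) ?_ h2 h4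
    have := degree_flp hr
    omega

/-- descend to a fixed exponent -/
lemma reachFix (hodd : Odd p) {U : Submodule K (Pol K m)} (hU : ClosedDD p U) (μ : K)
    (n : Ex m) (hn : Red p n) (hnf : flp p n = n) :
    ∀ (D : ℕ) (e : Ex m), dist1 e n = D → Red p e → e.degree = n.degree → vv K p μ e ∈ U →
      ∃ c : Ex m, Red p c ∧ c.degree = n.degree ∧ flp p c = c ∧ vv K p μ c ∈ U := by
  intro D
  induction D using Nat.strong_induction_on with
  | _ D ih =>
    intro e hD he hed hv
    by_cases hef : flp p e = e
    · exact ⟨e, he, hed, hef, hv⟩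
    have hen : e ≠ n := by rintro rfl; exact hef hnf
    obtain ⟨⟨w, hw⟩, ⟨z, hz⟩⟩ := exists_lt_of_ne hed hen
    have hwz : w ≠ z := by rintro rfl; omega
    have hz' : e z < p - 1 := lt_of_lt_of_le hz (hn z)
    have hm := move hodd hU μ he hv w z (by omega) hz' hwz (Or.inl hef)
    refine ih _ ?_ (mv e w z) rfl (red_mv he hz') ?_ hm
    · rw [← hD]; exact dist1_mv hw hz
    · rw [degree_mv (by omega), hed]

/-- DR2 -/
lemma reachP (hodd : Odd p) {U : Submodule K (Pol K m)} (hU : ClosedDD p U)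
    {e n : Ex m} (he : Red p e) (hn : Red p n) (hed : e.degree = m * (p - 1))
    (hnd : n.degree = m * (p - 1)) (hef : flp p e ≠ e)
    (hv : vv K p 0 e ∈ U) : vv K p 0 n ∈ U := by
  have h2 := two_ne (K := K) hodd
  let h0 : Ex m := Finsupp.equivFunOnFinite.symm (Sum.elim (fun _ => p - 1) (fun _ => 0))
  have r0 : Red p h0 := by rintro (i | i) <;> simp [h0]
  have d0 : h0.degree = m * (p - 1) := by
    rw [degree_eq_sum', Fintype.sum_sum_type]; simp [h0]
  have f0 : flp p h0 = h0 := by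
    ext z; rcases z with i | i <;> simp [h0]
  obtain ⟨c, hc, hcd, hcf, hcv⟩ := reachFix hodd hU 0 h0 r0 f0 _ e rfl he (hed.trans d0.symm) hv
  have hc1 : vv K p 1 c ∈ U := by
    have : vv K p (1:K) c = (2:K) • vv K p 0 c := by
      rw [vv_red _ _ hc, vv_red _ _ hc, hcf, cf_fixed c hc hcf]
      simp; rw [two_smul]
    rw [this]; exact U.smul_mem _ hcv
  have h1 : ∀ n : Ex m, Red p n → n.degree = m * (p - 1) → vv K p 1 n ∈ U := fun n hn hnd =>
    reachA hodd hU 1 (m * (p - 1)) (Or.inr rfl) n hn hnd _ c rfl hc (hcd.trans d0) hc1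
  have hsum : ∀ n : Ex m, vv K p 1 n + vv K p (-1) n = (2:K) • vv K p 0 n := by
    intro n; simp only [vv, TT_apply]; module
  have hm1 : vv K p (-1) e ∈ U := by
    have := U.sub_mem (U.smul_mem (2:K) hv) (h1 e he hed)
    rwa [← hsum, add_sub_cancel_left] at this
  have hm : vv K p (-1) n ∈ U := by
    by_cases hnf : flp p n = n
    · rw [vv_red _ _ hn, hnf, cf_fixed n hn hnf, ← map_add]; simp
    · exact reachM hodd hU (-1) (by ring) he hn hed hnd hef hnf hm1
  have := U.add_mem (h1 n hn hnd) hm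
  rw [hsum] at this
  exact (Submodule.smul_mem_iff U h2).1 this

end P4
end


noncomputable section
set_option linter.unusedSectionVars false
set_option linter.unusedSimpArgs false

def cv {p t m : ℕ} [Fact p.Prime] (v : SympV p t m) : Sg m → GaloisField p t := Sum.elim v.1 v.2

def fnc {p t m : ℕ} [Fact p.Prime] (f : Pol (GaloisField p t) m) : SympV p t m → GaloisField p t :=
  fun v => MvPolynomial.eval (cv v) f

def evT {p t m : ℕ} [Fact p.Prime] (f : Fin t → Pol (GaloisField p t) m) :
    SympV p t m → GaloisField p t :=
  fun v => ∏ l, (MvPolynomial.eval (cv v) (f l)) ^ (p ^ (l : ℕ))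

/-- signs -/
def sg (K : Type) [Field K] (pl : Prop) : K := if pl then 1 else -1

/-- polynomial digits -/
def IsDg (p : ℕ) {K : Type} [Field K] {m : ℕ} (n : ℕ) (pl : Prop) (g : Pol K m) : Prop :=
  ∃ e : Ex m, Red p e ∧ e.degree = n ∧
    ((n ≠ m * (p - 1) ∧ ¬ pl ∧ g = MvPolynomial.monomial e 1) ∨
     (n = m * (p - 1) ∧ flp p e = e ∧ pl ∧ g = MvPolynomial.monomial e 1) ∨
     (n = m * (p - 1) ∧ flp p e ≠ e ∧ g = vv K p (sg K pl) e))

/-- sign condition -/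
def SG (p : ℕ) {K : Type} [Field K] {m : ℕ} (pl : Prop) (F : Pol K m) : Prop :=
  tauL K p m F = sg K pl • redL K p m F

section P5a
open MvPolynomial
variable {K : Type} [Field K] {p m : ℕ} [hpp : Fact p.Prime] [hch : CharP K p]

lemma sg_sq (pl : Prop) : sg K pl * sg K pl = 1 := by unfold sg; split_ifs <;> simp

lemma poly_sum (F : Pol K m) : F = ∑ e ∈ F.support, coeff e F • monomial e 1 := by
  conv_lhs => rw [F.as_sum]
  apply Finset.sum_congr rfl; intro e _; rw [smul_monomial]; simp

/-- linear map image is in a submodule if it is on monomials of the right degree -/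
lemma map_mem_of_homog {V : Type*} [AddCommGroup V] [Module K V] (T : Pol K m →ₗ[K] V)
    (S : Submodule K V) {n : ℕ} {F : Pol K m} (hF : F.IsHomogeneous n)
    (h : ∀ e : Ex m, e.degree = n → T (monomial e 1) ∈ S) : T F ∈ S := by
  rw [poly_sum F, map_sum]
  refine S.sum_mem (fun e he => ?_)
  rw [map_smul]
  refine S.smul_mem _ (h e ?_)
  by_contra hne
  exact (mem_support_iff.1 he) (hF.coeff_eq_zero hne)

lemma digit_span (hodd : Odd p) {n : ℕ} {F : Pol K m} (hF : F.IsHomogeneous n) (R : Prop → Prop)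
    (hR : (∀ pl, R pl) ∨ (∃ pl, R pl ∧ n = m * (p - 1) ∧ SG p pl F)) :
    F ∈ Submodule.span K ({g : Pol K m | ∃ pl, R pl ∧ IsDg p n pl g} ∪
      {g | ∃ e : Ex m, ¬ Red p e ∧ e.degree = n ∧ g = monomial e 1}) := by
  set S := Submodule.span K ({g : Pol K m | ∃ pl, R pl ∧ IsDg p n pl g} ∪
      {g | ∃ e : Ex m, ¬ Red p e ∧ e.degree = n ∧ g = monomial e 1}) with hS
  have h2 := two_ne (K := K) hodd
  have hdig : ∀ g pl, R pl → IsDg p n pl g → g ∈ S := fun g pl h1 h3 =>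
    Submodule.subset_span (Or.inl ⟨pl, h1, h3⟩)
  have hnr : ∀ e : Ex m, ¬ Red p e → e.degree = n → monomial e (1:K) ∈ S := fun e h1 h3 =>
    Submodule.subset_span (Or.inr ⟨e, h1, h3, rfl⟩)
  have hvv : ∀ pl, R pl → n = m * (p - 1) → ∀ e : Ex m, e.degree = n → vv K p (sg K pl) e ∈ S := by
    intro pl h1 hn e he
    by_cases hr : Red p e
    · by_cases hf : flp p e = e
      · by_cases hp : pl
        · have := hdig (monomial e 1) pl h1 ⟨e, hr, he, Or.inr (Or.inl ⟨hn, hf, hp, rfl⟩)⟩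
          rw [vv_red _ _ hr, hf, cf_fixed e hr hf]
          simp only [sg, if_pos hp, one_mul]
          exact S.add_mem this this
        · rw [vv_red _ _ hr, hf, cf_fixed e hr hf]
          simp only [sg, if_neg hp]
          rw [← map_add]; simp
      · exact hdig _ pl h1 ⟨e, hr, he, Or.inr (Or.inr ⟨hn, hf, rfl⟩)⟩
    · rw [vv_not_red _ _ hr]; exact S.zero_mem
  have hnred : F - redL K p m F ∈ S := by
    refine map_mem_of_homog (LinearMap.id - redL K p m) S hF (fun e he => ?_)
    simp only [LinearMap.sub_apply, LinearMap.id_apply, redL_monomial]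
    by_cases hr : Red p e
    · simp [hr]
    · simp only [hr, if_false, sub_zero]; exact hnr e hr he
  rcases hR with hR | ⟨pl, hpl, hn, hs⟩
  · have h3 : redL K p m F ∈ S := by
      refine map_mem_of_homog (redL K p m) S hF (fun e he => ?_)
      rw [redL_monomial]
      by_cases hr : Red p e
      swap
      · simp [hr]
      rw [if_pos hr]
      by_cases hn : n = m * (p - 1)
      · have h4 := S.add_mem (hvv True (hR _) hn e he) (hvv False (hR _) hn e he)
        have h5 : vv K p (sg K True) e + vv K p (sg K False) e = (2:K) • monomial e (1:K) := by
          simp only [sg, if_true, if_false, vv_red _ _ hr, two_smul]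
          have : monomial (flp p e) (1 * cf K e) + monomial (flp p e) (-1 * cf K e) = 0 := by
            rw [← map_add]; simp
          linear_combination this
        rw [h5] at h4
        exact (Submodule.smul_mem_iff S h2).1 h4
      · exact hdig _ False (hR _) ⟨e, hr, he, Or.inl ⟨hn, not_false, rfl⟩⟩
    have := S.add_mem hnred h3
    simpa using this
  · have h3 : TT K p m (sg K pl) F ∈ S :=
      map_mem_of_homog (TT K p m (sg K pl)) S hF (fun e he => hvv pl hpl hn e he)
    have h4 : TT K p m (sg K pl) F = (2:K) • redL K p m F := by
      rw [TT_apply, hs, smul_smul, sg_sq, one_smul, two_smul]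
    rw [h4] at h3
    have := S.add_mem hnred ((Submodule.smul_mem_iff S h2).1 h3)
    simpa using this

lemma IsDg.homog {n : ℕ} {pl : Prop} {g : Pol K m} (h : IsDg p n pl g) : g.IsHomogeneous n := by
  obtain ⟨e, hr, hd, h⟩ := h
  have he : ∀ c : K, (monomial e c).IsHomogeneous n := fun c => isHomogeneous_monomial _ hd
  rcases h with ⟨_, _, rfl⟩ | ⟨_, _, _, rfl⟩ | ⟨hn, _, rfl⟩
  · exact he _
  · exact he _
  · rw [vv_red _ _ hr]
    refine (he _).add (isHomogeneous_monomial _ ?_)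
    have := degree_flp hr; omega

lemma IsDg.red {n : ℕ} {pl : Prop} {g : Pol K m} (h : IsDg p n pl g) : redL K p m g = g := by
  obtain ⟨e, hr, hd, h⟩ := h
  rcases h with ⟨_, _, rfl⟩ | ⟨_, _, _, rfl⟩ | ⟨hn, _, rfl⟩
  · rw [redL_monomial, if_pos hr]
  · rw [redL_monomial, if_pos hr]
  · rw [vv, TT_apply, map_add, map_smul, redL_redL, redL_tauL]

lemma SG_vv (pl : Prop) (e : Ex m) : SG p pl (vv K p (sg K pl) e) := by
  unfold SG vv
  rw [TT_apply, map_add, map_add, map_smul, map_smul, redL_redL, redL_tauL, tauL_redL, tauL_tauL,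
    smul_add, smul_smul, sg_sq, one_smul, add_comm]

lemma SG_fixed {e : Ex m} (hr : Red p e) (hf : flp p e = e) {pl : Prop} (hp : pl) :
    SG p pl (monomial e (1:K)) := by
  unfold SG
  rw [tauL_monomial, redL_monomial, if_pos hr, if_pos hr, hf, cf_fixed e hr hf]
  simp [sg, hp]

lemma IsDg.sg {n : ℕ} {pl : Prop} {g : Pol K m} (h : IsDg p n pl g) (hn : n = m * (p - 1)) :
    SG p pl g := by
  obtain ⟨e, hr, hd, h⟩ := h
  rcases h with ⟨h, _, rfl⟩ | ⟨_, hf, hp, rfl⟩ | ⟨hn, _, rfl⟩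
  · exact absurd hn h
  · exact SG_fixed hr hf hp
  · exact SG_vv pl e

lemma IsDg.pl_imp {n : ℕ} {pl : Prop} {g : Pol K m} (h : IsDg p n pl g) (hp : pl) :
    n = m * (p - 1) := by
  obtain ⟨e, hr, hd, h⟩ := h
  rcases h with ⟨_, h, _⟩ | ⟨h, _⟩ | ⟨h, _⟩
  · exact absurd hp h
  · exact h
  · exact h

lemma IsDg.le {n : ℕ} {pl : Prop} {g : Pol K m} (h : IsDg p n pl g) : n ≤ 2 * (m * (p - 1)) := by
  obtain ⟨e, hr, hd, h⟩ := h
  have := degree_flp hr; omega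

end P5a

section P5b
open MvPolynomial
variable {p t m : ℕ} [hpp : Fact p.Prime] [hnz : NeZero t]

lemma tne : t ≠ 0 := hnz.out

lemma frob_add (l : ℕ) (a b : GaloisField p t) : (a + b) ^ p ^ l = a ^ p ^ l + b ^ p ^ l :=
  add_pow_char_pow a b p l

lemma evT_update (f : Fin t → Pol (GaloisField p t) m) (j : Fin t) (g) (v : SympV p t m) :
    evT (Function.update f j g) v
      = (eval (cv v) g) ^ (p ^ (j:ℕ)) * ∏ l ∈ Finset.univ.erase j, (eval (cv v) (f l)) ^ (p ^ (l : ℕ)) := by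
  unfold evT
  rw [← Finset.mul_prod_erase _ _ (Finset.mem_univ j)]
  congr 1
  · simp
  · apply Finset.prod_congr rfl; intro l hl; rw [Function.update_of_ne (Finset.ne_of_mem_erase hl)]

lemma evT_update_add (f : Fin t → Pol (GaloisField p t) m) (j : Fin t) (g h) :
    evT (Function.update f j (g + h)) = evT (Function.update f j g) + evT (Function.update f j h) := by
  funext v
  rw [Pi.add_apply, evT_update, evT_update, evT_update, map_add, frob_add, add_mul]

lemma evT_update_smul (f : Fin t → Pol (GaloisField p t) m) (j : Fin t) (c : GaloisField p t) (g) :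
    evT (Function.update f j (c • g)) = c ^ (p ^ (j:ℕ)) • evT (Function.update f j g) := by
  funext v
  rw [Pi.smul_apply, evT_update, evT_update, smul_eval, mul_pow, smul_eq_mul, mul_assoc]

lemma evT_update_zero (f : Fin t → Pol (GaloisField p t) m) (j : Fin t) :
    evT (Function.update f j 0) = 0 := by
  funext v
  rw [evT_update, map_zero, zero_pow (pow_ne_zero _ hpp.out.ne_zero), zero_mul]; rfl

def Uslot (N : Submodule (GaloisField p t) (SympV p t m → GaloisField p t))
    (f : Fin t → Pol (GaloisField p t) m) (j : Fin t) : Submodule (GaloisField p t) (Pol (GaloisField p t) m) where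
  carrier := {g | evT (Function.update f j g) ∈ N}
  zero_mem' := by
    simp only [Set.mem_ofPred_eq, evT_update_zero]; exact N.zero_mem
  add_mem' := by
    intro a b ha hb
    simp only [Set.mem_ofPred_eq, evT_update_add] at *
    exact N.add_mem ha hb
  smul_mem' := by
    intro c a ha
    simp only [Set.mem_ofPred_eq, evT_update_smul] at *
    exact N.smul_mem _ ha

lemma mem_Uslot {N : Submodule (GaloisField p t) (SympV p t m → GaloisField p t)}
    {f : Fin t → Pol (GaloisField p t) m} {j : Fin t} {g} :
    g ∈ Uslot N f j ↔ evT (Function.update f j g) ∈ N := Iff.rfl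

lemma evT_mem_of_span (N : Submodule (GaloisField p t) (SympV p t m → GaloisField p t))
    (G : Fin t → Set (Pol (GaloisField p t) m))
    (h : ∀ g, (∀ l, g l ∈ G l) → evT g ∈ N) (f : Fin t → Pol (GaloisField p t) m)
    (hf : ∀ l, f l ∈ Submodule.span (GaloisField p t) (G l)) : evT f ∈ N := by
  have key : ∀ T : Finset (Fin t), ∀ f : Fin t → Pol (GaloisField p t) m,
      (∀ l ∈ T, f l ∈ Submodule.span (GaloisField p t) (G l)) → (∀ l ∉ T, f l ∈ G l) → evT f ∈ N := by
    intro T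
    induction T using Finset.induction_on with
    | empty => intro f _ h2; exact h f (fun l => h2 l (by simp))
    | insert a T ha ih =>
      intro f h1 h2
      have h3 : Submodule.span (GaloisField p t) (G a) ≤ Uslot N f a := by
        rw [Submodule.span_le]
        intro g hg
        refine ih _ ?_ ?_
        · intro l hl
          have : l ≠ a := by rintro rfl; exact ha hl
          rw [Function.update_of_ne this]; exact h1 l (Finset.mem_insert_of_mem hl)
        · intro l hl
          by_cases hla : l = a
          · subst hla; simpa using hg
          · rw [Function.update_of_ne hla]; exact h2 l (by simp [hla, hl])
      have h4 := h3 (h1 a (Finset.mem_insert_self _ _))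
      rw [mem_Uslot, Function.update_eq_self] at h4
      exact h4
  exact key Finset.univ f (fun l _ => hf l) (fun l hl => absurd (Finset.mem_univ l) hl)

instance fintypeGF : Fintype (GaloisField p t) := Fintype.ofFinite _

lemma card_GF : Fintype.card (GaloisField p t) = p ^ t := by
  rw [← Nat.card_eq_fintype_card]; exact GaloisField.card p t tne

lemma pow_q (x : GaloisField p t) : x ^ (p ^ t) = x := by
  have := FiniteField.pow_card x
  rwa [card_GF] at this

lemma frob_next (j : Fin t) (x : GaloisField p t) : (x ^ p) ^ (p ^ (j:ℕ)) = x ^ (p ^ ((j + 1 : Fin t) : ℕ)) := by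
  rw [← pow_mul, ← pow_succ']
  by_cases h : (j:ℕ) + 1 < t
  · have : ((j + 1 : Fin t) : ℕ) = j + 1 := by
      rw [Fin.val_add_one_of_lt']; exact h
    rw [this]
  · have h1 : (j:ℕ) + 1 = t := by have := j.2; omega
    have h2 : ((j + 1 : Fin t) : ℕ) = 0 := by
      rw [Fin.val_add]
      by_cases ht : t = 1
      · subst ht; omega
      · have ht2 : 1 < t := by have := hnz.out; omega
        have : ((1 : Fin t) : ℕ) = 1 := by
          rw [Fin.val_one']; exact Nat.mod_eq_of_lt ht2
        rw [this, h1, Nat.mod_self]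
    rw [h1, h2, pow_q]; simp

lemma add_one_ne (ht : 1 < t) (j : Fin t) : j + 1 ≠ j := by
  intro h
  have h1 : (1 : Fin t) = 0 := by simpa using h
  have h2 := congrArg Fin.val h1
  rw [Fin.val_one', Nat.mod_eq_of_lt ht] at h2
  simp at h2

/-- carry -/
lemma carry (ht : 1 < t) (f : Fin t → Pol (GaloisField p t) m) (j : Fin t) (z : Sg m) (h) :
    evT (Function.update f j (X z ^ p * h))
      = evT (Function.update (Function.update f j h) (j + 1) (X z * f (j + 1))) := by
  funext v
  have hj := add_one_ne ht j
  have hm : j + 1 ∈ Finset.univ.erase j := by simp [hj]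
  have hm' : j ∈ Finset.univ.erase (j + 1) := by simp [Ne.symm hj]
  rw [evT_update, evT_update, ← Finset.mul_prod_erase _ _ hm, ← Finset.mul_prod_erase _ _ hm',
    Finset.erase_right_comm]
  rw [map_mul, map_mul, mul_pow, mul_pow, map_pow, frob_next]
  have : ∏ x ∈ (Finset.univ.erase (j + 1)).erase j, eval (cv v) (Function.update f j h x) ^ p ^ (x:ℕ)
      = ∏ x ∈ (Finset.univ.erase (j + 1)).erase j, eval (cv v) (f x) ^ p ^ (x:ℕ) := by
    apply Finset.prod_congr rfl; intro x hx
    rw [Function.update_of_ne (Finset.ne_of_mem_erase hx)]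
  rw [this, Function.update_self]
  ring

def toEx (α β : Fin m → ℕ) : Ex m := Finsupp.equivFunOnFinite.symm (Sum.elim α β)
lemma toEx_inl (α β : Fin m → ℕ) (i) : toEx α β (Sum.inl i) = α i := rfl
lemma toEx_inr (α β : Fin m → ℕ) (i) : toEx α β (Sum.inr i) = β i := rfl
lemma toEx_eta (e : Ex m) : toEx (fun i => e (Sum.inl i)) (fun i => e (Sum.inr i)) = e := by
  ext z; cases z <;> rfl
lemma toEx_degree (α β : Fin m → ℕ) : (toEx α β).degree = ∑ i, α i + ∑ i, β i := by
  rw [degree_eq_sum', Fintype.sum_sum_type]; rfl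
lemma toEx_flp (α β : Fin m → ℕ) : flp p (toEx α β) = toEx (abar p β) (abar p α) := by
  ext z; cases z <;> rfl
lemma toEx_cf (α β : Fin m → ℕ) : cf (GaloisField p t) (toEx α β)
    = (-1) ^ ((∑ i, β i) + m) * factk p t α * factk p t β := by
  unfold cf factk
  rw [Fintype.prod_sum_type, mul_assoc]; rfl
lemma toEx_red (α β : Fin m → ℕ) : Red p (toEx α β) ↔ (∀ i, α i ≤ p - 1) ∧ (∀ i, β i ≤ p - 1) := by
  constructor
  · intro h; exact ⟨fun i => h (Sum.inl i), fun i => h (Sum.inr i)⟩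
  · rintro ⟨h1, h2⟩ (i | i)
    · exact h1 i
    · exact h2 i
lemma toEx_inj {α β α' β' : Fin m → ℕ} : toEx α β = toEx α' β' ↔ α = α' ∧ β = β' := by
  constructor
  · intro h
    exact ⟨funext fun i => DFunLike.congr_fun h (Sum.inl i), funext fun i => DFunLike.congr_fun h (Sum.inr i)⟩
  · rintro ⟨rfl, rfl⟩; rfl
lemma toEx_fix {α β : Fin m → ℕ} (h : Red p (toEx α β)) : flp p (toEx α β) = toEx α β ↔ β = abar p α := by
  rw [toEx_flp, toEx_inj]
  constructor
  · rintro ⟨_, h⟩; exact h.symm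
  · rintro rfl
    refine ⟨?_, rfl⟩
    funext i
    have := h (Sum.inl i)
    rw [toEx_inl] at this
    simp only [abar]; omega
lemma fnc_monomial (α β : Fin m → ℕ) (c : GaloisField p t) :
    fnc (monomial (toEx α β) c) = c • mono α β := by
  funext v
  simp only [fnc, eval_monomial, mono, Pi.smul_apply, smul_eq_mul]
  rw [Finsupp.prod_fintype _ _ (by simp), Fintype.prod_sum_type, Finset.prod_mul_distrib]; rfl

lemma isDigit_iff (n : ℕ) (pl : Prop) (h : SympV p t m → GaloisField p t) :
    IsDigit p t m n pl h ↔ ∃ g : Pol (GaloisField p t) m, IsDg p n pl g ∧ h = fnc g := by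
  have hvv : ∀ α β : Fin m → ℕ, Red p (toEx α β) → fnc (vv (GaloisField p t) p (sg _ pl) (toEx α β))
      = mono α β + ((if pl then (1 : GaloisField p t) else -1) *
          ((-1) ^ ((∑ i, β i) + m) * factk p t α * factk p t β)) • mono (abar p β) (abar p α) := by
    intro α β hr
    rw [vv_red _ _ hr, toEx_flp, toEx_cf]
    have : ∀ a b : Pol (GaloisField p t) m, fnc (a + b) = fnc a + fnc b := by
      intro a b; funext v; simp [fnc]
    rw [this, fnc_monomial, fnc_monomial, one_smul]; rfl
  constructor
  · rintro (⟨h1, h2, α, β, ha, hb, hs, rfl⟩ | ⟨h1, h2, α, ha, rfl⟩ | ⟨h1, α, β, ha, hb, hs, hne, rfl⟩)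
    · refine ⟨monomial (toEx α β) 1, ⟨toEx α β, (toEx_red _ _).2 ⟨ha, hb⟩, ?_, Or.inl ⟨h1, h2, rfl⟩⟩, ?_⟩
      · rw [toEx_degree, hs]
      · rw [fnc_monomial, one_smul]
    · have hr : Red p (toEx α (abar p α)) := (toEx_red _ _).2 ⟨ha, fun i => by simp [abar]⟩
      have hf := (toEx_fix hr).2 rfl
      refine ⟨monomial (toEx α (abar p α)) 1, ⟨toEx α (abar p α), hr, ?_,
        Or.inr (Or.inl ⟨h1, hf, h2, rfl⟩)⟩, ?_⟩
      · have := degree_flp hr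
        rw [hf] at this; omega
      · rw [fnc_monomial, one_smul]
    · have hr := (toEx_red _ _).2 ⟨ha, hb⟩
      refine ⟨vv _ p (sg _ pl) (toEx α β), ⟨toEx α β, hr, ?_,
        Or.inr (Or.inr ⟨h1, fun h => hne ((toEx_fix hr).1 h), rfl⟩)⟩, ?_⟩
      · rw [toEx_degree, hs, h1]
      · rw [hvv _ _ hr]
  · rintro ⟨g, ⟨e, hr, hd, h⟩, rfl⟩
    obtain ⟨α, β, rfl⟩ : ∃ α β, e = toEx α β := ⟨_, _, (toEx_eta e).symm⟩
    obtain ⟨ha, hb⟩ := (toEx_red _ _).1 hr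
    rw [toEx_degree] at hd
    rcases h with ⟨h1, h2, rfl⟩ | ⟨h1, hf, h2, rfl⟩ | ⟨h1, hf, rfl⟩
    · left
      exact ⟨h1, h2, α, β, ha, hb, hd, by rw [fnc_monomial, one_smul]⟩
    · right; left
      rw [toEx_fix hr] at hf
      subst hf
      exact ⟨h1, h2, α, ha, by rw [fnc_monomial, one_smul]⟩
    · right; right
      rw [Ne, toEx_fix hr] at hf
      exact ⟨h1, α, β, ha, hb, by rw [hd, h1], hf, by rw [hvv _ _ hr]⟩

lemma isSBF_iff (lam : Fin t → ℕ) (eps : Finset (Fin t)) (f : SympV p t m → GaloisField p t) :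
    IsSBF p t m lam eps f ↔ ∃ g : Fin t → Pol (GaloisField p t) m,
      (∀ j, IsDg p (lam j) (j ∈ eps) (g j)) ∧ f = evT g := by
  constructor
  · rintro ⟨g, hg, rfl⟩
    choose G hG hG2 using fun j => (isDigit_iff _ _ _).1 (hg j)
    refine ⟨G, hG, ?_⟩
    funext v
    simp only [evT]
    apply Finset.prod_congr rfl; intro j _; rw [hG2]; rfl
  · rintro ⟨g, hg, rfl⟩
    exact ⟨fun j => fnc (g j), fun j => (isDigit_iff _ _ _).2 ⟨g j, hg j, rfl⟩, rfl⟩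

end P5b
end


noncomputable section
set_option linter.unusedSectionVars false
set_option linter.unusedSimpArgs false

def caseLo (d : ℕ) : ℤ := if d = 0 then 1 else 0

/-- lower one coordinate -/
def dn {t : ℕ} (s : Fin t → ℤ) (j : Fin t) : Fin t → ℤ := Function.update s j (s j - 1)

section P6
variable {p t m d : ℕ} [hpp : Fact p.Prime] [hnz : NeZero t]

lemma caseLo_nonneg (d : ℕ) : 0 ≤ caseLo d := by unfold caseLo; split_ifs <;> simp

lemma memCase_iff (s : Fin t → ℤ) (eps : Finset (Fin t)) : memCase p t m d s eps ↔
    (∀ j, caseLo d ≤ s j ∧ s j ≤ 2 * m - 1) ∧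
    (∀ j, 0 ≤ lamOf p t d s j ∧ lamOf p t d s j ≤ 2 * m * ((p : ℤ) - 1)) ∧
    eps ⊆ Jset p t m d s := by
  unfold memCase memS memSd memH memHd caseLo
  split_ifs with h
  · subst h; rw [and_assoc]
  · rw [and_assoc]

lemma mem_Jset {s : Fin t → ℤ} {j : Fin t} : j ∈ Jset p t m d s ↔ lamOf p t d s j = m * ((p : ℤ) - 1) := by
  simp [Jset]

lemma mem_Zset {s' s : Fin t → ℤ} {j : Fin t} : j ∈ Zset p t m d s' s ↔
    s' j = s j ∧ s' (j + 1) = s (j + 1) ∧ lamOf p t d s' j = m * ((p : ℤ) - 1) := by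
  simp [Zset]

lemma leSd_iff {s' s : Fin t → ℤ} {eps' eps : Finset (Fin t)} : leSd p t m d s' eps' s eps ↔
    (∀ j, s' j ≤ s j) ∧ ∀ l ∈ Zset p t m d s' s, (l ∈ eps' ↔ l ∈ eps) := by
  unfold leSd
  refine and_congr Iff.rfl ?_
  rw [Finset.ext_iff]
  refine forall_congr' (fun l => ?_)
  simp only [Finset.mem_inter]
  tauto

lemma lam_congr {s' s : Fin t → ℤ} {j : Fin t} (h1 : s' j = s j) (h2 : s' (j + 1) = s (j + 1)) :
    lamOf p t d s' j = lamOf p t d s j := by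
  unfold lamOf; rw [h1, h2]

lemma leSd_refl (s : Fin t → ℤ) (eps : Finset (Fin t)) : leSd p t m d s eps s eps :=
  ⟨fun _ => le_rfl, rfl⟩

lemma leSd_trans {a b c : Fin t → ℤ} {ea eb ec : Finset (Fin t)} (h1 : leSd p t m d a ea b eb)
    (h2 : leSd p t m d b eb c ec) : leSd p t m d a ea c ec := by
  rw [leSd_iff] at *
  refine ⟨fun j => (h1.1 j).trans (h2.1 j), fun l hl => ?_⟩
  rw [mem_Zset] at hl
  have e1 : a l = b l := le_antisymm (h1.1 l) (by rw [hl.1]; exact h2.1 l)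
  have e2 : a (l+1) = b (l+1) := le_antisymm (h1.1 _) (by rw [hl.2.1]; exact h2.1 _)
  rw [h1.2 l (mem_Zset.2 ⟨e1, e2, hl.2.2⟩), h2.2 l (mem_Zset.2 ⟨by rw [← e1, hl.1], by rw [← e2, hl.2.1],
    by rw [← lam_congr e1 e2]; exact hl.2.2⟩)]

lemma eps_eq {s : Fin t → ℤ} {e e' : Finset (Fin t)} (h : memCase p t m d s e) (h' : memCase p t m d s e')
    (hl : leSd p t m d s e' s e) : e' = e := by
  rw [memCase_iff] at h h'
  rw [leSd_iff] at hl
  ext l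
  constructor
  · intro hh
    exact (hl.2 l (mem_Zset.2 ⟨rfl, rfl, mem_Jset.1 (h'.2.2 hh)⟩)).1 hh
  · intro hh
    exact (hl.2 l (mem_Zset.2 ⟨rfl, rfl, mem_Jset.1 (h.2.2 hh)⟩)).2 hh

lemma cyc {P : Fin t → Prop} (h : ∀ j, P j → P (j + 1)) {j0 : Fin t} (h0 : P j0) : ∀ j, P j := by
  have key : ∀ n : ℕ, P (j0 + Fin.ofNat t n) := by
    intro n
    induction n with
    | zero => simpa using h0
    | succ n ih =>
      have := h _ ih
      have e : j0 + Fin.ofNat t n + 1 = j0 + Fin.ofNat t (n + 1) := by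
        rw [add_assoc]; congr 1
        ext; simp [Fin.val_add]
      rwa [e] at this
  intro j
  have := key (j - j0).val
  have e : Fin.ofNat t (j - j0).val = j - j0 := by ext; simp [Nat.mod_eq_of_lt (j - j0).isLt]
  rw [e] at this
  simpa using this

lemma cyc' {P : Fin t → Prop} (h : ∀ j, P (j + 1) → P j) {j0 : Fin t} (h0 : P j0) : ∀ j, P j := by
  by_contra hcon
  push Not at hcon
  obtain ⟨j, hj⟩ := hcon
  exact cyc (P := fun j => ¬ P j) (fun j hj hj' => hj (h j hj')) hj j0 h0

lemma sum_shift (s : Fin t → ℤ) : ∑ j, s (j + 1) = ∑ j, s j :=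
  Equiv.sum_comp (Equiv.addRight (1 : Fin t)) s

lemma lam_sum (s : Fin t → ℤ) : ∑ j, lamOf p t d s j
    = ((p:ℤ) - 1) * ∑ j, s j + ∑ j : Fin t, (digitp p d j : ℤ) := by
  unfold lamOf
  rw [Finset.sum_add_distrib, Finset.sum_sub_distrib, ← Finset.mul_sum, sum_shift]; ring

lemma digit_le (d j : ℕ) : digitp p d j ≤ p - 1 := by
  have := Nat.mod_lt (d / p ^ j) hpp.out.pos
  unfold digitp; omega

lemma digit_le' (d j : ℕ) : (digitp p d j : ℤ) ≤ p - 1 := by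
  have := digit_le (p := p) d j
  have := hpp.out.pos
  omega

lemma digits_top (n d : ℕ) (h : ∀ j < n, digitp p d j = p - 1) : d % p ^ n = p ^ n - 1 := by
  induction n with
  | zero => simp [Nat.mod_one]
  | succ n ih =>
    rw [Nat.mod_pow_succ, ih (fun j hj => h j (by omega))]
    have := h n (by omega)
    unfold digitp at this
    rw [this]
    have h1 := hpp.out.pos
    have h2 : 0 < p ^ n := pow_pos h1 n
    obtain ⟨k, hk⟩ : ∃ k, p = k + 1 := ⟨p - 1, by omega⟩
    rw [pow_succ]
    have : p ^ n * p = p ^ n * (p - 1) + p ^ n := by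
      conv_lhs => rw [show p = (p - 1) + 1 by omega]
      rw [show p - 1 + 1 = p by omega]
      conv_lhs => rw [show p ^ n * p = p ^ n * ((p - 1) + 1) by rw [show p - 1 + 1 = p by omega]]
      ring
    omega

lemma digits_zero (n d : ℕ) (h : ∀ j < n, digitp p d j = 0) : d % p ^ n = 0 := by
  induction n with
  | zero => simp [Nat.mod_one]
  | succ n ih =>
    rw [Nat.mod_pow_succ, ih (fun j hj => h j (by omega))]
    have := h n (by omega)
    unfold digitp at this
    rw [this]; simp

lemma q_big (ht : 1 < t) : 4 ≤ p ^ t := by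
  calc 4 = 2 ^ 2 := by norm_num
    _ ≤ p ^ 2 := Nat.pow_le_pow_left hpp.out.two_le 2
    _ ≤ p ^ t := Nat.pow_le_pow_right hpp.out.pos (by omega)

lemma exists_digit_ne (ht : 1 < t) (hd : d ≤ p ^ t - 2) : ∃ j : Fin t, digitp p d j ≠ p - 1 := by
  by_contra hcon; push Not at hcon
  have h := digits_top t d (fun j hj => hcon ⟨j, hj⟩)
  have := q_big (p := p) ht
  rw [Nat.mod_eq_of_lt (by omega)] at h
  omega

lemma digit_sum_lt (ht : 1 < t) (hd : d ≤ p ^ t - 2) :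
    ∑ j : Fin t, (digitp p d j : ℤ) < t * ((p:ℤ) - 1) := by
  obtain ⟨j0, hj0⟩ := exists_digit_ne ht hd
  have h1 : ∑ j : Fin t, (digitp p d j : ℤ) < ∑ j : Fin t, ((p:ℤ) - 1) := by
    apply Finset.sum_lt_sum
    · intro j _; exact digit_le' d j
    · refine ⟨j0, Finset.mem_univ _, ?_⟩
      have := digit_le (p := p) d j0
      have := hpp.out.pos
      omega
  simp only [Finset.sum_const, Finset.card_univ, Fintype.card_fin, nsmul_eq_mul] at h1
  exact h1

lemma F1 (ht : 1 < t) (hd : d ≤ p ^ t - 2) {s : Fin t → ℤ} (h : ∀ j, 0 ≤ lamOf p t d s j) :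
    ∀ j, 0 ≤ s j := by
  by_contra hcon; push Not at hcon
  obtain ⟨j0, hj0⟩ := hcon
  have hp := hpp.out.two_le
  have hall : ∀ j, s j ≤ -1 := by
    refine cyc' (P := fun j => s j ≤ -1) (fun j hj => ?_) (j0 := j0) (by omega)
    have h1 := h j
    have h2 := digit_le' (p := p) d j
    unfold lamOf at h1
    have : (p:ℤ) * s (j+1) ≤ p * (-1) := mul_le_mul_of_nonneg_left hj (by positivity)
    linarith
  have h1 : 0 ≤ ∑ j, lamOf p t d s j := Finset.sum_nonneg (fun j _ => h j)
  rw [lam_sum] at h1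
  have h2 := digit_sum_lt (p := p) ht hd
  have h3 : ∑ j, s j ≤ ∑ j : Fin t, (-1 : ℤ) := Finset.sum_le_sum (fun j _ => hall j)
  simp at h3
  have h4 : ((p:ℤ) - 1) * ∑ j, s j ≤ ((p:ℤ) - 1) * (-t) := mul_le_mul_of_nonneg_left h3 (by
    have : (2:ℤ) ≤ p := by exact_mod_cast hp
    linarith)
  nlinarith

lemma digit_zero' (j : ℕ) : digitp p 0 j = 0 := by simp [digitp]

lemma F2 (ht : 1 < t) {s : Fin t → ℤ} (h : ∀ j, 0 ≤ lamOf p t 0 s j)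
    (hne : ∃ j, lamOf p t 0 s j ≠ 0) : ∀ j, 1 ≤ s j := by
  have h0 := F1 (d := 0) ht (by omega) h
  by_contra hcon; push Not at hcon
  obtain ⟨j0, hj0⟩ := hcon
  have hall : ∀ j, s j = 0 := by
    refine cyc' (P := fun j => s j = 0) (fun j hj => ?_) (j0 := j0) (by have := h0 j0; omega)
    have h1 := h j
    have := h0 j
    simp only [lamOf, hj, digit_zero'] at h1
    simp at h1; omega
  obtain ⟨j, hj⟩ := hne
  apply hj
  simp [lamOf, hall, digit_zero']

lemma lo_of (ht : 1 < t) (hd : d ≤ p ^ t - 2) {s : Fin t → ℤ} (h : ∀ j, 0 ≤ lamOf p t d s j)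
    (hne : d = 0 → ∃ j, lamOf p t d s j ≠ 0) : ∀ j, caseLo d ≤ s j := by
  unfold caseLo
  split_ifs with h0
  · subst h0; exact F2 ht h (hne rfl)
  · exact F1 ht hd h

lemma nz_of_lo (hd : d = 0) {s : Fin t → ℤ} (h : ∀ j, caseLo d ≤ s j) :
    ∃ j, lamOf p t d s j ≠ 0 := by
  by_contra hcon; push Not at hcon
  have h1 := lam_sum (p := p) (d := d) s
  rw [Finset.sum_eq_zero (fun j _ => hcon j)] at h1
  subst hd
  simp only [digit_zero', caseLo, if_true] at h1 h
  have hp : (2:ℤ) ≤ p := by exact_mod_cast hpp.out.two_le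
  have h2 : 0 < ∑ j, s j := Finset.sum_pos (fun j _ => by have := h j; omega) ⟨0, Finset.mem_univ _⟩
  have : 0 < ((p:ℤ) - 1) * ∑ j, s j := mul_pos (by linarith) h2
  simp at h1
  rcases h1 with h1 | h1
  all_goals omega

lemma dn_self (s : Fin t → ℤ) (j) : dn s j j = s j - 1 := by simp [dn]
lemma dn_ne (s : Fin t → ℤ) {j l} (h : l ≠ j) : dn s j l = s l := by simp [dn, h]
lemma dn_le (s : Fin t → ℤ) (j l) : dn s j l ≤ s l := by
  by_cases h : l = j
  · subst h; rw [dn_self]; omega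
  · rw [dn_ne _ h]
lemma dn_sum (s : Fin t → ℤ) (j) : ∑ l, dn s j l = ∑ l, s l - 1 := by
  unfold dn
  rw [← Finset.add_sum_erase _ _ (Finset.mem_univ j), ← Finset.add_sum_erase _ s (Finset.mem_univ j)]
  rw [Finset.sum_congr rfl (fun l hl => Function.update_of_ne (Finset.ne_of_mem_erase hl) _ _)]
  simp only [Function.update_self]; ring

lemma lam_dn_j (ht : 1 < t) (s : Fin t → ℤ) (j) : lamOf p t d (dn s (j+1)) j = lamOf p t d s j - p := by
  unfold lamOf; rw [dn_self, dn_ne _ (add_one_ne ht j).symm]; ring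
lemma lam_dn_j1 (ht : 1 < t) (s : Fin t → ℤ) (j) :
    lamOf p t d (dn s (j+1)) (j+1) = lamOf p t d s (j+1) + 1 := by
  unfold lamOf; rw [dn_self, dn_ne _ (add_one_ne ht (j+1))]; ring
lemma lam_dn_ne (s : Fin t → ℤ) {j l} (h1 : l ≠ j) (h2 : l ≠ j + 1) :
    lamOf p t d (dn s (j+1)) l = lamOf p t d s l := by
  refine lam_congr (dn_ne _ h2) (dn_ne _ ?_)
  simpa using h1

lemma Z_dn {s s0 : Fin t → ℤ} (hle : ∀ j, s j ≤ s0 j) {j l : Fin t}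
    (h : l ∈ Zset p t m d (dn s (j+1)) s0) : l ≠ j ∧ l ≠ j + 1 ∧ l ∈ Zset p t m d s s0 := by
  rw [mem_Zset] at h
  have hj := hle (j+1)
  have h1 : l ≠ j + 1 := by
    rintro rfl; have := h.1; rw [dn_self] at this; omega
  have h2 : l ≠ j := by
    rintro rfl; have := h.2.1; rw [dn_self] at this; omega
  refine ⟨h2, h1, mem_Zset.2 ?_⟩
  rw [dn_ne _ h1, dn_ne _ (by simpa using h2), lam_dn_ne _ h2 h1] at h
  exact h

lemma d_eq_zero (ht : 1 < t) (hd : d ≤ p ^ t - 2) (h : ∀ j : Fin t, digitp p d j = 0) : d = 0 := by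
  have h1 := digits_zero t d (fun j hj => h ⟨j, hj⟩)
  have := q_big (p := p) ht
  rwa [Nat.mod_eq_of_lt (by omega)] at h1

lemma lemC (ht : 1 < t) (hm : 2 ≤ m) (hd : d ≤ p ^ t - 2) {s0 s2 : Fin t → ℤ}
    (hs0 : ∀ j, caseLo d ≤ s0 j ∧ s0 j ≤ 2 * m - 1)
    (hl0 : ∀ j, 0 ≤ lamOf p t d s0 j ∧ lamOf p t d s0 j ≤ 2 * m * ((p : ℤ) - 1))
    (hs2 : ∀ j, caseLo d ≤ s2 j)
    (hl2 : ∀ j, 0 ≤ lamOf p t d s2 j ∧ lamOf p t d s2 j ≤ 2 * m * ((p : ℤ) - 1))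
    (hle : ∀ j, s2 j ≤ s0 j) (hne : s2 ≠ s0) :
    ∃ j, s2 (j+1) < s0 (j+1) ∧ (p:ℤ) ≤ lamOf p t d s0 j ∧
      lamOf p t d s0 (j+1) < 2 * m * ((p : ℤ) - 1) := by
  by_contra hcon; push Not at hcon
  have hp : (2:ℤ) ≤ p := by exact_mod_cast hpp.out.two_le
  have hm' : (2:ℤ) ≤ m := by exact_mod_cast hm
  have hB : (p:ℤ) ≤ 2 * m * ((p:ℤ) - 1) := by nlinarith
  obtain ⟨a, ha⟩ : ∃ a, s2 a < s0 a := by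
    by_contra h; push Not at h
    exact hne (funext fun j => le_antisymm (hle j) (h j))
  by_cases hA : ∃ l, s2 l < s0 l ∧ lamOf p t d s0 l = 2 * m * ((p : ℤ) - 1)
  · obtain ⟨l, hl⟩ := hA
    have hall := cyc (P := fun l => s2 l < s0 l ∧ lamOf p t d s0 l = 2 * m * ((p : ℤ) - 1))
      (fun l hl => by
        have h1 : s2 (l+1) < s0 (l+1) := by
          have h2 := (hl2 l).2
          rw [← hl.2] at h2
          unfold lamOf at h2
          by_contra h3; push Not at h3
          have : (p:ℤ) * s0 (l+1) ≤ p * s2 (l+1) := mul_le_mul_of_nonneg_left h3 (by linarith)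
          linarith [hl.1]
        refine ⟨h1, le_antisymm (hl0 _).2 (hcon l h1 ?_)⟩
        rw [hl.2]; exact hB) hl
    have h1 := lam_sum (p := p) (d := d) s0
    rw [Finset.sum_congr rfl (fun j _ => (hall j).2)] at h1
    have h2 := digit_sum_lt (p := p) ht hd
    have h3 : ∑ j, s0 j ≤ ∑ j : Fin t, (2 * (m:ℤ) - 1) := Finset.sum_le_sum (fun j _ => (hs0 j).2)
    simp only [Finset.sum_const, Finset.card_univ, Fintype.card_fin, nsmul_eq_mul] at h1 h3
    have h4 := mul_le_mul_of_nonneg_left h3 (show (0:ℤ) ≤ p - 1 by linarith)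
    nlinarith
  · push Not at hA
    have hlt : ∀ j, s2 (j+1) < s0 (j+1) → lamOf p t d s0 j < p := by
      intro j hj
      by_contra h; push Not at h
      exact hA _ hj (le_antisymm (hl0 _).2 (hcon j hj h))
    have hall := cyc' (P := fun l => s2 l < s0 l) (fun j hj => by
      have h1 := hlt j hj
      have h2 := (hl2 j).1
      unfold lamOf at h1 h2
      by_contra h3; push Not at h3
      have : (p:ℤ) * s2 (j+1) ≤ p * (s0 (j+1) - 1) := mul_le_mul_of_nonneg_left (by linarith) (by linarith)
      linarith) ha
    have h1 := lam_sum (p := p) (d := d) s0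
    have h2 := lam_sum (p := p) (d := d) s2
    have h3 : ∑ j, lamOf p t d s0 j ≤ ∑ j : Fin t, ((p:ℤ) - 1) :=
      Finset.sum_le_sum (fun j _ => by have := hlt j (hall _); linarith)
    have h4 : ∑ j, s2 j ≤ ∑ j, (s0 j - 1) := Finset.sum_le_sum (fun j _ => by have := hall j; linarith)
    rw [Finset.sum_sub_distrib] at h4
    simp only [Finset.sum_const, Finset.card_univ, Fintype.card_fin, nsmul_eq_mul, mul_one] at h3 h4
    have h5 := mul_le_mul_of_nonneg_left h4 (show (0:ℤ) ≤ p - 1 by linarith)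
    have h6 : ∑ j, lamOf p t d s2 j ≤ 0 := by nlinarith
    have h7 : ∀ j, lamOf p t d s2 j = 0 := by
      have := (Finset.sum_eq_zero_iff_of_nonneg (fun j _ => (hl2 j).1)).1
        (le_antisymm h6 (Finset.sum_nonneg (fun j _ => (hl2 j).1)))
      exact fun j => this j (Finset.mem_univ j)
    by_cases hd0 : d = 0
    · obtain ⟨j, hj⟩ := nz_of_lo (p := p) hd0 hs2
      exact hj (h7 j)
    · have h8 : 0 ≤ ∑ j, s2 j := Finset.sum_nonneg (fun j _ => (caseLo_nonneg d).trans (hs2 j))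
      have h9 : 0 ≤ ((p:ℤ) - 1) * ∑ j, s2 j := mul_nonneg (by linarith) h8
      have h10 : ∑ j : Fin t, (digitp p d j : ℤ) = 0 :=
        le_antisymm (by linarith) (Finset.sum_nonneg (fun j _ => by positivity))
      have h11 := (Finset.sum_eq_zero_iff_of_nonneg (fun j _ => by positivity)).1 h10
      exact hd0 (d_eq_zero ht hd (fun j => by exact_mod_cast h11 j (Finset.mem_univ j)))

/-- interpolation -/
lemma interp (ht : 1 < t) (hm : 2 ≤ m) (hd : d ≤ p ^ t - 2) {s0 s2 : Fin t → ℤ} {e0 e2 : Finset (Fin t)}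
    (h0 : memCase p t m d s0 e0) (h2 : memCase p t m d s2 e2) (hle : leSd p t m d s2 e2 s0 e0)
    (hne : s2 ≠ s0) : ∃ j e1, memCase p t m d (dn s0 (j+1)) e1 ∧
      leSd p t m d (dn s0 (j+1)) e1 s0 e0 ∧ leSd p t m d s2 e2 (dn s0 (j+1)) e1 := by
  rw [memCase_iff] at h0 h2
  rw [leSd_iff] at hle
  obtain ⟨j, hj1, hj2, hj3⟩ := lemC ht hm hd h0.1 h0.2.1 (fun j => (h2.1 j).1) h2.2.1 hle.1 hne
  have hj := add_one_ne ht j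
  have hle1 : ∀ l, s2 l ≤ dn s0 (j+1) l := by
    intro l
    by_cases h : l = j + 1
    · subst h; rw [dn_self]; omega
    · rw [dn_ne _ h]; exact hle.1 l
  refine ⟨j, (Finset.univ.filter fun l => if l = j ∨ l = j + 1 then l ∈ e2 ∧ l ∈ Jset p t m d (dn s0 (j+1))
    else l ∈ e0), ?_, ?_, ?_⟩
  · rw [memCase_iff]
    refine ⟨fun l => ⟨(h2.1 l).1.trans (hle1 l), (dn_le _ _ _).trans (h0.1 l).2⟩, fun l => ?_, ?_⟩
    · by_cases c1 : l = j
      · subst c1; rw [lam_dn_j ht]; have := h0.2.1 l; constructor <;> omega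
      by_cases c2 : l = j + 1
      · subst c2; rw [lam_dn_j1 ht]; have := h0.2.1 (j+1); constructor <;> omega
      · rw [lam_dn_ne _ c1 c2]; exact h0.2.1 l
    · intro l hl
      simp only [Finset.mem_filter, Finset.mem_univ, true_and] at hl
      split_ifs at hl with c
      · exact hl.2
      · push Not at c
        have := h0.2.2 hl
        rw [mem_Jset] at this ⊢
        rw [lam_dn_ne _ c.1 c.2, this]
  · rw [leSd_iff]
    refine ⟨dn_le _ _, fun l hl => ?_⟩
    obtain ⟨c1, c2, _⟩ := Z_dn (fun _ => le_rfl) hl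
    simp [c1, c2]
  · rw [leSd_iff]
    refine ⟨hle1, fun l hl => ?_⟩
    simp only [Finset.mem_filter, Finset.mem_univ, true_and]
    rw [mem_Zset] at hl
    split_ifs with c
    · have : l ∈ Jset p t m d (dn s0 (j+1)) := by
        rw [mem_Jset, ← lam_congr hl.1 hl.2.1]; exact hl.2.2
      tauto
    · push Not at c
      apply hle.2 l
      rw [mem_Zset]
      rw [dn_ne _ c.2, dn_ne _ (by simpa using c.1)] at hl
      exact hl

end P6
end


noncomputable section
set_option linter.unusedSectionVars false
set_option linter.unusedSimpArgs false

/-- filtration of Y -/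
def Yn (p t m d : ℕ) [Fact p.Prime] [NeZero t] (s : Fin t → ℤ)
    (eps : Finset (Fin t)) (n : ℤ) :
    Submodule (GaloisField p t) (SympV p t m → GaloisField p t) :=
  Submodule.span (GaloisField p t)
    {f | ∃ s' eps', memCase p t m d s' eps' ∧ leSd p t m d s' eps' s eps ∧ ∑ l, s' l ≤ n ∧
      IsSBF p t m (lamOfN p t d s') eps' f}

/-- admissible tuples of polynomials -/
structure Adm (p t m d : ℕ) [Fact p.Prime] [NeZero t] (s0 : Fin t → ℤ) (e0 : Finset (Fin t))
    (s : Fin t → ℤ) (F : Fin t → Pol (GaloisField p t) m) : Prop where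
  nn : ∀ l, 0 ≤ lamOf p t d s l
  nz : d = 0 → ∃ l, lamOf p t d s l ≠ 0
  le : ∀ l, s l ≤ s0 l
  hom : ∀ l, (F l).IsHomogeneous (lamOfN p t d s l)
  sgn : ∀ l ∈ Zset p t m d s s0, SG p (l ∈ e0) (F l)

section P7
open MvPolynomial
variable {p t m d : ℕ} [hpp : Fact p.Prime] [hnz : NeZero t]
variable {s0 : Fin t → ℤ} {e0 : Finset (Fin t)}

lemma Yn_mono {n n' : ℤ} (h : n ≤ n') : Yn p t m d s0 e0 n ≤ Yn p t m d s0 e0 n' := by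
  apply Submodule.span_mono
  rintro f ⟨s', e', h1, h2, h3, h4⟩
  exact ⟨s', e', h1, h2, h3.trans h, h4⟩

lemma Ymod_eq : Ymod p t m d s0 e0 = Yn p t m d s0 e0 (∑ l, s0 l) := by
  unfold Ymod Yn
  congr 1
  ext f
  constructor
  · rintro ⟨s', e', h1, h2, h4⟩
    exact ⟨s', e', h1, h2, Finset.sum_le_sum (fun l _ => h2.1 l), h4⟩
  · rintro ⟨s', e', h1, h2, _, h4⟩
    exact ⟨s', e', h1, h2, h4⟩

lemma Yltmod_eq (h0 : memCase p t m d s0 e0) :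
    Yltmod p t m d s0 e0 = Yn p t m d s0 e0 (∑ l, s0 l - 1) := by
  unfold Yltmod Yn
  congr 1
  ext f
  constructor
  · rintro ⟨s', e', h1, h2, h3, h4⟩
    refine ⟨s', e', h1, h2, ?_, h4⟩
    have hne : s' ≠ s0 := by
      rintro rfl
      exact h3 ⟨rfl, eps_eq h0 h1 h2⟩
    have hlt : ∑ l, s' l < ∑ l, s0 l := by
      apply Finset.sum_lt_sum (fun l _ => h2.1 l)
      by_contra hcon; push Not at hcon
      exact hne (funext fun l => le_antisymm (h2.1 l) (hcon l (Finset.mem_univ l)))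
    omega
  · rintro ⟨s', e', h1, h2, h3, h4⟩
    refine ⟨s', e', h1, h2, ?_, h4⟩
    rintro ⟨rfl, _⟩
    omega

lemma cast_N : ((m * (p - 1) : ℕ) : ℤ) = m * ((p:ℤ) - 1) := by
  have := hpp.out.pos
  push_cast [Nat.cast_sub this]; ring

lemma lamN_cast {s : Fin t → ℤ} {l} (h : 0 ≤ lamOf p t d s l) :
    ((lamOfN p t d s l : ℕ) : ℤ) = lamOf p t d s l := Int.toNat_of_nonneg h

lemma lamN_eq_iff {s : Fin t → ℤ} {l} (h : 0 ≤ lamOf p t d s l) :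
    lamOfN p t d s l = m * (p - 1) ↔ lamOf p t d s l = m * ((p:ℤ) - 1) := by
  rw [← cast_N, ← lamN_cast h]; norm_cast

lemma SG_redL_iff {pl : Prop} {F : Pol (GaloisField p t) m} : SG p pl (redL _ p m F) ↔ SG p pl F := by
  unfold SG; rw [tauL_redL, redL_redL]

lemma redL_homog {F : Pol (GaloisField p t) m} {n : ℕ} (h : F.IsHomogeneous n) :
    (redL _ p m F).IsHomogeneous n := by
  intro e he
  rw [coeff_redL] at he
  split_ifs at he with hr
  · exact h he
  · exact absurd rfl he

/-- SBFs give admissible tuples -/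
lemma adm_of_SBF {s : Fin t → ℤ} {e : Finset (Fin t)} (h : memCase p t m d s e)
    (hle : leSd p t m d s e s0 e0) {g : Fin t → Pol (GaloisField p t) m}
    (hg : ∀ j, IsDg p (lamOfN p t d s j) (j ∈ e) (g j)) : Adm p t m d s0 e0 s g := by
  rw [memCase_iff] at h
  rw [leSd_iff] at hle
  refine ⟨fun l => (h.2.1 l).1, fun hd => nz_of_lo hd (fun j => (h.1 j).1), hle.1,
    fun l => (hg l).homog, fun l hl => ?_⟩
  have h1 := (hg l).sg ((lamN_eq_iff (h.2.1 l).1).2 (mem_Zset.1 hl).2.2)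
  have h2 : (l ∈ e) = (l ∈ e0) := propext (hle.2 l hl)
  rwa [h2] at h1

lemma Adm.carry (ht : 1 < t) {s : Fin t → ℤ} {F : Fin t → Pol (GaloisField p t) m}
    (hA : Adm p t m d s0 e0 s F) (j : Fin t) (hj : (p:ℤ) ≤ lamOf p t d s j) (z : Sg m)
    {h : Pol (GaloisField p t) m} (hh : h.IsHomogeneous (lamOfN p t d s j - p)) :
    Adm p t m d s0 e0 (dn s (j+1))
      (Function.update (Function.update F j h) (j + 1) (X z * F (j + 1))) := by
  have hne := add_one_ne ht j
  refine ⟨fun l => ?_, fun _ => ⟨j + 1, ?_⟩, fun l => (dn_le _ _ _).trans (hA.le l), fun l => ?_, fun l hl => ?_⟩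
  · have := hA.nn l
    by_cases c1 : l = j
    · subst c1; rw [lam_dn_j ht]; omega
    by_cases c2 : l = j + 1
    · subst c2; rw [lam_dn_j1 ht]; omega
    · rw [lam_dn_ne _ c1 c2]; exact this
  · have := hA.nn (j+1)
    rw [lam_dn_j1 ht]; omega
  · by_cases c2 : l = j + 1
    · subst c2
      rw [Function.update_self]
      have h1 : lamOfN p t d (dn s (j+1)) (j+1) = 1 + lamOfN p t d s (j+1) := by
        have := hA.nn (j+1)
        unfold lamOfN; rw [lam_dn_j1 ht]; omega
      rw [h1]
      exact (isHomogeneous_X _ z).mul (hA.hom (j+1))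
    rw [Function.update_of_ne c2]
    by_cases c1 : l = j
    · subst c1
      rw [Function.update_self]
      have h1 : lamOfN p t d (dn s (l+1)) l = lamOfN p t d s l - p := by
        unfold lamOfN; rw [lam_dn_j ht]; omega
      rw [h1]; exact hh
    · rw [Function.update_of_ne c1]
      have h1 : lamOfN p t d (dn s (j+1)) l = lamOfN p t d s l := by
        unfold lamOfN; rw [lam_dn_ne _ c1 c2]
      rw [h1]; exact hA.hom l
  · obtain ⟨c1, c2, c3⟩ := Z_dn hA.le hl
    rw [Function.update_of_ne c2, Function.update_of_ne c1]
    exact hA.sgn l c3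

/-- a nonreduced monomial is a `p`-th power times a monomial -/
lemma split_nonred {e : Ex m} (h : ¬ Red p e) : ∃ z e', p ≤ e.degree ∧ e'.degree = e.degree - p ∧
    (monomial e 1 : Pol (GaloisField p t) m) = X z ^ p * monomial e' 1 := by
  obtain ⟨z, hz⟩ := (not_red_iff e hpp.out.pos).1 h
  have h1 : e = Finsupp.single z p + (e - Finsupp.single z p) := by
    ext u; by_cases hu : z = u
    · subst hu; simp; omega
    · simp [Finsupp.single_apply, hu]
  have h2 : e.degree = p + (e - Finsupp.single z p).degree := by
    conv_lhs => rw [h1]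
    rw [map_add, Finsupp.degree_single]
  refine ⟨z, e - Finsupp.single z p, by omega, by omega, ?_⟩
  rw [X_pow_eq_monomial, monomial_mul, ← h1, one_mul]

lemma lamN_sum_dn (ht : 1 < t) {s : Fin t → ℤ} (hn : ∀ l, 0 ≤ lamOf p t d s l) {j : Fin t}
    (hj : (p:ℤ) ≤ lamOf p t d s j) :
    ∑ l, lamOfN p t d (dn s (j+1)) l < ∑ l, lamOfN p t d s l := by
  have hp := hpp.out.two_le
  have hn' : ∀ l, 0 ≤ lamOf p t d (dn s (j+1)) l := by
    intro l
    have := hn l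
    by_cases c1 : l = j
    · subst c1; rw [lam_dn_j ht]; omega
    by_cases c2 : l = j + 1
    · subst c2; rw [lam_dn_j1 ht]; omega
    · rw [lam_dn_ne _ c1 c2]; exact this
  zify
  rw [Finset.sum_congr rfl (fun l _ => lamN_cast (hn l)), Finset.sum_congr rfl (fun l _ => lamN_cast (hn' l)),
    lam_sum, lam_sum, dn_sum]
  have : (2:ℤ) ≤ p := by exact_mod_cast hp
  nlinarith

lemma lemA_step (ht : 1 < t) {s : Fin t → ℤ} {F : Fin t → Pol (GaloisField p t) m}
    (IH : ∀ s' F', Adm p t m d s0 e0 s' F' → ∑ l, lamOfN p t d s' l < ∑ l, lamOfN p t d s l →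
      evT F' ∈ Yn p t m d s0 e0 (∑ l, s' l))
    (hA : Adm p t m d s0 e0 s F) (j : Fin t) (e : Ex m) (he : ¬ Red p e)
    (hed : e.degree = lamOfN p t d s j) (hF : F j = monomial e 1) :
    evT F ∈ Yn p t m d s0 e0 (∑ l, s l - 1) := by
  obtain ⟨z, e', h1, h2, h3⟩ := split_nonred (p := p) (t := t) he
  have h4 : evT F = evT (Function.update F j (X z ^ p * monomial e' 1)) := by
    rw [← h3, ← hF, Function.update_eq_self]
  have hj : (p:ℤ) ≤ lamOf p t d s j := by
    rw [← lamN_cast (hA.nn j), ← hed]; exact_mod_cast h1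
  rw [h4, carry ht, ← dn_sum s (j+1)]
  refine IH _ _ (hA.carry ht j hj z (isHomogeneous_monomial _ (by rw [h2, hed]))) ?_
  exact lamN_sum_dn ht hA.nn hj

lemma Adm.update {s : Fin t → ℤ} {F : Fin t → Pol (GaloisField p t) m}
    (hA : Adm p t m d s0 e0 s F) (j : Fin t) {g : Pol (GaloisField p t) m}
    (hg : g.IsHomogeneous (lamOfN p t d s j)) (hs : j ∈ Zset p t m d s s0 → SG p (j ∈ e0) g) :
    Adm p t m d s0 e0 s (Function.update F j g) := by
  refine ⟨hA.nn, hA.nz, hA.le, fun l => ?_, fun l hl => ?_⟩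
  · by_cases c : l = j
    · subst c; rwa [Function.update_self]
    · rw [Function.update_of_ne c]; exact hA.hom l
  · by_cases c : l = j
    · subst c; rw [Function.update_self]; exact hs hl
    · rw [Function.update_of_ne c]; exact hA.sgn l hl

lemma lemA (hodd : Odd p) (ht : 1 < t) (hd : d ≤ p ^ t - 2) (h0 : memCase p t m d s0 e0) :
    ∀ (B : ℕ) (s : Fin t → ℤ) (F : Fin t → Pol (GaloisField p t) m), Adm p t m d s0 e0 s F →
      ∑ l, lamOfN p t d s l = B → evT F ∈ Yn p t m d s0 e0 (∑ l, s l) := by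
  intro B
  induction B using Nat.strong_induction_on with
  | _ B ih =>
    intro s F hA hB
    have IH : ∀ s' F', Adm p t m d s0 e0 s' F' → ∑ l, lamOfN p t d s' l < ∑ l, lamOfN p t d s l →
      evT F' ∈ Yn p t m d s0 e0 (∑ l, s' l) := fun s' F' h1 h2 => ih _ (hB ▸ h2) s' F' h1 rfl
    let R : Fin t → Prop → Prop := fun l pl => l ∈ Zset p t m d s s0 → (pl ↔ l ∈ e0)
    let G : Fin t → Set (Pol (GaloisField p t) m) := fun l =>
      {g | ∃ pl, R l pl ∧ IsDg p (lamOfN p t d s l) pl g} ∪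
      {g | ∃ e : Ex m, ¬ Red p e ∧ e.degree = lamOfN p t d s l ∧ g = monomial e 1}
    -- split nonreduced parts off first, one slot at a time
    have key : ∀ T : Finset (Fin t), ∀ F, Adm p t m d s0 e0 s F →
        (∀ l ∉ T, ∃ pl, R l pl ∧ IsDg p (lamOfN p t d s l) pl (F l)) →
        evT F ∈ Yn p t m d s0 e0 (∑ l, s l) := by
      intro T
      induction T using Finset.induction_on with
      | empty =>
        intro F hF hG
        choose pl hR hdg using fun l => hG l (by simp)
        refine Submodule.subset_span ⟨s, Finset.univ.filter pl, ?_, ?_, le_rfl, ?_⟩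
        · rw [memCase_iff] at h0 ⊢
          refine ⟨fun j => ⟨lo_of ht hd hF.nn hF.nz j, (hF.le j).trans (h0.1 j).2⟩,
            fun j => ⟨hF.nn j, ?_⟩, fun l hl => ?_⟩
          · have := (hdg j).le
            rw [← lamN_cast (hF.nn j), mul_assoc, ← cast_N]; exact_mod_cast this
          · rw [mem_Jset, ← lamN_eq_iff (hF.nn l)]
            exact (hdg l).pl_imp (Finset.mem_filter.1 hl).2
        · rw [leSd_iff]
          refine ⟨hF.le, fun l hl => ?_⟩
          simp only [Finset.mem_filter, Finset.mem_univ, true_and]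
          exact hR l hl
        · rw [isSBF_iff]
          refine ⟨F, fun j => ?_, rfl⟩
          simpa using hdg j
      | insert a T ha ih2 =>
        intro F hF hG
        have h3 : Submodule.span (GaloisField p t) (G a) ≤ Uslot (Yn p t m d s0 e0 (∑ l, s l)) F a := by
          rw [Submodule.span_le]
          rintro g (⟨pl, hR, hdg⟩ | ⟨e, he, hed, rfl⟩)
          · refine ih2 _ (hF.update a hdg.homog (fun hz => ?_)) ?_
            · have h1 := hdg.sg ((lamN_eq_iff (hF.nn a)).2 (mem_Zset.1 hz).2.2)
              have : pl = (a ∈ e0) := propext (hR hz)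
              rwa [this] at h1
            · intro l hl
              by_cases hla : l = a
              · subst hla; rw [Function.update_self]; exact ⟨pl, hR, hdg⟩
              · rw [Function.update_of_ne hla]; exact hG l (by simp [hla, hl])
          · refine Yn_mono (by omega : ∑ l, s l - 1 ≤ ∑ l, s l) ?_
            by_cases hz : a ∈ Zset p t m d s s0
            swap
            · exact lemA_step ht IH (hF.update a (isHomogeneous_monomial _ hed) (fun h => absurd h hz)) a e he hed
                (by rw [Function.update_self])
            · refine lemA_step ht IH (hF.update a (isHomogeneous_monomial _ hed) (fun _ => ?_)) a e he hed
                (by rw [Function.update_self])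
              unfold SG
              rw [tauL_monomial, redL_monomial, if_neg he, if_neg he, smul_zero]
        have h4 : F a ∈ Submodule.span (GaloisField p t) (G a) := by
          refine digit_span hodd (hF.hom a) (R a) ?_
          by_cases hz : a ∈ Zset p t m d s s0
          · right
            exact ⟨a ∈ e0, fun _ => Iff.rfl, (lamN_eq_iff (hF.nn a)).2 (mem_Zset.1 hz).2.2, hF.sgn a hz⟩
          · left; intro pl h; exact absurd h hz
        have h5 := h3 h4
        rwa [mem_Uslot, Function.update_eq_self] at h5
    exact key Finset.univ F hA (fun l hl => absurd (Finset.mem_univ l) hl)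

lemma Adm.mem (hodd : Odd p) (ht : 1 < t) (hd : d ≤ p ^ t - 2) (h0 : memCase p t m d s0 e0)
    {s : Fin t → ℤ} {F : Fin t → Pol (GaloisField p t) m} (hA : Adm p t m d s0 e0 s F) :
    evT F ∈ Yn p t m d s0 e0 (∑ l, s l) := lemA hodd ht hd h0 _ s F hA rfl

/-- A2 -/
lemma Adm.mem_lower (hodd : Odd p) (ht : 1 < t) (hd : d ≤ p ^ t - 2) (h0 : memCase p t m d s0 e0)
    {s : Fin t → ℤ} {F : Fin t → Pol (GaloisField p t) m} (hA : Adm p t m d s0 e0 s F) (j : Fin t)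
    (hj : redL _ p m (F j) = 0) :
    evT F ∈ Yn p t m d s0 e0 (∑ l, s l - 1) := by
  have h1 : F j ∈ Uslot (Yn p t m d s0 e0 (∑ l, s l - 1)) F j := by
    have : F j = (LinearMap.id - redL (GaloisField p t) p m : Pol (GaloisField p t) m →ₗ[GaloisField p t] _) (F j) := by simp [hj]
    rw [this]
    refine map_mem_of_homog _ _ (hA.hom j) (fun e he => ?_)
    rw [LinearMap.sub_apply, redL_monomial, LinearMap.id_apply]
    split_ifs with hr
    · rw [sub_self]; exact Submodule.zero_mem _
    · rw [sub_zero, mem_Uslot]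
      refine lemA_step ht (fun s' F' h1 _ => h1.mem hodd ht hd h0)
        (hA.update j (isHomogeneous_monomial _ he) (fun _ => ?_)) j e hr he (by rw [Function.update_self])
      unfold SG
      rw [tauL_monomial, redL_monomial, if_neg hr, if_neg hr, smul_zero]
  rwa [mem_Uslot, Function.update_eq_self] at h1

lemma SG_sub_redL {pl : Prop} (F : Pol (GaloisField p t) m) : SG p pl (F - redL _ p m F) := by
  unfold SG; rw [map_sub, map_sub, tauL_redL, redL_redL]; simp

/-- replacing slots by their reductions -/
lemma Adm.redL_mem (hodd : Odd p) (ht : 1 < t) (hd : d ≤ p ^ t - 2) (h0 : memCase p t m d s0 e0)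
    {s : Fin t → ℤ} {F : Fin t → Pol (GaloisField p t) m} (hA : Adm p t m d s0 e0 s F) :
    evT F - evT (fun l => redL _ p m (F l)) ∈ Yn p t m d s0 e0 (∑ l, s l - 1) := by
  have key : ∀ T : Finset (Fin t),
      evT F - evT (fun l => if l ∈ T then redL _ p m (F l) else F l) ∈ Yn p t m d s0 e0 (∑ l, s l - 1) := by
    intro T
    induction T using Finset.induction_on with
    | empty => simp
    | insert a T ha ih =>
      have hA' : Adm p t m d s0 e0 s (fun l => if l ∈ T then redL _ p m (F l) else F l) := by
        refine ⟨hA.nn, hA.nz, hA.le, fun l => ?_, fun l hl => ?_⟩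
        · split_ifs
          · exact redL_homog (hA.hom l)
          · exact hA.hom l
        · split_ifs
          · rw [SG_redL_iff]; exact hA.sgn l hl
          · exact hA.sgn l hl
      have h1 := (hA'.update a (g := F a - redL _ p m (F a))
        ((hA.hom a).sub (redL_homog (hA.hom a))) (fun _ => SG_sub_redL _)).mem_lower hodd ht hd h0 a
        (by rw [Function.update_self, map_sub, redL_redL, sub_self])
      have h2 : (fun l => if l ∈ T then redL _ p m (F l) else F l)
          = Function.update (fun l => if l ∈ T then redL _ p m (F l) else F l) a
            ((F a - redL _ p m (F a)) + redL _ p m (F a)) := by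
        funext l
        by_cases c : l = a
        · subst c; simp [ha]
        · rw [Function.update_of_ne c]
      have h3 : (fun l => if l ∈ insert a T then redL _ p m (F l) else F l)
          = Function.update (fun l => if l ∈ T then redL _ p m (F l) else F l) a (redL _ p m (F a)) := by
        funext l
        by_cases c : l = a
        · subst c; simp [ha]
        · rw [Function.update_of_ne c]; simp [c]
      have h4 := Submodule.add_mem _ ih h1
      rw [h3]
      have h5 := (congrArg evT h2).trans (evT_update_add _ _ _ _)
      convert h4 using 1
      generalize evT (Function.update (fun l => if l ∈ T then redL _ p m (F l) else F l) a
            (F a - redL _ p m (F a))) = A at h5 ⊢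
      rw [h5]
      abel
  have := key Finset.univ
  simpa using this

/-- the symplectic action on tuples -/
lemma bas_sum (v : SympV p t m) : v = ∑ z : Sg m, cv v z •
    (Sum.elim (fun i => (Pi.single i 1, 0)) (fun i => (0, Pi.single i 1)) z : SympV p t m) := by
  rw [Fintype.sum_sum_type]
  ext i
  · simp [cv, Prod.fst_sum, Finset.sum_apply, Pi.single_apply]
  · simp [cv, Prod.snd_sum, Finset.sum_apply, Pi.single_apply]

def bas (z : Sg m) : SympV p t m :=
  Sum.elim (fun i => (Pi.single i 1, 0)) (fun i => (0, Pi.single i 1)) z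

def matOf (h : SympV p t m →ₗ[GaloisField p t] SympV p t m) : Matrix (Sg m) (Sg m) (GaloisField p t) :=
  fun z w => cv (h (bas w)) z

lemma cv_add (v w : SympV p t m) : cv (v + w) = cv v + cv w := by
  funext z; cases z <;> rfl
lemma cv_smul (c : GaloisField p t) (v : SympV p t m) : cv (c • v) = c • cv v := by
  funext z; cases z <;> rfl
lemma cv_sum {ι : Type*} (S : Finset ι) (f : ι → SympV p t m) : cv (∑ i ∈ S, f i) = ∑ i ∈ S, cv (f i) := by
  induction S using Finset.induction_on with
  | empty => funext z; cases z <;> rfl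
  | insert a S ha ih => rw [Finset.sum_insert ha, Finset.sum_insert ha, cv_add, ih]

lemma matOf_mulVec (h : SympV p t m →ₗ[GaloisField p t] SympV p t m) (v : SympV p t m) :
    (matOf h).mulVec (cv v) = cv (h v) := by
  conv_rhs => rw [bas_sum v, map_sum, cv_sum]
  funext z
  simp only [map_smul, cv_smul, Finset.sum_apply, Pi.smul_apply, smul_eq_mul, Matrix.mulVec, dotProduct, matOf]
  apply Finset.sum_congr rfl; intro w _; rw [mul_comm]; rfl

lemma sform_eq (v w : SympV p t m) : sform v w = ∑ z, sgn (GaloisField p t) z * cv v z * cv w z.swap := by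
  unfold sform
  rw [Fintype.sum_sum_type, ← Finset.sum_add_distrib]
  apply Finset.sum_congr rfl; intro i _
  simp [sgn, cv]; ring

lemma cv_bas (w z : Sg m) : cv (bas w : SympV p t m) z = if z = w then 1 else 0 := by
  cases z <;> cases w <;> simp [cv, bas, Pi.single_apply]

lemma matOf_symp {h : SympV p t m →ₗ[GaloisField p t] SympV p t m}
    (hs : ∀ v w, sform (h v) (h w) = sform v w) : matOf h ∈ Matrix.symplecticGroup (Fin m) (GaloisField p t) := by
  rw [SymplecticGroup.mem_iff']
  ext z w
  have h1 := hs (bas z) (bas w)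
  rw [sform_eq, sform_eq] at h1
  rw [Matrix.mul_apply, J_apply]
  have h2 : ∀ u, ((matOf h).transpose * Matrix.J (Fin m) (GaloisField p t)) z u
      = sgn _ u * cv (h (bas z)) u.swap := by
    intro u
    rw [Matrix.mul_apply, Finset.sum_eq_single u.swap]
    · rw [J_apply, Sum.swap_swap, if_pos rfl, sgn_swap, neg_neg]
      simp [Matrix.transpose_apply, matOf]; ring
    · intro b _ hb
      rw [J_apply, if_neg, mul_zero]
      rintro rfl; simp at hb
    · simp
  simp only [h2]
  have h3 : ∑ u, sgn (GaloisField p t) u * cv (h (bas z)) u.swap * matOf h u w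
      = - ∑ u, sgn (GaloisField p t) u * cv (h (bas z)) u * cv (h (bas w)) u.swap := by
    rw [← Finset.sum_neg_distrib]
    apply Fintype.sum_equiv (Equiv.sumComm (Fin m) (Fin m))
    intro u
    simp only [Equiv.sumComm_apply, Sum.swap_swap, sgn_swap, matOf]; ring
  rw [h3, h1]
  simp only [cv_bas]
  rw [Finset.sum_eq_single z]
  · simp only [if_true, mul_one]
    by_cases c : w = z.swap
    · rw [if_pos c.symm, if_pos c, mul_one]
    · rw [if_neg (Ne.symm c), if_neg c]; simp
  · intro b _ hb; rw [if_neg hb]; simp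
  · simp

lemma evT_comp (h : SympV p t m →ₗ[GaloisField p t] SympV p t m) (F : Fin t → Pol (GaloisField p t) m) :
    (fun v => evT F (h v)) = evT (fun l => phi (matOf h) (F l)) := by
  funext v
  simp only [evT, eval_phi, matOf_mulVec]

lemma Adm.phi {s : Fin t → ℤ} {F : Fin t → Pol (GaloisField p t) m} (hA : Adm p t m d s0 e0 s F)
    {h : SympV p t m →ₗ[GaloisField p t] SympV p t m}
    (hs : ∀ v w, sform (h v) (h w) = sform v w) :
    Adm p t m d s0 e0 s (fun l => _root_.phi (matOf h) (F l)) := by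
  refine ⟨hA.nn, hA.nz, hA.le, fun l => phi_homog _ (hA.hom l), fun l hl => ?_⟩
  have h1 := hA.sgn l hl
  have h2 := spMat_of_mem _ (matOf_symp hs)
  unfold SG at *
  rw [tauL_phi _ h2, h1, map_smul, map_smul, redL_phi_redL]

lemma Yn_comp (hodd : Odd p) (ht : 1 < t) (hd : d ≤ p ^ t - 2) (h0 : memCase p t m d s0 e0) (n : ℤ)
    {h : SympV p t m →ₗ[GaloisField p t] SympV p t m}
    (hs : ∀ v w, sform (h v) (h w) = sform v w) {f} (hf : f ∈ Yn p t m d s0 e0 n) :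
    (fun v => f (h v)) ∈ Yn p t m d s0 e0 n := by
  have h1 : Yn p t m d s0 e0 n ≤ (Yn p t m d s0 e0 n).comap
      (LinearMap.funLeft (GaloisField p t) (GaloisField p t) (h : SympV p t m → SympV p t m)) := by
    conv_lhs => unfold Yn
    rw [Submodule.span_le]
    rintro f ⟨s', e', h1, h2, h3, h4⟩
    obtain ⟨g, hg, rfl⟩ := (isSBF_iff _ _ _).1 h4
    have := ((adm_of_SBF h1 h2 hg).phi hs).mem hodd ht hd h0
    rw [← evT_comp] at this
    exact Yn_mono h3 this
  exact h1 hf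

lemma Yn_stable (hodd : Odd p) (ht : 1 < t) (hd : d ≤ p ^ t - 2) (h0 : memCase p t m d s0 e0) (n : ℤ) :
    SpStable (Yn p t m d s0 e0 n) := by
  intro g hg f hf
  refine Yn_comp hodd ht hd h0 n (h := g.symm.toLinearMap) ?_ hf
  intro v w
  have := hg (g.symm v) (g.symm w)
  simpa using this.symm

end P7
end


noncomputable section
set_option linter.unusedSectionVars false
set_option linter.unusedSimpArgs false

section P8a
open MvPolynomial
variable {K : Type} [Field K] {p m : ℕ} [hpp : Fact p.Prime] [hch : CharP K p]

/-- Taylor expansion in direction `b` -/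
def Tay (b : Sg m → K) : Pol K m →ₐ[K] Polynomial (Pol K m) :=
  MvPolynomial.aeval (fun w => Polynomial.C (X w) + Polynomial.C (C (b w)) * Polynomial.X)

/-- directional derivative -/
def Dir (b : Sg m → K) : Pol K m →ₗ[K] Pol K m :=
  ∑ w, b w • (pderiv w : Derivation K (Pol K m) (Pol K m)).toLinearMap

lemma Dir_apply (b : Sg m → K) (f : Pol K m) : Dir b f = ∑ w, b w • pderiv w f := by
  simp [Dir, LinearMap.sum_apply]

lemma Dir_mul_X (b : Sg m → K) (f : Pol K m) (z : Sg m) : Dir b (f * X z) = Dir b f * X z + f * C (b z) := by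
  simp only [Dir_apply, Derivation.leibniz, smul_eq_mul, pderiv_X, smul_add, Finset.sum_add_distrib,
    smul_eq_C_mul, Pi.single_apply, mul_ite, mul_one, mul_zero, Finset.sum_mul]
  rw [add_comm]
  congr 1
  · apply Finset.sum_congr rfl; intro w _; ring
  · simp [Finset.sum_ite_eq, mul_comm]

lemma Tay_C (b : Sg m → K) (c : K) : Tay b (C c) = Polynomial.C (C c) := by
  unfold Tay; rw [aeval_C]; rfl

lemma Tay_X (b : Sg m → K) (z : Sg m) :
    Tay b (X z) = Polynomial.C (X z) + Polynomial.C (C (b z)) * Polynomial.X := by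
  unfold Tay; rw [aeval_X]

lemma Tay_coeff0 (b : Sg m → K) (f : Pol K m) : (Tay b f).coeff 0 = f := by
  induction f using MvPolynomial.induction_on with
  | C c => rw [Tay_C]; simp
  | add f g hf hg => rw [map_add, Polynomial.coeff_add, hf, hg]
  | mul_X f z hf =>
    rw [map_mul, Polynomial.mul_coeff_zero, hf, Tay_X]; simp

lemma Tay_coeff1 (b : Sg m → K) (f : Pol K m) : (Tay b f).coeff 1 = Dir b f := by
  induction f using MvPolynomial.induction_on with
  | C c => rw [Tay_C, Dir_apply]; simp [Polynomial.coeff_C]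
  | add f g hf hg => rw [map_add, Polynomial.coeff_add, hf, hg, map_add]
  | mul_X f z hf =>
    rw [map_mul, Tay_X, Dir_mul_X, mul_add, Polynomial.coeff_add, Polynomial.coeff_mul_C, hf,
      ← mul_assoc, Polynomial.coeff_mul_X, Polynomial.coeff_mul_C, Tay_coeff0]

lemma Tay_eval (b a : Sg m → K) (x : K) (f : Pol K m) :
    eval (a + x • b) f = Polynomial.eval x ((Tay b f).map (eval a)) := by
  induction f using MvPolynomial.induction_on with
  | C c => rw [Tay_C]; simp
  | add f g hf hg => rw [map_add, map_add, Polynomial.map_add, Polynomial.eval_add, hf, hg]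
  | mul_X f z hf =>
    rw [map_mul, map_mul, Polynomial.map_mul, Polynomial.eval_mul, hf, Tay_X]
    simp; left; ring

lemma Tay_phi (b : Sg m → K) (A : Matrix (Sg m) (Sg m) K) (L : Pol K m)
    (hA : ∀ z, lform K (A z) = X z + C (b z) * L) (f : Pol K m) :
    phi A f = Polynomial.eval L (Tay b f) := by
  induction f using MvPolynomial.induction_on with
  | C c => rw [Tay_C]; simp [phi]
  | add f g hf hg => rw [map_add, map_add, Polynomial.eval_add, hf, hg]
  | mul_X f z hf =>
    rw [map_mul, map_mul, Polynomial.eval_mul, hf, Tay_X, phi_X, hA]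
    simp

lemma Tay_red (b : Sg m → K) (A : Matrix (Sg m) (Sg m) K) (l : Sg m → K) (c : K)
    (hA : ∀ z, lform K (A z) = X z + C (b z) * (C c * lform K l)) (f : Pol K m) :
    redL K p m (phi A f) = ∑ n ∈ Finset.range p, c ^ n • redL K p m (lform K l ^ n * (Tay b f).coeff n) := by
  rw [Tay_phi b A _ hA, Polynomial.eval_eq_sum_range' (n := (Tay b f).natDegree + 1 + p) (by omega), map_sum]
  have h1 : ∀ n, redL K p m ((Tay b f).coeff n * (C c * lform K l) ^ n)
      = c ^ n • redL K p m (lform K l ^ n * (Tay b f).coeff n) := by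
    intro n
    rw [← map_smul, smul_eq_C_mul, mul_pow, ← C_pow]
    congr 1; ring
  simp only [h1]
  symm
  apply Finset.sum_subset
  · intro n hn; simp only [Finset.mem_range] at *; omega
  · intro n _ hn
    simp only [Finset.mem_range, not_lt] at hn
    obtain ⟨r, rfl⟩ := Nat.exists_eq_add_of_le hn
    rw [pow_add (lform K l), mul_assoc, redL_lform_pow_mul, smul_zero]

lemma Tay_deg (z : Sg m) (f : Pol K m) (hf : redL K p m f = f) :
    (Tay (Pi.single z 1) f).natDegree < p := by
  have hp := hpp.out.pos
  have h : (Tay (Pi.single z 1) f).natDegree ≤ p - 1 := by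
    rw [redL_eq_self_iff] at hf
    conv_lhs => rw [f.as_sum, map_sum]
    apply Polynomial.natDegree_sum_le_of_forall_le
    intro e he
    have hr := hf e he
    unfold Tay
    rw [aeval_monomial]
    refine Polynomial.natDegree_mul_le.trans ?_
    have h0 : (algebraMap K (Polynomial (Pol K m)) (coeff e f)).natDegree = 0 :=
      Polynomial.natDegree_C (C (coeff e f))
    rw [h0, zero_add, Finsupp.prod_fintype _ _ (by simp)]
    refine (Polynomial.natDegree_prod_le _ _).trans ?_
    have h1 : ∀ w ∈ Finset.univ, ((Polynomial.C (X w) + Polynomial.C (C ((Pi.single z 1 : Sg m → K) w)) * Polynomial.X : Polynomial (Pol K m)) ^ e w).natDegree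
        ≤ if w = z then p - 1 else 0 := by
      intro w _
      refine Polynomial.natDegree_pow_le.trans ?_
      by_cases c : w = z
      · subst c
        rw [if_pos rfl]
        have : (Polynomial.C (X w) + Polynomial.C (C ((Pi.single w 1 : Sg m → K) w)) * Polynomial.X : Polynomial (Pol K m)).natDegree ≤ 1 := by
          rw [add_comm]; exact Polynomial.natDegree_linear_le
        calc _ ≤ e w * 1 := Nat.mul_le_mul_left _ this
          _ ≤ _ := by rw [mul_one]; exact hr w
      · simp [c]
    refine (Finset.sum_le_sum h1).trans ?_
    simp
  omega

lemma eval_Tay_sum (b a : Sg m → K) (x : K) (f : Pol K m) (h : (Tay b f).natDegree < p) :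
    eval (a + x • b) f = ∑ n ∈ Finset.range p, x ^ n * eval a ((Tay b f).coeff n) := by
  rw [Tay_eval, Polynomial.eval_eq_sum_range' (n := p) (lt_of_le_of_lt Polynomial.natDegree_map_le h)]
  apply Finset.sum_congr rfl; intro n _
  rw [Polynomial.coeff_map, mul_comm]

lemma Dir_single (z : Sg m) (f : Pol K m) : Dir (Pi.single z 1) f = pderiv z f := by
  rw [Dir_apply, Finset.sum_eq_single z]
  · simp
  · intro w _ hw; simp [hw]
  · simp

lemma pderiv_eq_dd (z : Sg m) (f : Pol K m) : pderiv z f = sgn K z.swap • dd K z.swap f := by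
  simp only [dd, LinearMap.smul_apply, Derivation.coeFn_coe, Sum.swap_swap, smul_smul, sgn_sq, one_smul]

lemma Dir_add (b b' : Sg m → K) (f : Pol K m) : Dir (b + b') f = Dir b f + Dir b' f := by
  simp [Dir_apply, add_smul, Finset.sum_add_distrib]
lemma Dir_sub (b b' : Sg m → K) (f : Pol K m) : Dir (b - b') f = Dir b f - Dir b' f := by
  simp [Dir_apply, sub_smul, Finset.sum_sub_distrib]

/-- the linear form attached to a vector -/
def lu (b : Sg m → K) : Pol K m := lform K (fun w => sgn K w * b w.swap)

lemma lu_add (b b' : Sg m → K) : lu (b + b') = lu b + lu b' := by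
  simp [lu, lform, mul_add, add_mul, Finset.sum_add_distrib]
lemma lu_sub (b b' : Sg m → K) : lu (b - b') = lu b - lu b' := by
  simp [lu, lform, mul_sub, sub_mul, Finset.sum_sub_distrib]
lemma lu_single (z : Sg m) : lu (Pi.single z 1 : Sg m → K) = C (sgn K z.swap) * X z.swap := by
  unfold lu lform
  rw [Finset.sum_eq_single z.swap]
  · simp
  · intro w _ hw
    have : w.swap ≠ z := by rintro rfl; simp at hw
    simp [this]
  · simp
end P8a

section P8b
open MvPolynomial
variable {p t m : ℕ} [hpp : Fact p.Prime] [hnz : NeZero t]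

lemma KX (ht : 1 < t) (j : Fin t) (G : Fin t → ℕ → GaloisField p t) :
    - ∑ c : (GaloisField p t)ˣ, ((c⁻¹ : (GaloisField p t)ˣ) : GaloisField p t) ^ (p ^ (j:ℕ)) *
      ∏ l : Fin t, (∑ n ∈ Finset.range p, (c : GaloisField p t) ^ n * G l n) ^ (p ^ (l:ℕ))
    = G j 1 ^ (p ^ (j:ℕ)) * ∏ l ∈ Finset.univ.erase j, G l 0 ^ (p ^ (l:ℕ)) := by
  have hp := hpp.out.two_le
  have : NeZero p := ⟨by omega⟩
  have : ExpChar (GaloisField p t) p := ExpChar.prime hpp.out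
  have hq : p ^ (j:ℕ) + 1 < p ^ t := by
    have h1 : p ^ (j:ℕ) ≤ p ^ (t-1) := Nat.pow_le_pow_right (by omega) (by omega)
    have h2 : p ^ t = p * p ^ (t-1) := by rw [← pow_succ']; congr 1; omega
    have h3 : 2 ≤ p ^ (t-1) := le_trans hp (Nat.le_self_pow (by omega) p)
    nlinarith
  have e1 : ∀ c : (GaloisField p t)ˣ, ∏ l : Fin t, (∑ n ∈ Finset.range p, (c : GaloisField p t) ^ n * G l n) ^ (p ^ (l:ℕ))
      = ∑ ν : Fin t → Fin p, (c : GaloisField p t) ^ ((finFunctionFinEquiv ν : Fin (p^t)) : ℕ) * ∏ l, G l (ν l) ^ (p ^ (l:ℕ)) := by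
    intro c
    have : ∀ l : Fin t, (∑ n ∈ Finset.range p, (c : GaloisField p t) ^ n * G l n) ^ (p ^ (l:ℕ))
      = ∑ n : Fin p, ((c : GaloisField p t) ^ ((n:ℕ) * p ^ (l:ℕ)) * G l n ^ (p ^ (l:ℕ))) := by
      intro l
      rw [Finset.sum_range, sum_pow_char_pow]
      apply Finset.sum_congr rfl; intro n _
      rw [mul_pow, pow_mul]
    simp only [this]
    rw [Finset.prod_univ_sum, Fintype.piFinset_univ]
    apply Finset.sum_congr rfl; intro ν _
    rw [Finset.prod_mul_distrib, Finset.prod_pow_eq_pow_sum, finFunctionFinEquiv_apply]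
  have e2 : ∀ N : ℕ, N < p ^ t → ∑ c : (GaloisField p t)ˣ, ((c⁻¹ : (GaloisField p t)ˣ) : GaloisField p t) ^ (p ^ (j:ℕ)) *
      (c : GaloisField p t) ^ N = if N = p ^ (j:ℕ) then -1 else 0 := by
    intro N hN
    have h1 : ∀ c : (GaloisField p t)ˣ, ((c⁻¹ : (GaloisField p t)ˣ) : GaloisField p t) ^ (p ^ (j:ℕ)) *
      (c : GaloisField p t) ^ N = (c : GaloisField p t) ^ (N + (p ^ t - 1 - p ^ (j:ℕ))) := by
      intro c
      have hc : (c : GaloisField p t) ^ (p ^ t - 1) = 1 := by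
        have := FiniteField.pow_card_sub_one_eq_one (c : GaloisField p t) c.ne_zero
        rwa [card_GF] at this
      have h3 : (c : GaloisField p t) ^ (N + (p ^ t - 1 - p ^ (j:ℕ))) * (c : GaloisField p t) ^ (p ^ (j:ℕ))
          = (c : GaloisField p t) ^ N := by
        rw [← pow_add, show N + (p ^ t - 1 - p ^ (j:ℕ)) + p ^ (j:ℕ) = N + (p ^ t - 1) by omega, pow_add, hc, mul_one]
      rw [← h3, mul_comm _ (_ ^ p ^ (j:ℕ)), ← mul_assoc, ← mul_pow, Units.inv_mul, one_pow, one_mul]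
    simp only [h1]
    rw [FiniteField.sum_pow_units, card_GF]
    congr 1
    rw [eq_iff_iff]
    constructor
    · rintro ⟨k, hk⟩
      have hk1 : k = 1 := by
        have hpj : 0 < p ^ (j:ℕ) := by positivity
        have a1 : 0 < (p ^ t - 1) * k := by omega
        have a2 : (p ^ t - 1) * k < (p ^ t - 1) * 2 := by omega
        have := Nat.lt_of_mul_lt_mul_left a2
        have := Nat.pos_of_mul_pos_left a1
        omega
      subst hk1; omega
    · rintro rfl
      exact ⟨1, by omega⟩
  simp only [e1, Finset.mul_sum]
  rw [Finset.sum_comm]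
  have e3 : ∀ ν : Fin t → Fin p, ∑ c : (GaloisField p t)ˣ, ((c⁻¹ : (GaloisField p t)ˣ) : GaloisField p t) ^ (p ^ (j:ℕ)) *
      ((c : GaloisField p t) ^ ((finFunctionFinEquiv ν : Fin (p^t)) : ℕ) * ∏ l, G l (ν l) ^ (p ^ (l:ℕ)))
      = if ν = Pi.single j ⟨1, by omega⟩ then - ∏ l, G l (ν l) ^ (p ^ (l:ℕ)) else 0 := by
    intro ν
    simp only [← mul_assoc]
    rw [← Finset.sum_mul, e2 _ (Fin.is_lt _)]
    have h1 : ((finFunctionFinEquiv ν : Fin (p^t)) : ℕ) = p ^ (j:ℕ) ↔ ν = Pi.single j ⟨1, by omega⟩ := by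
      have h2 := finFunctionFinEquiv_single (m := p) j ⟨1, by omega⟩
      rw [show (((⟨1, by omega⟩ : Fin p)) : ℕ) = 1 from rfl, one_mul] at h2
      rw [← h2, Fin.val_inj, EmbeddingLike.apply_eq_iff_eq]
    by_cases c : ν = Pi.single j ⟨1, by omega⟩
    · rw [if_pos (h1.2 c), if_pos c]; ring
    · rw [if_neg (fun h => c (h1.1 h)), if_neg c, zero_mul]
  simp only [e3]
  rw [Finset.sum_ite_eq' , if_pos (Finset.mem_univ _), neg_neg, ← Finset.mul_prod_erase _ _ (Finset.mem_univ j)]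
  congr 1
  · simp
  · apply Finset.prod_congr rfl; intro l hl
    rw [Pi.single_eq_of_ne (Finset.ne_of_mem_erase hl)]; simp

/-- symplectic transvections -/
lemma sform_add_left (v v' w : SympV p t m) : sform (v + v') w = sform v w + sform v' w := by
  unfold sform; rw [← Finset.sum_add_distrib]; apply Finset.sum_congr rfl; intro i _
  simp; ring
lemma sform_smul_left (c : GaloisField p t) (v w : SympV p t m) : sform (c • v) w = c * sform v w := by
  unfold sform; rw [Finset.mul_sum]; apply Finset.sum_congr rfl; intro i _
  simp; ring
lemma sform_symm (v w : SympV p t m) : sform v w = - sform w v := by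
  unfold sform; rw [← Finset.sum_neg_distrib]; apply Finset.sum_congr rfl; intro i _
  ring
lemma sform_self (v : SympV p t m) : sform v v = 0 := by
  unfold sform; apply Finset.sum_eq_zero; intro i _; ring
lemma sform_add_right (v v' w : SympV p t m) : sform w (v + v') = sform w v + sform w v' := by
  rw [sform_symm, sform_add_left, sform_symm v, sform_symm v']; ring
lemma sform_smul_right (c : GaloisField p t) (v w : SympV p t m) : sform w (c • v) = c * sform w v := by
  rw [sform_symm, sform_smul_left, sform_symm v]; ring

def Tv (u : SympV p t m) (c : GaloisField p t) : SympV p t m ≃ₗ[GaloisField p t] SympV p t m where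
  toFun v := v + (c * sform v u) • u
  invFun v := v + (-c * sform v u) • u
  map_add' v w := by rw [sform_add_left, mul_add, add_smul]; abel
  map_smul' a v := by
    rw [sform_smul_left, RingHom.id_apply, smul_add, smul_smul]; congr 2; ring
  left_inv v := by
    dsimp only
    rw [sform_add_left, sform_smul_left, sform_self, mul_zero, add_zero, add_assoc, ← add_smul]
    simp
  right_inv v := by
    dsimp only
    rw [sform_add_left, sform_smul_left, sform_self, mul_zero, add_zero, add_assoc, ← add_smul]
    simp

lemma Tv_apply (u : SympV p t m) (c : GaloisField p t) (v) : Tv u c v = v + (c * sform v u) • u := rfl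
lemma Tv_symm_apply (u : SympV p t m) (c : GaloisField p t) (v) : (Tv u c).symm v = v + (-c * sform v u) • u := rfl

lemma Tv_symp (u : SympV p t m) (c : GaloisField p t) : IsSymp (Tv u c) := by
  intro v w
  rw [Tv_apply, Tv_apply, sform_add_left, sform_add_right, sform_add_right, sform_smul_left, sform_smul_right,
    sform_smul_left, sform_smul_right, sform_self, sform_symm u w]
  ring

def Eop (u : SympV p t m) (j : Fin t) :
    (SympV p t m → GaloisField p t) →ₗ[GaloisField p t] (SympV p t m → GaloisField p t) :=
  - ∑ c : (GaloisField p t)ˣ, ((c⁻¹ : (GaloisField p t)ˣ) : GaloisField p t) ^ (p ^ (j:ℕ)) •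
    LinearMap.funLeft (GaloisField p t) (GaloisField p t) (Tv u c : SympV p t m → SympV p t m)

lemma Eop_apply (u : SympV p t m) (j : Fin t) (f) : Eop u j f =
   - ∑ c : (GaloisField p t)ˣ, ((c⁻¹ : (GaloisField p t)ˣ) : GaloisField p t) ^ (p ^ (j:ℕ)) •
     (fun v => f (Tv u c v)) := by
  unfold Eop
  rw [LinearMap.neg_apply, LinearMap.sum_apply]; rfl

lemma Eop_stab {M : Submodule (GaloisField p t) (SympV p t m → GaloisField p t)} (hM : SpStable M)
    (u : SympV p t m) (j : Fin t) {f} (hf : f ∈ M) : Eop u j f ∈ M := by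
  rw [Eop_apply]
  refine M.neg_mem (M.sum_mem (fun c _ => M.smul_mem _ ?_))
  have := hM (Tv u (-c)) (Tv_symp _ _) f hf
  simp only [Tv_symm_apply, neg_neg] at this
  exact this

lemma eval_lu (v u : SympV p t m) : eval (cv v) (lu (cv u)) = sform v u := by
  rw [lu, eval_lform, sform_eq]
  apply Finset.sum_congr rfl; intro w _; ring

lemma cv_Tv (u v : SympV p t m) (c) : cv (Tv u c v) = cv v + (c * sform v u) • cv u := by
  rw [Tv_apply, cv_add, cv_smul]

/-- exact action -/
lemma Eop_exact (ht : 1 < t) (u : SympV p t m) (j : Fin t) (F : Fin t → Pol (GaloisField p t) m)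
    (hF : ∀ l, (Tay (cv u) (F l)).natDegree < p) :
    Eop u j (evT F) = evT (Function.update F j (lu (cv u) * Dir (cv u) (F j))) := by
  funext v
  have h1 := KX ht j (fun l n => sform v u ^ n * eval (cv v) ((Tay (cv u) (F l)).coeff n))
  rw [evT_update, Eop_apply, Pi.neg_apply, Finset.sum_apply]
  simp only [Pi.smul_apply, smul_eq_mul]
  convert h1 using 1
  · congr 1; apply Finset.sum_congr rfl; intro c _
    congr 1
    unfold evT
    apply Finset.prod_congr rfl; intro l _
    rw [cv_Tv, eval_Tay_sum _ _ _ _ (hF l)]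
    congr 1; apply Finset.sum_congr rfl; intro n _; rw [mul_pow, mul_assoc]
  · simp only [pow_one, pow_zero, one_mul, Tay_coeff0, Tay_coeff1, map_mul, eval_lu]

lemma lform_matOf_Tv (u : SympV p t m) (c) (z : Sg m) :
    lform (GaloisField p t) (matOf (Tv u c).toLinearMap z) = X z + C (cv u z) * (C c * lu (cv u)) := by
  have h : ∀ w, matOf (Tv u c).toLinearMap z w = (if z = w then 1 else 0) + cv u z * (c * (sgn _ w * cv u w.swap)) := by
    intro w
    unfold matOf
    have h2 : sform (bas w) u = sgn _ w * cv u w.swap := by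
      rw [sform_eq]; simp only [cv_bas]
      rw [Finset.sum_eq_single w]
      · simp
      · intro b _ hb; simp [hb]
      · simp
    have : cv ((Tv u c).toLinearMap (bas w)) z = cv (Tv u c (bas w)) z := rfl
    rw [this, cv_Tv, Pi.add_apply, cv_bas, Pi.smul_apply, h2, smul_eq_mul]; ring
  unfold lu lform
  simp only [h, C_add, add_mul, Finset.sum_add_distrib, Finset.mul_sum]
  congr 1
  · simp
  · apply Finset.sum_congr rfl; intro w _; simp only [C_mul]; ring

lemma Eop_red (ht : 1 < t) (u : SympV p t m) (j : Fin t) (F : Fin t → Pol (GaloisField p t) m) :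
    - ∑ c : (GaloisField p t)ˣ, ((c⁻¹ : (GaloisField p t)ˣ) : GaloisField p t) ^ (p ^ (j:ℕ)) •
     evT (fun l => redL _ p m (phi (matOf (Tv u c).toLinearMap) (F l)))
    = evT (Function.update (fun l => redL _ p m (F l)) j (redL _ p m (lu (cv u) * Dir (cv u) (F j)))) := by
  funext v
  have h1 := KX ht j (fun l n => eval (cv v) (redL _ p m (lu (cv u) ^ n * (Tay (cv u) (F l)).coeff n)))
  rw [evT_update, Pi.neg_apply, Finset.sum_apply]
  simp only [Pi.smul_apply, smul_eq_mul]
  convert h1 using 1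
  · congr 1; apply Finset.sum_congr rfl; intro c _
    congr 1
    unfold evT
    apply Finset.prod_congr rfl; intro l _
    dsimp only
    rw [Tay_red (cv u) _ (fun w => sgn _ w * cv u w.swap) (c : GaloisField p t) (lform_matOf_Tv u c), map_sum]
    congr 1; apply Finset.sum_congr rfl; intro n _; rw [smul_eval]; rfl
  · simp only [pow_one, pow_zero, one_mul, Tay_coeff0, Tay_coeff1]

variable {d : ℕ} {s0 : Fin t → ℤ} {e0 : Finset (Fin t)}

lemma Adm.Eop (hodd : Odd p) (ht : 1 < t) (hd : d ≤ p ^ t - 2) (h0 : memCase p t m d s0 e0)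
    {s : Fin t → ℤ} {F : Fin t → Pol (GaloisField p t) m} (hA : Adm p t m d s0 e0 s F)
    (u : SympV p t m) (j : Fin t) :
    _root_.Eop u j (evT F) - evT (Function.update (fun l => redL _ p m (F l)) j
      (redL _ p m (lu (cv u) * Dir (cv u) (F j)))) ∈ Yn p t m d s0 e0 (∑ l, s l - 1) := by
  rw [← Eop_red ht, Eop_apply, neg_sub_neg, ← Finset.sum_sub_distrib]
  refine Submodule.sum_mem _ (fun c _ => ?_)
  rw [← smul_sub, ← neg_sub (fun v => evT F (Tv u c v)), smul_neg]
  refine Submodule.neg_mem _ (Submodule.smul_mem _ _ ?_)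
  have h1 := (hA.phi (h := (Tv u c).toLinearMap) (Tv_symp u c)).redL_mem hodd ht hd h0
  rw [← evT_comp] at h1
  exact h1

lemma cv_bas' (z : Sg m) : cv (bas z : SympV p t m) = Pi.single z 1 := by
  funext w; rw [cv_bas, Pi.single_apply]

lemma polar (hodd : Odd p) (a b : Sg m) (f : Pol (GaloisField p t) m) :
    redL _ p m (lu (cv (bas a.swap + bas b.swap : SympV p t m)) * Dir (cv (bas a.swap + bas b.swap : SympV p t m)) f)
     - redL _ p m (lu (cv (bas a.swap + (-1 : GaloisField p t) • bas b.swap : SympV p t m)) *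
        Dir (cv (bas a.swap + (-1 : GaloisField p t) • bas b.swap : SympV p t m)) f)
    = (2 * sgn (GaloisField p t) a * sgn (GaloisField p t) b) • DD (GaloisField p t) p a b f := by
  rw [DD_apply, ← map_sub, ← map_smul]
  congr 1
  rw [cv_add, cv_add, cv_smul, neg_one_smul, ← sub_eq_add_neg, lu_add, lu_sub, Dir_add, Dir_sub, cv_bas', cv_bas', lu_single, lu_single,
    Dir_single, Dir_single, pderiv_eq_dd, pderiv_eq_dd]
  simp only [Sum.swap_swap, smul_eq_C_mul, C_mul]
  have : (C (2 : GaloisField p t) : Pol (GaloisField p t) m) = 2 := map_ofNat C 2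
  rw [this]; ring

/-- realization of `DD a b` at slot `j` -/
def Thop (a b : Sg m) (j : Fin t) :
    (SympV p t m → GaloisField p t) →ₗ[GaloisField p t] (SympV p t m → GaloisField p t) :=
  ((2 * sgn (GaloisField p t) a * sgn (GaloisField p t) b)⁻¹ ^ (p ^ (j:ℕ))) •
    (_root_.Eop (bas a.swap + bas b.swap) j - _root_.Eop (bas a.swap + (-1 : GaloisField p t) • bas b.swap) j)

lemma Thop_stab {M : Submodule (GaloisField p t) (SympV p t m → GaloisField p t)} (hM : SpStable M)
    (a b : Sg m) (j : Fin t) {f} (hf : f ∈ M) : Thop a b j f ∈ M := by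
  unfold Thop
  rw [LinearMap.smul_apply, LinearMap.sub_apply]
  exact M.smul_mem _ (M.sub_mem (Eop_stab hM _ _ hf) (Eop_stab hM _ _ hf))

lemma adm_Thop (hodd : Odd p) (ht : 1 < t) (hd : d ≤ p ^ t - 2) (h0 : memCase p t m d s0 e0)
    {s : Fin t → ℤ} {F : Fin t → Pol (GaloisField p t) m} (hA : Adm p t m d s0 e0 s F)
    (a b : Sg m) (j : Fin t) :
    _root_.Thop a b j (evT F) - evT (Function.update (fun l => redL _ p m (F l)) j
      (DD _ p a b (F j))) ∈ Yn p t m d s0 e0 (∑ l, s l - 1) := by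
  have hc : (2 * sgn (GaloisField p t) a * sgn (GaloisField p t) b) ≠ 0 :=
    mul_ne_zero (mul_ne_zero (two_ne (p := p) hodd) (sgn_ne a)) (sgn_ne b)
  have h1 := polar (t := t) hodd a b (F j)
  have h2 : DD _ p a b (F j) = (2 * sgn (GaloisField p t) a * sgn (GaloisField p t) b)⁻¹ •
    ((2 * sgn (GaloisField p t) a * sgn (GaloisField p t) b) • DD (GaloisField p t) p a b (F j)) := by
    rw [smul_smul, inv_mul_cancel₀ hc, one_smul]
  rw [h2, ← h1, evT_update_smul, sub_eq_add_neg (redL _ p m _), evT_update_add, ← neg_one_smul (GaloisField p t) (redL _ p m _),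
    evT_update_smul]
  have hodd' : (-1 : GaloisField p t) ^ (p ^ (j:ℕ)) = -1 := (hodd.pow).neg_one_pow
  rw [hodd', neg_one_smul]
  unfold _root_.Thop
  rw [LinearMap.smul_apply, LinearMap.sub_apply, ← smul_sub]
  refine Submodule.smul_mem _ _ ?_
  have h3 := Submodule.sub_mem _ (hA.Eop hodd ht hd h0 (bas a.swap + bas b.swap) j)
    (hA.Eop hodd ht hd h0 (bas a.swap + (-1 : GaloisField p t) • bas b.swap) j)
  convert h3 using 1
  abel

lemma Adm.DD {s : Fin t → ℤ} {F : Fin t → Pol (GaloisField p t) m} (hA : Adm p t m d s0 e0 s F)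
    (a b : Sg m) (j : Fin t) : Adm p t m d s0 e0 s (Function.update F j (_root_.DD _ p a b (F j))) := by
  refine hA.update j ?_ (fun hj => ?_)
  · rw [DD_apply]
    apply redL_homog
    have key : ∀ a b : Sg m, (X a * dd (GaloisField p t) b (F j)).IsHomogeneous (lamOfN p t d s j) := by
      intro a b
      rw [← mem_homogeneousSubmodule]
      refine map_mem_of_homog (LinearMap.mulLeft _ (X a) ∘ₗ dd (GaloisField p t) b) _ (hA.hom j) (fun e he => ?_)
      rw [LinearMap.comp_apply, dd_monomial, LinearMap.mulLeft_apply, X, monomial_mul]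
      by_cases h : e b.swap = 0
      · rw [h]; simp
      · rw [mem_homogeneousSubmodule]
        apply isHomogeneous_monomial
        have := degree_mv (z := a) (Nat.pos_of_ne_zero h)
        unfold mv at this
        rw [add_comm, this, he]
    exact (key a b).add (key b a)
  · have := hA.sgn j hj
    unfold SG at *
    rw [tauL_DD, this, redL_DD, map_smul, DD_redL]
end P8b
end


noncomputable section
set_option linter.unusedSectionVars false
set_option linter.unusedSimpArgs false

open MvPolynomial

/-- `g` is an allowable digit attached to the exponent `e`. -/
def DgAt (p : ℕ) {K : Type} [Field K] {m : ℕ} (n : ℕ) (pl : Prop) (e : Ex m) (g : Pol K m) : Prop :=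
  Red p e ∧ e.degree = n ∧ ((n ≠ m * (p - 1) ∧ ¬ pl ∧ g = monomial e 1) ∨
    (n = m * (p - 1) ∧ flp p e = e ∧ pl ∧ g = monomial e 1) ∨
    (n = m * (p - 1) ∧ flp p e ≠ e ∧ g = vv K p (sg K pl) e))

/-- eigenvalue of the quadratic operators on monomials -/
def kap (K : Type) [Field K] {m : ℕ} (z : Sg m) (e : Ex m) : K := -((e z.swap : K) * ((e z : K) + 1))

section P9a
variable {K : Type} [Field K] {p m : ℕ} [hpp : Fact p.Prime] [hch : CharP K p]

lemma vv_zero (e : Ex m) (h : Red p e) : vv K p 0 e = monomial e 1 := by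
  rw [vv_red _ _ h]; simp

lemma vv_fixed (e : Ex m) (h : Red p e) (hf : flp p e = e) : vv K p 1 e = (2:K) • monomial e 1 := by
  rw [vv_red _ _ h, hf, cf_fixed e h hf, two_smul]; simp

lemma sg_pos {pl : Prop} (h : pl) : sg K pl = 1 := by simp [sg, h]

lemma vv_pos_iff (hodd : Odd p) {U : Submodule K (Pol K m)} {n : ℕ} {pl : Prop} {e : Ex m} {g : Pol K m}
    (h : DgAt p n pl e g) (hn : n = m * (p - 1)) (hp : pl) : vv K p 1 e ∈ U ↔ g ∈ U := by
  obtain ⟨h1, h2, h3 | h3 | h3⟩ := h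
  · exact absurd hn h3.1
  · rw [vv_fixed e h1 h3.2.1, h3.2.2.2, Submodule.smul_mem_iff _ (two_ne (p := p) hodd)]
  · rw [h3.2.2, sg_pos hp]

lemma dg_reach (hodd : Odd p) {U : Submodule K (Pol K m)} (hU : ClosedDD p U) {n : ℕ} {pl : Prop}
    {g0 g1 : Pol K m} (h0 : IsDg p n pl g0) (h1 : IsDg p n pl g1) (hg : g0 ∈ U) : g1 ∈ U := by
  obtain ⟨e0, h0⟩ := h0
  obtain ⟨e1, h1⟩ := h1
  have h0 : DgAt p n pl e0 g0 := h0
  have h1 : DgAt p n pl e1 g1 := h1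
  by_cases hn : n = m * (p - 1)
  · by_cases hp : pl
    · have a0 := (vv_pos_iff (U := U) hodd h0 hn hp).2 hg
      refine (vv_pos_iff (U := U) hodd h1 hn hp).1 ?_
      exact reachA hodd hU 1 n (Or.inr rfl) e1 h1.1 h1.2.1 _ e0 rfl h0.1 h0.2.1 a0
    · obtain ⟨a1, a2, a3⟩ := h0
      obtain ⟨b1, b2, b3⟩ := h1
      simp only [hn, ne_eq, not_true_eq_false, false_and, hp, and_false, false_or, true_and] at a3 b3
      rw [b3.2]
      refine reachM hodd hU _ (sg_sq _) a1 b1 (a2.trans hn) (b2.trans hn) a3.1 b3.1 ?_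
      rw [← a3.2]; exact hg
  · obtain ⟨a1, a2, a3⟩ := h0
    obtain ⟨b1, b2, b3⟩ := h1
    simp only [hn, ne_eq, not_false_eq_true, false_and, or_false, true_and] at a3 b3
    rw [b3.2, ← vv_zero e1 b1]
    refine reachA hodd hU 0 n (Or.inl hn) e1 b1 b2 _ e0 rfl a1 a2 ?_
    rw [vv_zero e0 a1, ← a3.2]; exact hg

lemma dg_reach0 (hodd : Odd p) {U : Submodule K (Pol K m)} (hU : ClosedDD p U) {n : ℕ} {pl : Prop}
    {e : Ex m} (he : Red p e) (hd : e.degree = n) (hf : n = m * (p - 1) → flp p e ≠ e)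
    (hU1 : monomial e 1 ∈ U) {g : Pol K m} (hg : IsDg p n pl g) : g ∈ U := by
  have all : ∀ e' : Ex m, Red p e' → e'.degree = n → monomial e' 1 ∈ U := by
    intro e' hr hd'
    rw [← vv_zero e' hr]
    rw [← vv_zero e he] at hU1
    by_cases hn : n = m * (p - 1)
    · exact reachP hodd hU he hr (hd.trans hn) (hd'.trans hn) (hf hn) hU1
    · exact reachA hodd hU 0 n (Or.inl hn) e' hr hd' _ e rfl he hd hU1
  obtain ⟨e', a1, a2, a3 | a3 | a3⟩ := hg
  · rw [a3.2.2]; exact all _ a1 a2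
  · rw [a3.2.2.2]; exact all _ a1 a2
  · rw [a3.2.2, vv_red _ _ a1]
    refine U.add_mem (all _ a1 a2) ?_
    rw [show monomial (flp p e') (sg K pl * cf K e') = (sg K pl * cf K e') • monomial (flp p e') (1:K) by
      rw [smul_monomial]; simp]
    refine U.smul_mem _ (all _ (red_flp e') ?_)
    have := degree_flp a1
    omega

lemma DgAt.eig {n : ℕ} {pl : Prop} {e : Ex m} {g : Pol K m} (h : DgAt p n pl e g) (k) :
    DG K p k g = ev0 K k e • g := by
  obtain ⟨h1, h2, h3 | h3 | h3⟩ := h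
  · rw [h3.2.2, DG_monomial, redL_monomial, if_pos h1]
  · rw [h3.2.2.2, DG_monomial, redL_monomial, if_pos h1]
  · rw [h3.2.2, DG_vv]

lemma DgAt.shape {n : ℕ} {pl : Prop} {e : Ex m} {g : Pol K m} (h : DgAt p n pl e g) :
    ∃ c : K, g = monomial e 1 + c • monomial (flp p e) 1 ∧ (c ≠ 0 → n = m * (p - 1)) := by
  obtain ⟨h1, h2, h3 | h3 | h3⟩ := h
  · exact ⟨0, by simp [h3.2.2], by simp⟩
  · exact ⟨0, by simp [h3.2.2.2], by simp⟩
  · refine ⟨sg K pl * cf K e, ?_, fun _ => h3.1⟩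
    rw [h3.2.2, vv_red _ _ h1, smul_monomial]; simp

lemma DgAt.prop (hodd : Odd p) {n : ℕ} {pl : Prop} {e e' : Ex m} {g g' : Pol K m} (h : DgAt p n pl e g)
    (h' : DgAt p n pl e' g') (hev : ∀ k, ev0 K k e = ev0 K k e') : ∃ c : K, g' = c • g := by
  obtain ⟨h1, h2, h3⟩ := h
  obtain ⟨k1, k2, k3⟩ := h'
  have same : e' = e → ∃ c : K, g' = c • g := by
    rintro rfl
    refine ⟨1, ?_⟩
    rw [one_smul]
    rcases h3 with h3 | h3 | h3 <;> rcases k3 with k3 | k3 | k3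
    · rw [h3.2.2, k3.2.2]
    · exact absurd k3.1 h3.1
    · exact absurd k3.1 h3.1
    · exact absurd h3.1 k3.1
    · rw [h3.2.2.2, k3.2.2.2]
    · exact absurd h3.2.1 k3.2.1
    · exact absurd h3.1 k3.1
    · exact absurd k3.2.1 h3.2.1
    · rw [h3.2.2, k3.2.2]
  rcases sepChar hodd h1 k1 hev with he | he
  · exact same he
  · have hd := degree_flp h1
    rw [← he, k2, h2] at hd
    have hn : n = m * (p - 1) := by omega
    by_cases hf : flp p e = e
    · exact same (he.trans hf)
    have hf' : flp p e' ≠ e' := by rw [he, flp_flp h1]; exact fun h => hf h.symm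
    simp only [hn, ne_eq, not_true_eq_false, false_and, hf, hf', false_or, not_false_eq_true, true_and] at h3 k3
    rw [h3, k3]
    refine ⟨sg K pl * cf K e', ?_⟩
    rw [vv_flp _ (sg_sq pl) e' k1, he, flp_flp h1]

lemma exists_cap (cap : Sg m → ℕ) (D : ℕ) (h : D ≤ ∑ z, cap z) :
    ∃ e : Ex m, (∀ z, e z ≤ cap z) ∧ e.degree = D := by
  induction D with
  | zero => exact ⟨0, fun z => by simp, by simp⟩
  | succ D ih =>
    obtain ⟨e, h1, h2⟩ := ih (by omega)
    have : ∃ z, e z < cap z := by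
      by_contra hc
      push Not at hc
      have := Finset.sum_le_sum (fun z (_ : z ∈ Finset.univ) => hc z)
      rw [← degree_eq_sum' e] at this
      omega
    obtain ⟨z, hz⟩ := this
    refine ⟨e + Finsupp.single z 1, ?_, ?_⟩
    · intro w
      have := h1 w
      by_cases hw : z = w
      · subst hw; simp; omega
      · simp [Finsupp.single_apply, hw]; omega
    · rw [map_add, h2]; simp

lemma kap_flp (z : Sg m) {e : Ex m} (h : Red p e) : kap K z (flp p e) = kap K z e := by
  simp only [kap, flp_apply, Sum.swap_swap]
  rw [cast_p_sub _ (h _), cast_p_sub _ (h _)]; ring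

lemma kap_parity {e e' : Ex m} (he : Red p e) (he' : Red p e')
    (h : ∀ z, kap K z e = kap K z e') : e.degree % 2 = e'.degree % 2 := by
  have hp := hpp.out.two_le
  have hc : ∀ i : Fin m, (e (Sum.inl i) + e (Sum.inr i)) ≡ (e' (Sum.inl i) + e' (Sum.inr i)) [MOD 2] := by
    intro i
    have k1 := h (Sum.inl i)
    have k2 := h (Sum.inr i)
    simp only [kap, Sum.swap_inl, Sum.swap_inr] at k1 k2
    set a : K := (e (Sum.inl i) : K) with ha; set b : K := (e (Sum.inr i) : K) with hb
    have key : ((e' (Sum.inl i) : K) - a) * ((e' (Sum.inl i) : K) + b + 1) = 0 := by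
      linear_combination ((e' (Sum.inl i) : K)) * (k2 - k1) + k2
    have kd : (e' (Sum.inr i) : K) = b + e' (Sum.inl i) - a := by linear_combination k1 - k2
    have q1 := he (Sum.inl i)
    have q2 := he (Sum.inr i)
    unfold Nat.ModEq
    rcases mul_eq_zero.1 key with h5 | h5
    · have := cast_inj_small (K := K) (he' (Sum.inl i)) (he (Sum.inl i)) (by linear_combination h5)
      have := cast_inj_small (K := K) (he' (Sum.inr i)) (he (Sum.inr i)) (by rw [kd]; linear_combination h5)
      omega
    · have : e' (Sum.inl i) = p - 1 - e (Sum.inr i) := by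
        refine cast_inj_small (K := K) (p := p) (he' _) (by omega) ?_
        rw [cast_p_sub _ (he _)]; linear_combination h5
      have : e' (Sum.inr i) = p - 1 - e (Sum.inl i) := by
        refine cast_inj_small (K := K) (p := p) (he' _) (by omega) ?_
        rw [cast_p_sub _ (he _)]; rw [kd]; linear_combination h5
      omega
  have hs : ∀ f : Ex m, f.degree = ∑ i : Fin m, (f (Sum.inl i) + f (Sum.inr i)) := by
    intro f
    rw [degree_eq_sum', Fintype.sum_sum_type, Finset.sum_add_distrib]
  rw [hs, hs]
  rw [Finset.sum_nat_mod, Finset.sum_nat_mod Finset.univ 2 (fun i => e' (Sum.inl i) + e' (Sum.inr i))]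
  congr 1
  exact Finset.sum_congr rfl (fun i _ => hc i)

end P9a
end


noncomputable section
set_option linter.unusedSectionVars false
set_option linter.unusedSimpArgs false

open MvPolynomial

section P10a
variable {p t m d : ℕ} [hpp : Fact p.Prime] [hnz : NeZero t]

/-- allowed values of slot `j`, modulo `M` -/
def Vslot (d : ℕ) (s0 : Fin t → ℤ) (e0 : Finset (Fin t))
    (M : Submodule (GaloisField p t) (SympV p t m → GaloisField p t)) (s : Fin t → ℤ)
    (F : Fin t → Pol (GaloisField p t) m) (j : Fin t) : Submodule (GaloisField p t) (Pol (GaloisField p t) m) where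
  carrier := {g | evT (Function.update F j g) ∈ M ∧ g.IsHomogeneous (lamOfN p t d s j) ∧
    redL _ p m g = g ∧ (j ∈ Zset p t m d s s0 → SG p (j ∈ e0) g)}
  add_mem' := by
    rintro a b ⟨a1, a2, a3, a4⟩ ⟨b1, b2, b3, b4⟩
    refine ⟨by rw [evT_update_add]; exact M.add_mem a1 b1, a2.add b2, by rw [map_add, a3, b3], fun h => ?_⟩
    have := a4 h; have := b4 h
    unfold SG at *
    rw [map_add, map_add, smul_add]; simp_all
  zero_mem' := by
    refine ⟨by rw [evT_update_zero]; exact M.zero_mem, isHomogeneous_zero _ _ _, by simp, fun h => by simp [SG]⟩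
  smul_mem' := by
    rintro c a ⟨a1, a2, a3, a4⟩
    refine ⟨by rw [evT_update_smul]; exact M.smul_mem _ a1, ?_, by rw [map_smul, a3], fun h => ?_⟩
    · exact (homogeneousSubmodule _ _ _).smul_mem c a2
    · have := a4 h
      unfold SG at *
      rw [map_smul, map_smul, this, smul_comm]

lemma mem_Vslot {s0 : Fin t → ℤ} {e0 : Finset (Fin t)}
    {M : Submodule (GaloisField p t) (SympV p t m → GaloisField p t)} {s : Fin t → ℤ}
    {F : Fin t → Pol (GaloisField p t) m} {j : Fin t} {g} : g ∈ Vslot d s0 e0 M s F j ↔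
    evT (Function.update F j g) ∈ M ∧ g.IsHomogeneous (lamOfN p t d s j) ∧
    redL _ p m g = g ∧ (j ∈ Zset p t m d s s0 → SG p (j ∈ e0) g) := Iff.rfl

variable {s0 : Fin t → ℤ} {e0 : Finset (Fin t)}

lemma thop_red (hodd : Odd p) (ht : 1 < t) (hd : d ≤ p ^ t - 2) (h0 : memCase p t m d s0 e0)
    {s : Fin t → ℤ} {F : Fin t → Pol (GaloisField p t) m}
    (hA : Adm p t m d s0 e0 s F) (hr : ∀ l, redL _ p m (F l) = F l) (a b : Sg m) (j : Fin t) :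
    Thop a b j (evT F) - evT (Function.update F j (DD _ p a b (F j))) ∈ Yn p t m d s0 e0 (∑ l, s l - 1) := by
  have := adm_Thop hodd ht hd h0 hA a b j
  simpa only [hr] using this

lemma red_update {F : Fin t → Pol (GaloisField p t) m} (hr : ∀ l, redL _ p m (F l) = F l) (j : Fin t)
    {g : Pol (GaloisField p t) m} (hg : redL _ p m g = g) (l : Fin t) :
    redL _ p m (Function.update F j g l) = Function.update F j g l := by
  by_cases h : l = j
  · subst h; simpa using hg
  · simpa [h] using hr l

lemma Vslot_closed (hodd : Odd p) (ht : 1 < t) (hd : d ≤ p ^ t - 2) (h0 : memCase p t m d s0 e0)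
    {s : Fin t → ℤ} {F : Fin t → Pol (GaloisField p t) m}
    (hA : Adm p t m d s0 e0 s F) (hr : ∀ l, redL _ p m (F l) = F l)
    {M : Submodule (GaloisField p t) (SympV p t m → GaloisField p t)} (hM : SpStable M)
    (hY : Yn p t m d s0 e0 (∑ l, s l - 1) ≤ M) (j : Fin t) : ClosedDD p (Vslot d s0 e0 M s F j) := by
  rintro a b g ⟨h1, h2, h3, h4⟩
  have hA' := hA.update j h2 h4
  have hT := hY (thop_red hodd ht hd h0 hA' (red_update hr j h3) a b j)
  have hA2 := hA'.DD a b j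
  simp only [Function.update_self, Function.update_idem] at hT hA2
  refine ⟨?_, ?_, ?_, fun hz => ?_⟩
  · have := M.sub_mem (Thop_stab hM a b j h1) hT
    simpa using this
  · have := hA2.hom j
    simpa using this
  · exact redL_DD ..
  · have := hA2.sgn j hz
    simpa using this

lemma slot_reach (hodd : Odd p) (ht : 1 < t) (hd : d ≤ p ^ t - 2) (h0 : memCase p t m d s0 e0)
    {s : Fin t → ℤ} {F : Fin t → Pol (GaloisField p t) m}
    (hA : Adm p t m d s0 e0 s F) (hr : ∀ l, redL _ p m (F l) = F l)
    {M : Submodule (GaloisField p t) (SympV p t m → GaloisField p t)} (hM : SpStable M)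
    (hY : Yn p t m d s0 e0 (∑ l, s l - 1) ≤ M) (j : Fin t) (hF : evT F ∈ M) {pl : Prop}
    (h1 : IsDg p (lamOfN p t d s j) pl (F j)) {g} (hg : IsDg p (lamOfN p t d s j) pl g) :
    evT (Function.update F j g) ∈ M := by
  have hc := Vslot_closed hodd ht hd h0 hA hr hM hY j
  refine (mem_Vslot.1 (dg_reach hodd hc h1 hg ?_)).1
  exact ⟨by rwa [Function.update_eq_self], hA.hom j, hr j, hA.sgn j⟩

lemma slot_reach0 (hodd : Odd p) (ht : 1 < t) (hd : d ≤ p ^ t - 2) (h0 : memCase p t m d s0 e0)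
    {s : Fin t → ℤ} {F : Fin t → Pol (GaloisField p t) m}
    (hA : Adm p t m d s0 e0 s F) (hr : ∀ l, redL _ p m (F l) = F l)
    {M : Submodule (GaloisField p t) (SympV p t m → GaloisField p t)} (hM : SpStable M)
    (hY : Yn p t m d s0 e0 (∑ l, s l - 1) ≤ M) (j : Fin t) (hF : evT F ∈ M) {pl : Prop}
    {e : Ex m} (he : F j = monomial e 1) (her : Red p e) (hed : e.degree = lamOfN p t d s j)
    (hef : lamOfN p t d s j = m * (p - 1) → flp p e ≠ e)
    {g} (hg : IsDg p (lamOfN p t d s j) pl g) :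
    evT (Function.update F j g) ∈ M := by
  have hc := Vslot_closed hodd ht hd h0 hA hr hM hY j
  refine (mem_Vslot.1 (dg_reach0 hodd hc her hed hef ?_ hg)).1
  rw [← he]
  exact ⟨by rwa [Function.update_eq_self], hA.hom j, hr j, hA.sgn j⟩

lemma dg_reach_all (hodd : Odd p) (ht : 1 < t) (hd : d ≤ p ^ t - 2) (h0 : memCase p t m d s0 e0)
    {M : Submodule (GaloisField p t) (SympV p t m → GaloisField p t)} (hM : SpStable M)
    (hY : Yn p t m d s0 e0 (∑ l, s0 l - 1) ≤ M) {g0 g1 : Fin t → Pol (GaloisField p t) m}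
    (h1 : ∀ j, IsDg p (lamOfN p t d s0 j) (j ∈ e0) (g0 j))
    (h2 : ∀ j, IsDg p (lamOfN p t d s0 j) (j ∈ e0) (g1 j)) (hg : evT g0 ∈ M) : evT g1 ∈ M := by
  have key : ∀ S : Finset (Fin t), evT (fun l => if l ∈ S then g1 l else g0 l) ∈ M := by
    intro S
    induction S using Finset.induction_on with
    | empty => simpa using hg
    | insert j S hj ih =>
      have hD : ∀ l, IsDg p (lamOfN p t d s0 l) (l ∈ e0) (if l ∈ S then g1 l else g0 l) := by
        intro l; split_ifs
        · exact h2 l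
        · exact h1 l
      have := slot_reach hodd ht hd h0 (adm_of_SBF h0 (leSd_refl _ _) hD) (fun l => (hD l).red) hM hY j ih
        (hD j) (h2 j)
      convert this using 2
      ext1 l
      by_cases hl : l = j
      · subst hl; simp
      · simp [hl]
  simpa using key Finset.univ

/-- functional version of `DG` -/
def DGop (k : Sg m ⊕ (Fin m × Fin m)) (j : Fin t) :
    (SympV p t m → GaloisField p t) →ₗ[GaloisField p t] (SympV p t m → GaloisField p t) :=
  match k with
  | Sum.inl z => Thop z.swap z.swap j ∘ₗ Thop z z j
  | Sum.inr (i, k) => if i = k then 0 else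
      -(Thop (Sum.inr i) (Sum.inr k) j ∘ₗ Thop (Sum.inl i) (Sum.inl k) j) +
        Thop (Sum.inl k) (Sum.inr i) j ∘ₗ Thop (Sum.inl i) (Sum.inr k) j

lemma DGop_inl (z : Sg m) (j : Fin t) (f : SympV p t m → GaloisField p t) :
    DGop (Sum.inl z) j f = Thop z.swap z.swap j (Thop z z j f) := by
  simp only [DGop, LinearMap.comp_apply]

lemma DGop_inr (i k : Fin m) (j : Fin t) (f : SympV p t m → GaloisField p t) :
    DGop (Sum.inr (i, k)) j f = if i = k then 0 else
      -(Thop (Sum.inr i) (Sum.inr k) j (Thop (Sum.inl i) (Sum.inl k) j f)) +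
        Thop (Sum.inl k) (Sum.inr i) j (Thop (Sum.inl i) (Sum.inr k) j f) := by
  simp only [DGop]
  split_ifs
  · rfl
  · simp only [LinearMap.add_apply, LinearMap.neg_apply, LinearMap.comp_apply]

lemma DGop_stab {M : Submodule (GaloisField p t) (SympV p t m → GaloisField p t)} (hM : SpStable M)
    (k : Sg m ⊕ (Fin m × Fin m)) (j : Fin t) (f) (hf : f ∈ M) : DGop k j f ∈ M := by
  rcases k with z | ⟨i, k⟩
  · rw [DGop_inl]; exact Thop_stab hM _ _ _ (Thop_stab hM _ _ _ hf)
  · rw [DGop_inr]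
    split_ifs
    · simp
    · exact M.add_mem (M.neg_mem (Thop_stab hM _ _ _ (Thop_stab hM _ _ _ hf)))
        (Thop_stab hM _ _ _ (Thop_stab hM _ _ _ hf))

lemma Thop_Thop (hodd : Odd p) (ht : 1 < t) (hd : d ≤ p ^ t - 2) (h0 : memCase p t m d s0 e0)
    {s : Fin t → ℤ} {F : Fin t → Pol (GaloisField p t) m}
    (hA : Adm p t m d s0 e0 s F) (hr : ∀ l, redL _ p m (F l) = F l) (a b a' b' : Sg m) (j : Fin t) :
    Thop a b j (Thop a' b' j (evT F)) - evT (Function.update F j (DD _ p a b (DD _ p a' b' (F j))))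
      ∈ Yn p t m d s0 e0 (∑ l, s l - 1) := by
  have h1 := thop_red hodd ht hd h0 hA hr a' b' j
  have h2 := Thop_stab (Yn_stable hodd ht hd h0 _) a b j h1
  have h3 := thop_red hodd ht hd h0 (hA.DD a' b' j) (red_update hr j (redL_DD ..)) a b j
  simp only [Function.update_self, Function.update_idem] at h3
  rw [map_sub] at h2
  have := Submodule.add_mem _ h2 h3
  simpa using this

lemma evT_update_neg (f : Fin t → Pol (GaloisField p t) m) (j : Fin t) (g) :
    evT (Function.update f j (-g)) = - evT (Function.update f j g) := by
  have := evT_update_add f j (-g) g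
  rw [neg_add_cancel, evT_update_zero] at this
  exact eq_neg_of_add_eq_zero_left this.symm

lemma DGop_mem (hodd : Odd p) (ht : 1 < t) (hd : d ≤ p ^ t - 2) (h0 : memCase p t m d s0 e0)
    {s : Fin t → ℤ} {F : Fin t → Pol (GaloisField p t) m}
    (hA : Adm p t m d s0 e0 s F) (hr : ∀ l, redL _ p m (F l) = F l) (k) (j : Fin t) {c : GaloisField p t}
    (hc : DG _ p k (F j) = c • F j) :
    DGop k j (evT F) - c ^ (p ^ (j : ℕ)) • evT F ∈ Yn p t m d s0 e0 (∑ l, s l - 1) := by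
  have key : DGop k j (evT F) - evT (Function.update F j (DG _ p k (F j))) ∈ Yn p t m d s0 e0 (∑ l, s l - 1) := by
    rcases k with z | ⟨i, k⟩
    · rw [DGop_inl]
      have h := Thop_Thop hodd ht hd h0 hA hr z.swap z.swap z z j
      simpa only [DG, LinearMap.comp_apply] using h
    · rw [DGop_inr]
      simp only [DG]
      split_ifs
      · simp [evT_update_zero]
      · simp only [LinearMap.add_apply, LinearMap.neg_apply, LinearMap.comp_apply]
        rw [evT_update_add, evT_update_neg]
        have a1 := Thop_Thop hodd ht hd h0 hA hr (Sum.inr i) (Sum.inr k) (Sum.inl i) (Sum.inl k) j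
        have a2 := Thop_Thop hodd ht hd h0 hA hr (Sum.inl k) (Sum.inr i) (Sum.inl i) (Sum.inr k) j
        have := Submodule.sub_mem _ a2 a1
        convert this using 1
        abel
  rw [hc, evT_update_smul, Function.update_eq_self] at key
  exact key

lemma frob_inj (l : ℕ) {a b : GaloisField p t} (h : a ^ p ^ l = b ^ p ^ l) : a = b := by
  have h1 : (a - b) ^ p ^ l = a ^ p ^ l - b ^ p ^ l := sub_pow_char_pow _ _ _
  rw [h, sub_self] at h1
  exact sub_eq_zero.1 (pow_eq_zero_iff (pow_ne_zero _ hpp.out.ne_zero) |>.1 h1)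

lemma evT_prop {g g' : Fin t → Pol (GaloisField p t) m} (h : ∀ j, ∃ c : GaloisField p t, g' j = c • g j) :
    ∃ c : GaloisField p t, evT g' = c • evT g := by
  choose c hc using h
  refine ⟨∏ j, c j ^ (p ^ (j : ℕ)), ?_⟩
  ext v
  simp only [evT, hc, smul_eval, mul_pow, Finset.prod_mul_distrib, Pi.smul_apply, smul_eq_mul]

lemma top_split (h0 : memCase p t m d s0 e0) : Ymod p t m d s0 e0 ≤
    Submodule.span _ {f | ∃ g : Fin t → Pol (GaloisField p t) m,
      (∀ j, IsDg p (lamOfN p t d s0 j) (j ∈ e0) (g j)) ∧ f = evT g} ⊔ Yltmod p t m d s0 e0 := by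
  unfold Ymod
  rw [Submodule.span_le]
  rintro f ⟨s', e', h1, h2, h3⟩
  by_cases hs : s' = s0 ∧ e' = e0
  · obtain ⟨rfl, rfl⟩ := hs
    refine Submodule.mem_sup_left (Submodule.subset_span ?_)
    exact (isSBF_iff _ _ _).1 h3
  · exact Submodule.mem_sup_right (Submodule.subset_span ⟨s', e', h1, h2, hs, h3⟩)

lemma top_in (hodd : Odd p) (ht : 1 < t) (hd : d ≤ p ^ t - 2) (h0 : memCase p t m d s0 e0)
    {M : Submodule (GaloisField p t) (SympV p t m → GaloisField p t)} (hM : SpStable M)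
    (hY : Yltmod p t m d s0 e0 ≤ M) {f} (hf : f ∈ Ymod p t m d s0 e0) (hfn : f ∉ Yltmod p t m d s0 e0)
    (hfM : f ∈ M) : Ymod p t m d s0 e0 ≤ M := by
  have hY' := hY
  rw [Yltmod_eq h0] at hY'
  -- it suffices to find one
  suffices hs : ∃ g : Fin t → Pol (GaloisField p t) m,
      (∀ j, IsDg p (lamOfN p t d s0 j) (j ∈ e0) (g j)) ∧ evT g ∈ M by
    obtain ⟨g, hg, hgM⟩ := hs
    refine (top_split h0).trans (sup_le ?_ hY)
    rw [Submodule.span_le]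
    rintro _ ⟨g1, hg1, rfl⟩
    exact dg_reach_all hodd ht hd h0 hM hY' hg hg1 hgM
  by_contra hcon
  push Not at hcon
  obtain ⟨x, hx, y, hy, rfl⟩ := Submodule.mem_sup.1 (top_split h0 hf)
  apply hfn
  let I := {q : (Fin t → Ex m) × (Fin t → Pol (GaloisField p t) m) //
    ∀ j, DgAt p (lamOfN p t d s0 j) (j ∈ e0) (q.1 j) (q.2 j)}
  have hIs : ∀ i : I, ∀ j, IsDg p (lamOfN p t d s0 j) (j ∈ e0) (i.1.2 j) := fun i j => ⟨i.1.1 j, i.2 j⟩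
  have hrange : {f | ∃ g : Fin t → Pol (GaloisField p t) m,
      (∀ j, IsDg p (lamOfN p t d s0 j) (j ∈ e0) (g j)) ∧ f = evT g} ⊆ Set.range (fun i : I => evT i.1.2) := by
    rintro _ ⟨g, hg, rfl⟩
    choose e he using hg
    exact ⟨⟨(e, g), he⟩, rfl⟩
  have hx' := Submodule.span_mono hrange hx
  rw [Finsupp.mem_span_range_iff_exists_finsupp] at hx'
  obtain ⟨c, hc⟩ := hx'
  have hxM : x ∈ M := by
    have := M.sub_mem hfM (hY hy)
    simpa using this
  let v : I → (SympV p t m → GaloisField p t) := fun i => c i • evT i.1.2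
  let χ : I → (Sg m ⊕ (Fin m × Fin m)) × Fin t → GaloisField p t :=
    fun i k => ev0 _ k.1 (i.1.1 k.2) ^ (p ^ (k.2 : ℕ))
  have hxs : x = ∑ i ∈ c.support, v i := by rw [← hc]; rfl
  have hv : ∀ i ∈ c.support, ∀ k : (Sg m ⊕ (Fin m × Fin m)) × Fin t, DGop k.1 k.2 (v i) - χ i k • v i ∈ M := by
    intro i _ k
    have := hY' (DGop_mem hodd ht hd h0 (adm_of_SBF h0 (leSd_refl _ _) (hIs i)) (fun l => (hIs i l).red)
      k.1 k.2 ((i.2 k.2).eig k.1))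
    have := M.smul_mem (c i) this
    simp only [v, χ, map_smul]
    rw [smul_sub, smul_comm] at this
    exact this
  have hcls : ∀ i0 : I, ∑ i ∈ c.support with χ i = χ i0, v i = 0 := by
    intro i0
    have h1 : ∑ i ∈ c.support with χ i = χ i0, v i ∈ M := by
      convert sep M (fun k : (Sg m ⊕ (Fin m × Fin m)) × Fin t => DGop k.1 k.2)
        (fun k x hx => DGop_stab hM k.1 k.2 x hx) χ i0 c.support v hv (by rw [← hxs]; exact hxM)
    have h2 : ∀ i, χ i = χ i0 → ∃ a : GaloisField p t, evT i.1.2 = a • evT i0.1.2 := by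
      intro i hi
      apply evT_prop
      intro j
      refine (i0.2 j).prop hodd (i.2 j) (fun k => ?_)
      have := congrFun hi (k, j)
      exact (frob_inj _ this).symm
    have h3 : ∃ a : GaloisField p t, ∑ i ∈ c.support with χ i = χ i0, v i = a • evT i0.1.2 := by
      choose! a ha using h2
      refine ⟨∑ i ∈ c.support with χ i = χ i0, c i * a i, ?_⟩
      rw [Finset.sum_smul]
      refine Finset.sum_congr rfl (fun i hi => ?_)
      simp only [v]
      rw [ha i (Finset.mem_filter.1 hi).2, smul_smul]
    obtain ⟨a, ha⟩ := h3
    rw [ha] at h1 ⊢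
    by_cases ha0 : a = 0
    · simp [ha0]
    · exact absurd ((Submodule.smul_mem_iff _ ha0).1 h1) (hcon _ (hIs i0))
  have hx0 : x = 0 := by
    rw [hxs, ← Finset.sum_fiberwise_of_maps_to (t := c.support.image χ) (g := χ)
      (fun i hi => Finset.mem_image_of_mem _ hi)]
    refine Finset.sum_eq_zero (fun w hw => ?_)
    obtain ⟨i0, _, rfl⟩ := Finset.mem_image.1 hw
    exact hcls i0
  rw [hx0, zero_add]; exact hy

end P10a
end


noncomputable section
set_option linter.unusedSectionVars false
set_option linter.unusedSimpArgs false

open MvPolynomial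

section P11a
variable {p t m d : ℕ} [hpp : Fact p.Prime] [hnz : NeZero t]

lemma lu_dir (z : Sg m) (f : Pol (GaloisField p t) m) :
    lu (cv (bas z.swap : SympV p t m)) * Dir (cv (bas z.swap : SympV p t m)) f = X z * dd _ z f := by
  rw [cv_bas', Dir_single, lu_single, pderiv_eq_dd, Sum.swap_swap, smul_eq_C_mul]
  have : (C (sgn (GaloisField p t) z) * C (sgn (GaloisField p t) z) : Pol (GaloisField p t) m) = 1 := by
    rw [← C_mul, sgn_sq, C_1]
  linear_combination (X z * dd _ z f) * this

/-- quadratic operator -/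
def Thz (z : Sg m) (j : Fin t) :
    (SympV p t m → GaloisField p t) →ₗ[GaloisField p t] (SympV p t m → GaloisField p t) :=
  Eop (bas z) j ∘ₗ Eop (bas z.swap) j

lemma Thz_apply (z : Sg m) (j : Fin t) (f : SympV p t m → GaloisField p t) :
    Thz z j f = Eop (bas z) j (Eop (bas z.swap) j f) := rfl

lemma Thz_stab {M : Submodule (GaloisField p t) (SympV p t m → GaloisField p t)} (hM : SpStable M)
    (z : Sg m) (j : Fin t) (f) (hf : f ∈ M) : Thz z j f ∈ M :=
  Eop_stab hM _ _ (Eop_stab hM _ _ hf)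

lemma half_DD (hodd : Odd p) (z : Sg m) (f : Pol (GaloisField p t) m) :
    redL _ p m (X z * dd _ z f) = (2 : GaloisField p t)⁻¹ • DD _ p z z f := by
  rw [DD_apply, ← two_smul (GaloisField p t), map_smul, smul_smul,
    inv_mul_cancel₀ (two_ne (p := p) hodd), one_smul]

variable {s0 : Fin t → ℤ} {e0 : Finset (Fin t)}

lemma eop_red (hodd : Odd p) (ht : 1 < t) (hd : d ≤ p ^ t - 2) (h0 : memCase p t m d s0 e0)
    {s : Fin t → ℤ} {F : Fin t → Pol (GaloisField p t) m}
    (hA : Adm p t m d s0 e0 s F) (hr : ∀ l, redL _ p m (F l) = F l) (z : Sg m) (j : Fin t) :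
    Eop (bas z.swap) j (evT F) - evT (Function.update F j ((2 : GaloisField p t)⁻¹ • DD _ p z z (F j)))
      ∈ Yn p t m d s0 e0 (∑ l, s l - 1) := by
  have := hA.Eop hodd ht hd h0 (bas z.swap) j
  rw [lu_dir, half_DD hodd] at this
  simpa only [hr] using this

lemma adm_smul {s : Fin t → ℤ} {F : Fin t → Pol (GaloisField p t) m} {j : Fin t} {g} (c : GaloisField p t)
    (hA : Adm p t m d s0 e0 s (Function.update F j g)) : Adm p t m d s0 e0 s (Function.update F j (c • g)) := by
  have h1 := hA.update j (g := c • g) ?_ ?_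
  · simpa using h1
  · have := hA.hom j
    rw [Function.update_self] at this
    exact (homogeneousSubmodule _ _ _).smul_mem c this
  · intro h
    have := hA.sgn j h
    rw [Function.update_self] at this
    unfold SG at *
    rw [map_smul, map_smul, this, smul_comm]

lemma Thz_cover (hodd : Odd p) (ht : 1 < t) (hd : d ≤ p ^ t - 2) (h0 : memCase p t m d s0 e0)
    {s : Fin t → ℤ} {F : Fin t → Pol (GaloisField p t) m}
    (hA : Adm p t m d s0 e0 s F) (hr : ∀ l, redL _ p m (F l) = F l) (z : Sg m) (j : Fin t) {e : Ex m}
    (he : DG _ p (Sum.inl z) (F j) = ev0 (GaloisField p t) (Sum.inl z) e • F j) :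
    Thz z j (evT F) - (kap (GaloisField p t) z e) ^ (p ^ (j : ℕ)) • evT F ∈ Yn p t m d s0 e0 (∑ l, s l - 1) := by
  have h1 := eop_red hodd ht hd h0 hA hr z j
  have h2 := Eop_stab (Yn_stable hodd ht hd h0 _) (bas z) j h1
  have hA2 := adm_smul (2 : GaloisField p t)⁻¹ (hA.DD z z j)
  have h3 := eop_red hodd ht hd h0 hA2 (red_update hr j (by rw [map_smul, redL_DD])) z.swap j
  simp only [Function.update_self, Function.update_idem, Sum.swap_swap] at h3
  rw [map_sub] at h2
  have h4 := Submodule.add_mem _ h2 h3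
  rw [sub_add_sub_cancel] at h4
  have h5 : (2 : GaloisField p t)⁻¹ • DD _ p z.swap z.swap ((2 : GaloisField p t)⁻¹ • DD _ p z z (F j))
      = kap (GaloisField p t) z e • F j := by
    have he' : DD _ p z.swap z.swap (DD _ p z z (F j)) = ev0 (GaloisField p t) (Sum.inl z) e • F j := by
      rw [← he]; simp only [DG, LinearMap.comp_apply]
    rw [map_smul, he', smul_smul, smul_smul]
    congr 1
    have := two_ne (K := GaloisField p t) (p := p) hodd
    simp only [ev0, kap]
    field_simp
    ring
  rw [h5, evT_update_smul, Function.update_eq_self] at h4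
  exact h4

lemma X_mul_dd_mono (z : Sg m) (n : Ex m) :
    X z * dd (GaloisField p t) z (monomial n 1) =
      (sgn (GaloisField p t) z * n z.swap) • monomial (mv n z.swap z) 1 := by
  rw [dd_monomial, smul_monomial]
  rw [show (X z : Pol (GaloisField p t) m) = monomial (Finsupp.single z 1) 1 from rfl, monomial_mul]
  simp [mv, add_comm]

lemma Thz_mono (hodd : Odd p) (ht : 1 < t) (hd : d ≤ p ^ t - 2) (h0 : memCase p t m d s0 e0)
    {F : Fin t → Pol (GaloisField p t) m}
    (hA : Adm p t m d s0 e0 s0 F) (hr : ∀ l, redL _ p m (F l) = F l) (z : Sg m) (j : Fin t) {n : Ex m}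
    (hn : Red p n) (hnd : n.degree = lamOfN p t d s0 j) :
    Thz z j (evT (Function.update F j (monomial n 1))) -
      (kap (GaloisField p t) z n) ^ (p ^ (j : ℕ)) • evT (Function.update F j (monomial n 1)) ∈
        Yn p t m d s0 e0 (∑ l, s0 l - 2) := by
  have hp := hpp.out.two_le
  have hpj : p ^ (j : ℕ) ≠ 0 := pow_ne_zero _ (by omega)
  have hredmono : ∀ e : Ex m, Red p e → redL (GaloisField p t) p m (monomial e 1) = monomial e 1 := by
    intro e he; rw [redL_monomial, if_pos he]
  have ex1 : ∀ (w : Sg m) (e : Ex m), Red p e →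
      Eop (bas w.swap) j (evT (Function.update F j (monomial e 1))) =
      (sgn (GaloisField p t) w * e w.swap) ^ (p ^ (j : ℕ)) • evT (Function.update F j (monomial (mv e w.swap w) 1)) := by
    intro w e he
    rw [Eop_exact ht _ j _ (fun l => by rw [cv_bas']; exact Tay_deg _ _ (red_update hr j (hredmono e he) l)),
      lu_dir, Function.update_self, Function.update_idem, X_mul_dd_mono, evT_update_smul]
  rw [Thz_apply, ex1 z n hn, map_smul]
  by_cases hz0 : n z.swap = 0
  · simp only [kap, hz0, Nat.cast_zero, mul_zero, zero_mul, neg_zero]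
    rw [zero_pow hpj, zero_smul, zero_smul, sub_zero]
    exact Submodule.zero_mem _
  by_cases hz1 : n z < p - 1
  · have hr2 : Red p (mv n z.swap z) := by
      intro w
      rw [mv_apply]
      have := hn w
      split_ifs <;> (try subst_vars) <;> omega
    have := ex1 z.swap _ hr2
    rw [Sum.swap_swap] at this
    rw [this]
    have hmv : mv (mv n z.swap z) z z.swap = n := by
      have hne : z ≠ z.swap := by rcases z with i | i <;> simp
      ext w
      rw [mv_apply, mv_apply]
      by_cases h1 : w = z
      · subst h1; simp [hne, hne.symm]
      · by_cases h2 : w = z.swap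
        · subst h2; simp [hne, hne.symm, Ne.symm h1]; omega
        · simp [h1, h2, Ne.symm h1, Ne.symm h2]
    rw [hmv, smul_smul, ← mul_pow]
    have hk : sgn (GaloisField p t) z * (n z.swap : GaloisField p t) *
        (sgn (GaloisField p t) z.swap * ((mv n z.swap z) z : GaloisField p t)) = kap _ z n := by
      have hne : z ≠ z.swap := by rcases z with i | i <;> simp
      have h1 : (mv n z.swap z) z = n z + 1 := by rw [mv_apply]; simp [hne, hne.symm]
      rw [h1, sgn_swap]
      have := sgn_sq (K := GaloisField p t) z
      simp only [kap]
      push_cast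
      linear_combination (-(n z.swap : GaloisField p t) * (n z + 1)) * this
    rw [hk]; simp
  · have hz2 : n z = p - 1 := le_antisymm (hn z) (by omega)
    have hne : z ≠ z.swap := by rcases z with i | i <;> simp
    have hk : kap (GaloisField p t) z n = 0 := by
      have : ((n z : GaloisField p t) + 1) = 0 := by
        rw [hz2]
        have : ((p - 1 : ℕ) : GaloisField p t) + 1 = ((p - 1 + 1 : ℕ) : GaloisField p t) := by push_cast; rfl
        rw [this, Nat.sub_add_cancel (by omega), CharP.cast_eq_zero]
      simp [kap, this]
    rw [hk, zero_pow hpj, zero_smul, sub_zero]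
    refine Submodule.smul_mem _ _ ?_
    set h : Ex m := n - Finsupp.single z (p - 1) - Finsupp.single z.swap 1 with hh
    have hsplit : mv n z.swap z = Finsupp.single z p + h := by
      ext w
      rw [mv_apply]
      by_cases h1 : w = z
      · subst h1; simp [hh, hne, hne.symm, hz2]; omega
      · by_cases h2 : w = z.swap
        · subst h2; simp [hh, Finsupp.single_apply, hne, hne.symm, Ne.symm h1]
        · simp [hh, Finsupp.single_apply, h1, h2, Ne.symm h1, Ne.symm h2]
    have hhz : h z = 0 := by simp [hh, hz2, hne.symm]
    have hdeg : p + h.degree = n.degree := by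
      have := congrArg Finsupp.degree hsplit
      rw [map_add, Finsupp.degree_single] at this
      rw [← this]
      have h3 : mv n z.swap z = n - Finsupp.single z.swap 1 + Finsupp.single z 1 := rfl
      have h4 : (n - Finsupp.single z.swap 1) + Finsupp.single z.swap 1 = n := by
        ext w
        by_cases h2 : z.swap = w
        · subst h2; simp; omega
        · simp [Finsupp.single_apply, h2]
      have h5 := congrArg Finsupp.degree h4
      rw [map_add, Finsupp.degree_single] at h5
      rw [h3, map_add, Finsupp.degree_single]; omega
    have hmon : (monomial (mv n z.swap z) 1 : Pol (GaloisField p t) m) = X z ^ p * monomial h 1 := by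
      rw [hsplit, X_pow_eq_monomial, monomial_mul, one_mul]
    rw [hmon, carry ht]
    have hlam : (p : ℤ) ≤ lamOf p t d s0 j := by
      have := hA.nn j
      have h6 : ((lamOfN p t d s0 j : ℕ) : ℤ) = lamOf p t d s0 j := lamN_cast this
      omega
    have hC := hA.carry ht j hlam z (h := monomial h 1) (isHomogeneous_monomial _ (by omega))
    have hE := hC.Eop hodd ht hd h0 (bas z) j
    have hz' := lu_dir (p := p) (t := t) z.swap (monomial h 1)
    rw [Sum.swap_swap] at hz'
    have hj : j ≠ j + 1 := (add_one_ne ht j).symm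
    rw [Function.update_of_ne hj, Function.update_self, hz', X_mul_dd_mono, Sum.swap_swap, hhz] at hE
    simp only [Nat.cast_zero, mul_zero, zero_smul, map_zero, evT_update_zero, sub_zero] at hE
    rw [dn_sum] at hE
    rw [show ∑ l, s0 l - 2 = ∑ l, s0 l - 1 - 1 by ring]
    simpa [Function.update_of_ne hj.symm] using hE

lemma Thz_top (hodd : Odd p) (ht : 1 < t) (hd : d ≤ p ^ t - 2) (h0 : memCase p t m d s0 e0)
    {F : Fin t → Pol (GaloisField p t) m} {e : Fin t → Ex m}
    (hF : ∀ j, DgAt p (lamOfN p t d s0 j) (j ∈ e0) (e j) (F j)) (z : Sg m) (j : Fin t) :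
    Thz z j (evT F) - (kap (GaloisField p t) z (e j)) ^ (p ^ (j : ℕ)) • evT F ∈ Yn p t m d s0 e0 (∑ l, s0 l - 2) := by
  have hI : ∀ j, IsDg p (lamOfN p t d s0 j) (j ∈ e0) (F j) := fun j => ⟨e j, hF j⟩
  have hA := adm_of_SBF h0 (leSd_refl _ _) hI
  have hr : ∀ l, redL _ p m (F l) = F l := fun l => (hI l).red
  have h1 := Thz_mono hodd ht hd h0 hA hr z j (hF j).1 (hF j).2.1
  obtain ⟨c, hc, hc0⟩ := (hF j).shape
  let c' := c ^ (p ^ (j : ℕ))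
  have hev : evT F = evT (Function.update F j (monomial (e j) 1)) +
      c' • evT (Function.update F j (monomial (flp p (e j)) 1)) := by
    conv_lhs => rw [← Function.update_eq_self j F]
    rw [hc, evT_update_add, evT_update_smul]
  by_cases hcz : c = 0
  · have : c' = 0 := by simp [c', hcz, hpp.out.ne_zero]
    rw [this, zero_smul, add_zero] at hev
    rw [hev]; exact h1
  · have hdeg := degree_flp (hF j).1
    have hn := hc0 hcz
    have h2 := Thz_mono hodd ht hd h0 hA hr z j (red_flp (e j)) (by rw [(hF j).2.1] at hdeg; omega)
    rw [kap_flp z (hF j).1] at h2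
    have := Submodule.add_mem _ h1 (Submodule.smul_mem _ c' h2)
    convert this using 1
    rw [hev, map_add, map_smul, smul_add, smul_sub, smul_comm c']
    abel

lemma cover_eq {s : Fin t → ℤ} (h : ∀ l, s l ≤ s0 l) (hs : ∑ l, s l = ∑ l, s0 l - 1) :
    ∃ j, s = dn s0 (j + 1) := by
  have hne : ∃ l, s l < s0 l := by
    by_contra hc
    push Not at hc
    have := Finset.sum_le_sum (fun l (_ : l ∈ Finset.univ) => hc l)
    omega
  obtain ⟨l, hl⟩ := hne
  refine ⟨l - 1, ?_⟩
  rw [sub_add_cancel]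
  have h1 : ∀ i ∈ Finset.univ, s i ≤ dn s0 l i := by
    intro i _
    by_cases hi : i = l
    · subst hi; rw [dn_self]; omega
    · rw [dn_ne _ hi]; exact h i
  have h2 : ∑ i, s i = ∑ i, dn s0 l i := by rw [dn_sum]; exact hs
  have := (Finset.sum_eq_sum_iff_of_le h1).1 h2
  ext i; exact this i (Finset.mem_univ _)

lemma step3 (hodd : Odd p) (ht : 1 < t) (hd : d ≤ p ^ t - 2) (h0 : memCase p t m d s0 e0)
    {M : Submodule (GaloisField p t) (SympV p t m → GaloisField p t)} (hM : SpStable M)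
    (hY2 : Yn p t m d s0 e0 (∑ l, s0 l - 2) ≤ M)
    (hsup : Ymod p t m d s0 e0 ≤ M ⊔ Yltmod p t m d s0 e0)
    {g : Fin t → Pol (GaloisField p t) m} (hg : ∀ j, IsDg p (lamOfN p t d s0 j) (j ∈ e0) (g j)) : evT g ∈ M := by
  have hb : evT g ∈ Ymod p t m d s0 e0 :=
    Submodule.subset_span ⟨s0, e0, h0, leSd_refl _ _, (isSBF_iff _ _ _).2 ⟨g, hg, rfl⟩⟩
  choose eg heg using hg
  have heg : ∀ j, DgAt p (lamOfN p t d s0 j) (j ∈ e0) (eg j) (g j) := heg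
  let I := {q : ((Fin t → ℤ) × Finset (Fin t)) × (Fin t → Ex m) × (Fin t → Pol (GaloisField p t) m) //
    memCase p t m d q.1.1 q.1.2 ∧ leSd p t m d q.1.1 q.1.2 s0 e0 ∧ ∑ l, q.1.1 l = ∑ l, s0 l - 1 ∧
    ∀ j, DgAt p (lamOfN p t d q.1.1 j) (j ∈ q.1.2) (q.2.1 j) (q.2.2 j)}
  have hlow : Yltmod p t m d s0 e0 ≤ Submodule.span _ (Set.range (fun i : I => evT i.1.2.2)) ⊔
      Yn p t m d s0 e0 (∑ l, s0 l - 2) := by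
    rw [Yltmod_eq h0]
    unfold Yn
    rw [Submodule.span_le]
    rintro f ⟨s', e', h1, h2, h3, h4⟩
    by_cases hs : ∑ l, s' l = ∑ l, s0 l - 1
    · obtain ⟨g', hg', rfl⟩ := (isSBF_iff _ _ _).1 h4
      choose e'' he'' using hg'
      exact Submodule.mem_sup_left (Submodule.subset_span ⟨⟨((s', e'), (e'', g')), h1, h2, hs, he''⟩, rfl⟩)
    · exact Submodule.mem_sup_right (Submodule.subset_span ⟨s', e', h1, h2, by omega, h4⟩)
  obtain ⟨w, hw, y, hy, hwy⟩ := Submodule.mem_sup.1 (hsup hb)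
  obtain ⟨x, hx, y', hy', rfl⟩ := Submodule.mem_sup.1 (hlow hy)
  rw [Finsupp.mem_span_range_iff_exists_finsupp] at hx
  obtain ⟨c, hc⟩ := hx
  have hbx : evT g - x ∈ M := by
    rw [← hwy]
    have := M.add_mem hw (hY2 hy')
    convert this using 1
    abel
  let v : Option I → (SympV p t m → GaloisField p t) := fun o => o.elim (evT g) (fun i => -(c i • evT i.1.2.2))
  let χ : Option I → (Sg m × Fin t) → GaloisField p t :=
    fun o k => kap _ k.1 (o.elim (eg k.2) (fun i => i.1.2.1 k.2)) ^ (p ^ (k.2 : ℕ))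
  have hsum : ∑ o ∈ Finset.insertNone c.support, v o ∈ M := by
    rw [Finset.sum_insertNone]
    have : ∑ i ∈ c.support, v (some i) = - x := by
      rw [← hc, Finsupp.sum, ← Finset.sum_neg_distrib]; rfl
    rw [this]
    simpa [v, sub_eq_add_neg] using hbx
  have hv : ∀ o ∈ Finset.insertNone c.support, ∀ k : Sg m × Fin t, Thz k.1 k.2 (v o) - χ o k • v o ∈ M := by
    intro o _ k
    rcases o with _ | i
    · exact hY2 (Thz_top hodd ht hd h0 heg k.1 k.2)
    · obtain ⟨h1, h2, h3, h4⟩ := i.2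
      have hI : ∀ j, IsDg p (lamOfN p t d i.1.1.1 j) (j ∈ i.1.1.2) (i.1.2.2 j) := fun j => ⟨_, h4 j⟩
      have := Thz_cover hodd ht hd h0 (adm_of_SBF h1 h2 hI) (fun l => (hI l).red) k.1 k.2 ((h4 k.2).eig _)
      rw [h3, show ∑ l, s0 l - 1 - 1 = ∑ l, s0 l - 2 by ring] at this
      have := M.smul_mem (-c i) (hY2 this)
      simp only [v, χ, Option.elim, map_smul, map_neg]
      rw [smul_sub, smul_comm] at this
      simpa using this
  have h1 : ∑ o ∈ Finset.insertNone c.support with χ o = χ none, v o ∈ M := by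
    convert sep M (fun k : Sg m × Fin t => Thz k.1 k.2)
      (fun k x hx => Thz_stab hM k.1 k.2 x hx) χ none _ v hv hsum
  have h2 : (Finset.insertNone c.support).filter (fun o => χ o = χ none) = {none} := by
    ext o
    rcases o with _ | i
    · simp
    · simp only [Finset.mem_filter, Finset.mem_singleton, reduceCtorEq, iff_false, not_and]
      intro _ hχ
      obtain ⟨h1, h2, h3, h4⟩ := i.2
      obtain ⟨j, hj⟩ := cover_eq (leSd_iff.1 h2).1 h3
      have hk : ∀ z, kap (GaloisField p t) z (i.1.2.1 (j + 1)) = kap _ z (eg (j + 1)) :=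
        fun z => frob_inj _ (congrFun hχ (z, j + 1))
      have hpar := kap_parity (h4 (j+1)).1 (heg (j+1)).1 hk
      rw [(h4 (j+1)).2.1, (heg (j+1)).2.1] at hpar
      have hl : lamOf p t d i.1.1.1 (j + 1) = lamOf p t d s0 (j + 1) + 1 := by
        rw [hj]; exact lam_dn_j1 ht s0 j
      have hnn := (((memCase_iff _ _).1 h0).2.1 (j + 1)).1
      unfold lamOfN at hpar
      omega
  rw [h2, Finset.sum_singleton] at h1
  exact h1

end P11a
end


noncomputable section
set_option linter.unusedSectionVars false
set_option linter.unusedSimpArgs false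

open MvPolynomial

section P12a
variable {K : Type} [Field K] {p m : ℕ} [hpp : Fact p.Prime] [hch : CharP K p]

lemma exists_dg {n : ℕ} {pl : Prop} {e : Ex m} (he : Red p e) (hd : e.degree = n)
    (hf : n = m * (p - 1) → flp p e ≠ e) (hpl : pl → n = m * (p - 1)) : ∃ g : Pol K m, DgAt p n pl e g := by
  by_cases hn : n = m * (p - 1)
  · exact ⟨_, he, hd, Or.inr (Or.inr ⟨hn, hf hn, rfl⟩)⟩
  · exact ⟨_, he, hd, Or.inl ⟨hn, fun h => hn (hpl h), rfl⟩⟩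

lemma sum_cap (x : Sg m) (a b c : ℕ) :
    ∑ z : Sg m, (if z = x then a else if z = x.swap then b else c) = a + b + (2 * m - 2) * c := by
  have hne : x.swap ≠ x := by rcases x with i | i <;> simp
  rw [← Finset.add_sum_erase _ _ (Finset.mem_univ x),
    ← Finset.add_sum_erase _ _ (Finset.mem_erase.2 ⟨hne, Finset.mem_univ x.swap⟩)]
  rw [Finset.sum_congr rfl (g := fun _ => c)]
  · rw [Finset.sum_const, Finset.card_erase_of_mem (Finset.mem_erase.2 ⟨hne, Finset.mem_univ _⟩),
      Finset.card_erase_of_mem (Finset.mem_univ _)]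
    simp only [if_true, hne, if_false, Finset.card_univ, Fintype.card_sum, Fintype.card_fin, smul_eq_mul]
    rw [show m + m - 1 - 1 = 2 * m - 2 by omega]; ring
  · intro z hz
    simp only [Finset.mem_erase] at hz
    simp [hz.1, hz.2.1]

lemma pick_j (hodd : Odd p) (x : Sg m) {l : ℕ} (hl : l + p ≤ 2 * (m * (p - 1))) (hm : 2 ≤ m) :
    ∃ e : Ex m, Red p e ∧ e.degree = l ∧ e x = 0 ∧ e x.swap + 2 ≤ p := by
  have hp := hpp.out.two_le
  obtain ⟨e, h1, h2⟩ := exists_cap (fun z : Sg m => if z = x then 0 else if z = x.swap then p - 2 else p - 1) l (by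
    rw [sum_cap]
    have : (2 * m - 2) * (p - 1) + 2 * (p - 1) = 2 * (m * (p - 1)) := by
      rw [← add_mul, show 2 * m - 2 + 2 = 2 * m by omega]; ring
    omega)
  have hne : x.swap ≠ x := by rcases x with i | i <;> simp
  refine ⟨e, fun z => (h1 z).trans (by split_ifs <;> omega), h2, ?_, ?_⟩
  · have := h1 x; simpa using this
  · have := h1 x.swap; simp [hne] at this; omega

lemma pick_j1 (hodd : Odd p) (x : Sg m) {l : ℕ} (hl : l + 1 ≤ 2 * (m * (p - 1))) (hm : 2 ≤ m) :
    ∃ e : Ex m, Red p e ∧ e.degree = l ∧ e x + 2 ≤ p ∧ (l ≤ m * (p - 1) → e x = 0 ∧ e x.swap = 0) := by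
  have hp := hpp.out.two_le
  have hne : x.swap ≠ x := by rcases x with i | i <;> simp
  have hs : (2 * m - 2) * (p - 1) + 2 * (p - 1) = 2 * (m * (p - 1)) := by
    rw [← add_mul, show 2 * m - 2 + 2 = 2 * m by omega]; ring
  have hs2 : 2 * (p - 1) ≤ m * (p - 1) := Nat.mul_le_mul_right _ hm
  by_cases hN : l ≤ m * (p - 1)
  · obtain ⟨e, h1, h2⟩ := exists_cap (fun z : Sg m => if z = x then 0 else if z = x.swap then 0 else p - 1) l (by
      rw [sum_cap]; omega)
    have a1 := h1 x
    have a2 := h1 x.swap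
    simp [hne] at a1 a2
    exact ⟨e, fun z => (h1 z).trans (by split_ifs <;> omega), h2, by omega, fun _ => ⟨a1, a2⟩⟩
  · obtain ⟨e, h1, h2⟩ := exists_cap (fun z : Sg m => if z = x then p - 2 else if z = x.swap then p - 1 else p - 1) l (by
      rw [sum_cap]; omega)
    have a1 := h1 x
    simp at a1
    exact ⟨e, fun z => (h1 z).trans (by split_ifs <;> omega), h2, by omega, fun h => absurd h hN⟩

end P12a

section P12b
variable {p t m d : ℕ} [hpp : Fact p.Prime] [hnz : NeZero t]
variable {s0 : Fin t → ℤ} {e0 : Finset (Fin t)}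

lemma lamN_le {s : Fin t → ℤ} {e : Finset (Fin t)} (h : memCase p t m d s e) (l : Fin t) :
    lamOfN p t d s l ≤ 2 * (m * (p - 1)) := by
  have h1 := ((memCase_iff _ _).1 h).2.1 l
  have h2 := lamN_cast (p := p) (t := t) (d := d) h1.1
  have h3 := cast_N (p := p) (m := m)
  have : (lamOfN p t d s l : ℤ) ≤ (2 * (m * (p - 1)) : ℕ) := by
    rw [h2]; push_cast at h3 ⊢; rw [h3]; linarith [h1.2]
  exact_mod_cast this

lemma mem_e_imp {s : Fin t → ℤ} {e : Finset (Fin t)} (h : memCase p t m d s e) {l : Fin t} (hl : l ∈ e) :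
    lamOfN p t d s l = m * (p - 1) := by
  have h1 := (memCase_iff _ _).1 h
  have h2 := mem_Jset.1 (h1.2.2 hl)
  exact (lamN_eq_iff (h1.2.1 l).1).2 h2

lemma step4 (hodd : Odd p) (ht : 1 < t) (hm : 2 ≤ m) (hd : d ≤ p ^ t - 2) (h0 : memCase p t m d s0 e0)
    {M : Submodule (GaloisField p t) (SympV p t m → GaloisField p t)} (hM : SpStable M)
    (hY2 : Yn p t m d s0 e0 (∑ l, s0 l - 2) ≤ M)
    (hall : ∀ g : Fin t → Pol (GaloisField p t) m, (∀ j, IsDg p (lamOfN p t d s0 j) (j ∈ e0) (g j)) → evT g ∈ M)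
    {j : Fin t} {e1 : Finset (Fin t)} (h1 : memCase p t m d (dn s0 (j + 1)) e1)
    (hle : leSd p t m d (dn s0 (j + 1)) e1 s0 e0) {g : Fin t → Pol (GaloisField p t) m}
    (hg : ∀ l, IsDg p (lamOfN p t d (dn s0 (j + 1)) l) (l ∈ e1) (g l)) : evT g ∈ M := by
  have hp := hpp.out.two_le
  have hp3 : 3 ≤ p := by
    rcases hodd with ⟨k, hk⟩; omega
  have hj : j ≠ j + 1 := (add_one_ne ht j).symm
  set s1 := dn s0 (j + 1) with hs1
  let x : Sg m := Sum.inl ⟨0, by omega⟩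
  have hx : x.swap ≠ x := by simp [x]
  have n0 := fun l => (((memCase_iff _ _).1 h0).2.1 l).1
  have n1 := fun l => (((memCase_iff _ _).1 h1).2.1 l).1
  have hlj : lamOfN p t d s0 j = lamOfN p t d s1 j + p := by
    have := lam_dn_j (p := p) (d := d) ht s0 j
    have := n1 j
    unfold lamOfN; rw [hs1] at *; omega
  have hlj1 : lamOfN p t d s1 (j + 1) = lamOfN p t d s0 (j + 1) + 1 := by
    have := lam_dn_j1 (p := p) (d := d) ht s0 j
    have := n0 (j + 1)
    unfold lamOfN; rw [hs1] at *; omega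
  have hlne : ∀ l, l ≠ j → l ≠ j + 1 → lamOfN p t d s1 l = lamOfN p t d s0 l := by
    intro l a b; unfold lamOfN; rw [hs1, lam_dn_ne s0 a b]
  -- choice of exponents
  obtain ⟨a, ha1, ha2, ha3, ha4⟩ := pick_j (p := p) hodd x (l := lamOfN p t d s1 j)
    (by rw [← hlj]; exact lamN_le h0 j) hm
  obtain ⟨b, hb1, hb2, hb3, hb4⟩ := pick_j1 (p := p) hodd x (l := lamOfN p t d s0 (j + 1))
    (by rw [← hlj1]; exact lamN_le h1 _) hm
  set a' : Ex m := a + Finsupp.single x (p - 1) + Finsupp.single x.swap 1 with ha'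
  have a'x : a' x = p - 1 := by simp [ha', ha3, hx]
  have a'y : a' x.swap = a x.swap + 1 := by simp [ha', Finsupp.single_apply, hx.symm]
  have a'r : Red p a' := by
    intro z
    have := ha1 z
    by_cases h2 : z = x
    · rw [h2, a'x]
    · by_cases h3 : z = x.swap
      · rw [h3, a'y]; omega
      · simp [ha', Finsupp.single_apply, Ne.symm h2, Ne.symm h3]; exact this
  have a'd : a'.degree = lamOfN p t d s0 j := by
    rw [ha', map_add, map_add, Finsupp.degree_single, Finsupp.degree_single, ha2, hlj]; omega
  have a'f : flp p a' ≠ a' := by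
    intro h
    have := DFunLike.congr_fun h x
    rw [flp_apply, a'x, a'y] at this; omega
  have af : flp p a ≠ a := by
    intro h
    have := DFunLike.congr_fun h x
    rw [flp_apply, ha3] at this; omega
  obtain ⟨fj, hfj⟩ := exists_dg (K := GaloisField p t) (p := p) (pl := j ∈ e0) a'r a'd (fun _ => a'f) (mem_e_imp h0)
  obtain ⟨fk, hfk⟩ := exists_dg (K := GaloisField p t) (p := p) (pl := (j + 1) ∈ e0) hb1 hb2 (fun hN h => by
    have h2 := hb4 hN.le
    have := DFunLike.congr_fun h x
    rw [flp_apply, h2.1, h2.2] at this; omega) (mem_e_imp h0)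
  set f : Fin t → Pol (GaloisField p t) m := Function.update (Function.update g j fj) (j + 1) fk with hf
  have fj_eq : f j = fj := by simp [hf, hj]
  have fk_eq : f (j + 1) = fk := by simp [hf]
  have fl_eq : ∀ l, l ≠ j → l ≠ j + 1 → f l = g l := by intro l a b; simp [hf, a, b]
  have hfD : ∀ l, IsDg p (lamOfN p t d s0 l) (l ∈ e0) (f l) := by
    intro l
    by_cases l1 : l = j
    · subst l1; rw [fj_eq]; exact ⟨_, hfj⟩
    by_cases l2 : l = j + 1
    · subst l2; rw [fk_eq]; exact ⟨_, hfk⟩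
    rw [fl_eq l l1 l2, ← hlne l l1 l2]
    have : (l ∈ e0) = (l ∈ e1) := by
      apply propext
      by_cases hN : lamOfN p t d s1 l = m * (p - 1)
      · symm
        apply (leSd_iff.1 hle).2 l
        rw [mem_Zset]
        refine ⟨dn_ne _ l2, dn_ne _ (fun h => l1 (add_right_cancel h)), ?_⟩
        exact (lamN_eq_iff (n1 l)).1 hN
      · constructor
        · intro h; exact absurd ((hlne l l1 l2).trans (mem_e_imp h0 h)) hN
        · intro h; exact absurd (mem_e_imp h1 h) hN
    rw [this]; exact hg l
  have hfM := hall f hfD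
  have hfA := adm_of_SBF h0 (leSd_refl _ _) hfD
  have hfr : ∀ l, redL _ p m (f l) = f l := fun l => (hfD l).red
  -- apply the operator
  have hE := Eop_stab hM (bas x.swap) j hfM
  rw [Eop_exact ht _ j _ (fun l => by rw [cv_bas']; exact Tay_deg _ _ (hfr l)), lu_dir] at hE
  obtain ⟨c, hc, -⟩ := hfj.shape
  have hflip : flp p a' x.swap = 0 := by
    rw [flp_apply, Sum.swap_swap, a'x]; omega
  have hmv : mv a' x.swap x = Finsupp.single x p + a := by
    ext w
    rw [mv_apply]
    by_cases h1 : w = x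
    · rw [h1, a'x]; simp [hx, ha3, hx.symm]; omega
    · by_cases h2 : w = x.swap
      · rw [h2, a'y]; simp [Finsupp.single_apply, hx, hx.symm]
      · simp [ha', Finsupp.single_apply, h1, h2, Ne.symm h1, Ne.symm h2]
  have hXdd : X x * dd (GaloisField p t) x (f j) =
      (sgn (GaloisField p t) x * (a' x.swap : ℕ)) • (X x ^ p * monomial a 1) := by
    rw [fj_eq, hc, map_add, map_smul, mul_add, mul_smul_comm, X_mul_dd_mono, X_mul_dd_mono, hflip, hmv,
      X_pow_eq_monomial, monomial_mul, one_mul]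
    simp
  rw [hXdd, evT_update_smul, Submodule.smul_mem_iff _ (pow_ne_zero _ (mul_ne_zero (sgn_ne _)
    (cast_ne_zero_small (p := p) (a'r _) (by rw [a'y]; omega)))), carry ht] at hE
  have hlam : (p : ℤ) ≤ lamOf p t d s0 j := by
    have := lamN_cast (n0 j)
    omega
  have hC := hfA.carry ht j hlam x (h := monomial a 1) (isHomogeneous_monomial _ (by omega))
  have hR := hY2 (by
    have := hC.redL_mem hodd ht hd h0
    rw [dn_sum, sub_sub] at this
    exact this)
  have hR2 := M.sub_mem hE hR
  rw [sub_sub_cancel] at hR2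
  -- identify the reduced tuple
  set b' : Ex m := b + Finsupp.single x 1 with hb'
  have b'r : Red p b' := by
    intro z
    have := hb1 z
    by_cases h2 : x = z
    · subst h2; simp [hb']; omega
    · simp [hb', Finsupp.single_apply, h2]; exact this
  have b'd : b'.degree = lamOfN p t d s1 (j + 1) := by
    rw [hb', map_add, Finsupp.degree_single, hb2, hlj1]
  have hk : redL _ p m (X x * f (j + 1)) = monomial b' 1 := by
    obtain ⟨c', hc', hc0⟩ := hfk.shape
    rw [fk_eq, hc', mul_add, mul_smul_comm, map_add, map_smul]
    rw [show (X x : Pol (GaloisField p t) m) = monomial (Finsupp.single x 1) 1 from rfl, monomial_mul, monomial_mul,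
      redL_monomial, redL_monomial, add_comm (Finsupp.single x 1) b, if_pos b'r, one_mul]
    by_cases hz : c' = 0
    · rw [hz, zero_smul, add_zero, hb']
    · have h2 := hb4 (hc0 hz).le
      rw [if_neg, smul_zero, add_zero]
      intro h
      have := h x
      simp [flp_apply, h2.2] at this
  have hF : (fun l => redL (GaloisField p t) p m
      (Function.update (Function.update f j (monomial a 1)) (j + 1) (X x * f (j + 1)) l)) =
      Function.update (Function.update g j (monomial a 1)) (j + 1) (monomial b' 1) := by
    ext1 l
    by_cases l2 : l = j + 1
    · subst l2; simp only [Function.update_self]; exact hk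
    · rw [Function.update_of_ne l2, Function.update_of_ne l2]
      by_cases l1 : l = j
      · subst l1; simp only [Function.update_self]; rw [redL_monomial, if_pos ha1]
      · rw [Function.update_of_ne l1, Function.update_of_ne l1, hfr, fl_eq l l1 l2]
  rw [hF] at hR2
  have hgA := adm_of_SBF h1 hle hg
  have hgr : ∀ l, redL _ p m (g l) = g l := fun l => (hg l).red
  have hjZ : j ∉ Zset p t m d s1 s0 := by
    intro h
    have := (mem_Zset.1 h).2.1
    rw [hs1, dn_self] at this; omega
  have hkZ : j + 1 ∉ Zset p t m d s1 s0 := by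
    intro h
    have := (mem_Zset.1 h).1
    rw [hs1, dn_self] at this; omega
  have A1 := hgA.update j (g := monomial a 1) (isHomogeneous_monomial _ ha2) (fun h => absurd h hjZ)
  have A2 := A1.update (j + 1) (g := monomial b' 1) (isHomogeneous_monomial _ b'd) (fun h => absurd h hkZ)
  have r1 := red_update hgr j (g := monomial a 1) (by rw [redL_monomial, if_pos ha1])
  have r2 := red_update r1 (j + 1) (g := monomial b' 1) (by rw [redL_monomial, if_pos b'r])
  have hY3 : Yn p t m d s0 e0 (∑ l, s1 l - 1) ≤ M := by
    rw [hs1, dn_sum, sub_sub]; exact hY2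
  have Q1 := slot_reach0 hodd ht hd h0 A2 r2 hM hY3 (j + 1) hR2 (e := b') (by simp) b'r b'd (fun hN h => by
    have h2 := hb4 (by omega)
    have := DFunLike.congr_fun h x
    simp [flp_apply, hb', h2.1, h2.2, hx.symm] at this
    omega) (hg (j + 1))
  have hup : Function.update (Function.update g j (monomial a 1)) (j + 1) (g (j + 1)) =
      Function.update g j (monomial a 1) := by
    conv_lhs => rw [show g (j + 1) = Function.update g j (monomial a 1) (j + 1) by simp [hj.symm]]
    exact Function.update_eq_self _ _
  rw [Function.update_idem, hup] at Q1
  have Q2 := slot_reach0 hodd ht hd h0 A1 r1 hM hY3 j Q1 (e := a) (by simp) ha1 ha2 (fun _ => af) (hg j)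
  rwa [Function.update_idem, Function.update_eq_self] at Q2

lemma stable_sup {A B : Submodule (GaloisField p t) (SympV p t m → GaloisField p t)} (hA : SpStable A)
    (hB : SpStable B) : SpStable (A ⊔ B) := by
  intro g hg h hh
  obtain ⟨a, ha, b, hb, rfl⟩ := Submodule.mem_sup.1 hh
  exact Submodule.mem_sup.2 ⟨_, hA g hg a ha, _, hB g hg b hb, rfl⟩

lemma Ymod_mono {s1 : Fin t → ℤ} {e1 : Finset (Fin t)} (h : leSd p t m d s1 e1 s0 e0) :
    Ymod p t m d s1 e1 ≤ Ymod p t m d s0 e0 := by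
  unfold Ymod
  apply Submodule.span_mono
  rintro f ⟨s', e', a1, a2, a3⟩
  exact ⟨s', e', a1, leSd_trans a2 h, a3⟩

lemma Yltmod_le : Yltmod p t m d s0 e0 ≤ Ymod p t m d s0 e0 := by
  unfold Ymod Yltmod
  apply Submodule.span_mono
  rintro f ⟨s', e', a1, a2, _, a3⟩
  exact ⟨s', e', a1, a2, a3⟩

lemma tprime (hodd : Odd p) (ht : 1 < t) (hm : 2 ≤ m) (hd : d ≤ p ^ t - 2) (n : ℕ) :
    ∀ (s0 : Fin t → ℤ) (e0 : Finset (Fin t)), memCase p t m d s0 e0 → (∑ l, s0 l).toNat = n →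
    ∀ W : Submodule (GaloisField p t) (SympV p t m → GaloisField p t), SpStable W →
      Ymod p t m d s0 e0 ≤ W ⊔ Yltmod p t m d s0 e0 → Ymod p t m d s0 e0 ≤ W := by
  induction n using Nat.strong_induction_on with
  | _ n ih =>
  intro s0 e0 h0 hn W hW hsup
  by_contra hcon
  have hnn : ∀ {s : Fin t → ℤ} {e : Finset (Fin t)}, memCase p t m d s e → 0 ≤ ∑ l, s l := by
    intro s e h
    exact Finset.sum_nonneg (fun l _ => (caseLo_nonneg d).trans (((memCase_iff _ _).1 h).1 l).1)
  obtain ⟨M, ⟨hWM, hM, hMn⟩, hmax⟩ := (wellFounded_gt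
    (α := Submodule (GaloisField p t) (SympV p t m → GaloisField p t))).has_min
    {M | W ≤ M ∧ SpStable M ∧ ¬ Ymod p t m d s0 e0 ≤ M} ⟨W, le_refl _, hW, hcon⟩
  have hsupM : Ymod p t m d s0 e0 ≤ M ⊔ Yltmod p t m d s0 e0 := hsup.trans (sup_le_sup_right hWM _)
  have hcov : ∀ j e1, memCase p t m d (dn s0 (j + 1)) e1 → leSd p t m d (dn s0 (j + 1)) e1 s0 e0 →
      Yltmod p t m d (dn s0 (j + 1)) e1 ≤ M := by
    intro j e1 h1 hle
    by_contra hno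
    have hst : SpStable (M ⊔ Yltmod p t m d (dn s0 (j + 1)) e1) :=
      stable_sup hM (by rw [Yltmod_eq h1]; exact Yn_stable hodd ht hd h1 _)
    have hY : Ymod p t m d s0 e0 ≤ M ⊔ Yltmod p t m d (dn s0 (j + 1)) e1 := by
      by_contra hY
      refine hmax _ ⟨hWM.trans le_sup_left, hst, hY⟩ ?_
      exact lt_of_le_of_ne le_sup_left (fun h => hno (by rw [h]; exact le_sup_right))
    have hlt : (∑ l, dn s0 (j + 1) l).toNat < n := by
      have := hnn h0
      have := hnn h1
      rw [dn_sum] at *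
      omega
    have := ih _ hlt _ e1 h1 rfl M hM ((Ymod_mono hle).trans hY)
    exact hno (Yltmod_le.trans this)
  have hY2 : Yn p t m d s0 e0 (∑ l, s0 l - 2) ≤ M := by
    unfold Yn
    rw [Submodule.span_le]
    rintro f ⟨s2, e2, a1, a2, a3, a4⟩
    obtain ⟨j, e1, b1, b2, b3⟩ := interp ht hm hd h0 a1 a2 (by rintro rfl; omega)
    refine hcov j e1 b1 b2 (Submodule.subset_span ⟨s2, e2, a1, b3, ?_, a4⟩)
    rintro ⟨rfl, -⟩
    rw [dn_sum] at a3; omega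
  have hall := fun (g : Fin t → Pol (GaloisField p t) m)
    (hg : ∀ j, IsDg p (lamOfN p t d s0 j) (j ∈ e0) (g j)) => step3 hodd ht hd h0 hM hY2 hsupM hg
  have hY1 : Yltmod p t m d s0 e0 ≤ M := by
    rw [Yltmod_eq h0]
    unfold Yn
    rw [Submodule.span_le]
    rintro f ⟨s2, e2, a1, a2, a3, a4⟩
    by_cases hs : ∑ l, s2 l = ∑ l, s0 l - 1
    · obtain ⟨j, rfl⟩ := cover_eq (leSd_iff.1 a2).1 hs
      obtain ⟨g, hg, rfl⟩ := (isSBF_iff _ _ _).1 a4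
      exact step4 hodd ht hm hd h0 hM hY2 hall a1 a2 hg
    · exact hY2 (Submodule.subset_span ⟨s2, e2, a1, a2, by omega, a4⟩)
  exact hMn (hsupM.trans (sup_le le_rfl hY1))

end P12b

theorem Y_cyclic_aux (p t m d : ℕ) [Fact p.Prime] [NeZero t] (hodd : Odd p) (ht : 1 < t) (hm : 2 ≤ m)
    (hd : d ≤ p ^ t - 2) (s : Fin t → ℤ) (eps : Finset (Fin t)) (hmem : memCase p t m d s eps) :
    ∀ f ∈ Ymod p t m d s eps, f ∉ Yltmod p t m d s eps →
      sInf {W : Submodule (GaloisField p t) (SympV p t m → GaloisField p t) | SpStable W ∧ f ∈ W} =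
        Ymod p t m d s eps := by
  intro f hf hfn
  have hYs : SpStable (Ymod p t m d s eps) := by rw [Ymod_eq]; exact Yn_stable hodd ht hd hmem _
  have hYl : SpStable (Yltmod p t m d s eps) := by rw [Yltmod_eq hmem]; exact Yn_stable hodd ht hd hmem _
  refine le_antisymm (sInf_le ⟨hYs, hf⟩) (le_sInf ?_)
  rintro W ⟨hW, hfW⟩
  refine tprime hodd ht hm hd _ s eps hmem rfl W hW ?_
  exact top_in hodd ht hd hmem (stable_sup hW hYl) le_sup_right hf hfn (le_sup_left (a := W) hfW)

end

/-- Any `f ∈ Y(s,ε)[d] \ Y_<(s,ε)[d]` generates `Y(s,ε)[d]` as a `kSp(V)`-module: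
the smallest `Sp(V)`-stable `k`-subspace of `k[V]` containing `f` equals
`Y(s,ε)[d]`. (For `d = 0` read `Y(s,ε)` and `Y_<(s,ε)`.) -/
theorem Y_cyclic (p t m d : ℕ) [Fact p.Prime] [NeZero t]
    (hodd : Odd p) (ht : 1 < t) (hm : 2 ≤ m) (hd : d ≤ p ^ t - 2)
    (s : Fin t → ℤ) (eps : Finset (Fin t))
    (hmem : memCase p t m d s eps) :
    ∀ f ∈ Ymod p t m d s eps, f ∉ Yltmod p t m d s eps →
      sInf {W : Submodule (GaloisField p t) (SympV p t m → GaloisField p t) |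
        SpStable W ∧ f ∈ W} = Ymod p t m d s eps := by
  exact Y_cyclic_aux p t m d hodd ht hm hd s eps hmem

end
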